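/- arXiv:math/0001122 — 2 statements merged into one kernel-verified Lean document; each statement's English description precedes it below -/
import Mathlib

section
/- Let G ⊂ ℂ be a Jordan domain that is symmetric with respect to the real axis (invariant under complex conjugation) with 0 ∈ G, and let ξ ∈ ∂G be real with G ⊆ {z : Re z < ξ}. Let φ be the normalized conformal map of G with respect to z₀ = 0 and let B_n be the Bieberbach polynomials of G with respect to z₀ = 0. If φ admits no analytic continuation to any neighbourhood of the closure of G (i.e. there is no open set U containing cl(G) and no analytic function g on U with g = φ on G), then for every real x > ξ one has limsup_{n→∞} |B_n(x)| = ∞. -/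
open MeasureTheory Filter

/-- A Jordan domain: a bounded simply connected open subset of `ℂ` whose
boundary is a Jordan curve (the image of an injective continuous map of the
unit circle). -/
def IsJordanDomain (G : Set ℂ) : Prop :=
  IsOpen G ∧ Bornology.IsBounded G ∧ SimplyConnectedSpace G ∧
    ∃ γ : C(Metric.sphere (0 : ℂ) 1, ℂ),
      Function.Injective γ ∧ Set.range γ = frontier G

/-- `B` is an `n`-th Bieberbach polynomial of `G` with respect to `z₀`:
`deg B ≤ n`, `B(z₀) = 0`, `B'(z₀) = 1`, and `B` minimizes `∫∫_G |P'|²` among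
all polynomials `P` of degree at most `n` with `P(z₀) = 0`, `P'(z₀) = 1`. -/
def IsBieberbachPoly (G : Set ℂ) (z₀ : ℂ) (n : ℕ) (B : Polynomial ℂ) : Prop :=
  B.natDegree ≤ n ∧ B.eval z₀ = 0 ∧ B.derivative.eval z₀ = 1 ∧
  ∀ P : Polynomial ℂ, P.natDegree ≤ n → P.eval z₀ = 0 → P.derivative.eval z₀ = 1 →
    (∫ z in G, ‖B.derivative.eval z‖ ^ 2) ≤ ∫ z in G, ‖P.derivative.eval z‖ ^ 2

section Kernel

open Polynomial ComplexConjugate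

/-- Every complex polynomial has a polynomial antiderivative vanishing at `0`. -/
theorem Polynomial.exists_antiderivative (p : ℂ[X]) :
    ∃ P : ℂ[X], derivative P = p ∧ P.eval 0 = 0 ∧ P.natDegree ≤ p.natDegree + 1 := by
  refine ⟨∑ i ∈ Finset.range (p.natDegree + 1), monomial (i + 1) (p.coeff i / (i + 1)),
    ?_, ?_, ?_⟩
  · conv_rhs => rw [p.as_sum_range]
    rw [derivative_sum]
    refine Finset.sum_congr rfl fun i _ => ?_
    rw [derivative_monomial]
    have : (i : ℂ) + 1 ≠ 0 := by exact_mod_cast Nat.succ_ne_zero i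
    congr 1
    push_cast
    field_simp
  · simp [eval_finsetSum]
  · refine natDegree_sum_le_of_forall_le _ _ fun i hi => ?_
    exact (natDegree_monomial_le _).trans (by simpa using Finset.mem_range.1 hi)

/-- A continuous function is integrable on a bounded subset of `ℂ`. -/
theorem Continuous.integrableOn_of_isBounded {E : Type*} [NormedAddCommGroup E] {f : ℂ → E}
    (hf : Continuous f) {G : Set ℂ} (hb : Bornology.IsBounded G) : IntegrableOn f G :=
  (hf.continuousOn.integrableOn_compact hb.isCompact_closure).mono_set subset_closure

/-- The sesquilinear pairing of polynomials in `L²(G)`. -/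
noncomputable def bergmanInner (G : Set ℂ) (p q : ℂ[X]) : ℂ :=
  ∫ z in G, p.eval z * conj (q.eval z)

/-- The squared `L²(G)` norm of a polynomial. -/
noncomputable def bergmanNormSq (G : Set ℂ) (p : ℂ[X]) : ℝ :=
  ∫ z in G, ‖p.eval z‖ ^ 2

variable {G : Set ℂ}

theorem bergmanNormSq_nonneg (p : ℂ[X]) : 0 ≤ bergmanNormSq G p :=
  integral_nonneg fun _ => by positivity

theorem integrableOn_bergmanInner (hb : Bornology.IsBounded G) (p q : ℂ[X]) :
    IntegrableOn (fun z => p.eval z * conj (q.eval z)) G :=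
  Continuous.integrableOn_of_isBounded (by fun_prop) hb

theorem integrableOn_bergmanNormSq (hb : Bornology.IsBounded G) (p : ℂ[X]) :
    IntegrableOn (fun z => ‖p.eval z‖ ^ 2) G :=
  Continuous.integrableOn_of_isBounded (by fun_prop) hb

theorem bergmanInner_add_left (hb : Bornology.IsBounded G) (p q r : ℂ[X]) :
    bergmanInner G (p + q) r = bergmanInner G p r + bergmanInner G q r := by
  unfold bergmanInner
  rw [← integral_add (integrableOn_bergmanInner hb p r) (integrableOn_bergmanInner hb q r)]
  simp [add_mul]

theorem bergmanInner_sub_left (hb : Bornology.IsBounded G) (p q r : ℂ[X]) :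
    bergmanInner G (p - q) r = bergmanInner G p r - bergmanInner G q r := by
  unfold bergmanInner
  rw [← integral_sub (integrableOn_bergmanInner hb p r) (integrableOn_bergmanInner hb q r)]
  simp [sub_mul]

theorem bergmanInner_C_mul_left (c : ℂ) (p q : ℂ[X]) :
    bergmanInner G (C c * p) q = c * bergmanInner G p q := by
  unfold bergmanInner
  rw [← integral_const_mul]
  simp [mul_assoc]

theorem bergmanInner_conj_symm (p q : ℂ[X]) :
    conj (bergmanInner G p q) = bergmanInner G q p := by
  unfold bergmanInner
  rw [← integral_conj]
  simp [mul_comm]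

theorem bergmanInner_sub_right (hb : Bornology.IsBounded G) (p q r : ℂ[X]) :
    bergmanInner G p (q - r) = bergmanInner G p q - bergmanInner G p r := by
  rw [← bergmanInner_conj_symm, bergmanInner_sub_left hb, map_sub, bergmanInner_conj_symm,
    bergmanInner_conj_symm]

theorem bergmanInner_C_mul_right (c : ℂ) (p q : ℂ[X]) :
    bergmanInner G p (C c * q) = conj c * bergmanInner G p q := by
  rw [← bergmanInner_conj_symm, bergmanInner_C_mul_left, map_mul, bergmanInner_conj_symm]

theorem bergmanInner_self (p : ℂ[X]) : bergmanInner G p p = bergmanNormSq G p := by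
  unfold bergmanInner bergmanNormSq
  rw [← integral_complex_ofReal]
  congr 1 with z
  rw [Complex.mul_conj, Complex.normSq_eq_norm_sq]

theorem bergmanInner_add_right (hb : Bornology.IsBounded G) (p q r : ℂ[X]) :
    bergmanInner G p (q + r) = bergmanInner G p q + bergmanInner G p r := by
  rw [← bergmanInner_conj_symm, bergmanInner_add_left hb, map_add, bergmanInner_conj_symm,
    bergmanInner_conj_symm]

theorem bergmanNormSq_add (hb : Bornology.IsBounded G) (p q : ℂ[X]) :
    bergmanNormSq G (p + q) =
      bergmanNormSq G p + 2 * (bergmanInner G q p).re + bergmanNormSq G q := by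
  have h : (bergmanNormSq G (p + q) : ℂ) = bergmanNormSq G p +
      (bergmanInner G q p + conj (bergmanInner G q p)) + bergmanNormSq G q := by
    rw [← bergmanInner_self, bergmanInner_add_left hb, bergmanInner_add_right hb,
      bergmanInner_add_right hb, bergmanInner_conj_symm, bergmanInner_self, bergmanInner_self]
    ring
  have := congrArg Complex.re h
  simpa [two_mul] using this

theorem bergmanNormSq_C_mul (c : ℂ) (p : ℂ[X]) :
    bergmanNormSq G (C c * p) = ‖c‖ ^ 2 * bergmanNormSq G p := by
  unfold bergmanNormSq
  rw [← integral_const_mul]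
  simp [mul_pow]

/-- A polynomial with vanishing `L²` norm on a nonempty open set is zero. -/
theorem bergmanNormSq_eq_zero (ho : IsOpen G) (hb : Bornology.IsBounded G) (hne : G.Nonempty)
    {p : ℂ[X]} (hp : bergmanNormSq G p = 0) : p = 0 := by
  have h1 := (setIntegral_eq_zero_iff_of_nonneg_ae (Eventually.of_forall fun _ => by positivity)
    (integrableOn_bergmanNormSq hb p)).1 hp
  have h2 : Set.EqOn (fun z => ‖p.eval z‖ ^ 2) 0 G :=
    Measure.eqOn_open_of_ae_eq h1 ho (by fun_prop) continuousOn_const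
  obtain ⟨z, hz⟩ := hne
  refine eq_zero_of_infinite_isRoot p (Set.Infinite.mono (s := G) (fun w hw => ?_) ?_)
  · simpa using h2 hw
  · exact infinite_of_mem_nhds z (ho.mem_nhds hz)

/-- A Bieberbach polynomial's derivative reproduces the value at `0`, up to normalization. -/
theorem IsBieberbachPoly.bergmanInner_derivative {n : ℕ} {B : ℂ[X]} (hb : Bornology.IsBounded G)
    (hB : IsBieberbachPoly G 0 (n + 1) B) {p : ℂ[X]} (hp : p.natDegree ≤ n) :
    bergmanInner G p (derivative B) = p.eval 0 * bergmanNormSq G (derivative B) := by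
  obtain ⟨hdeg, hB0, hB1, hmin⟩ := hB
  have key : ∀ q : ℂ[X], q.natDegree ≤ n → q.eval 0 = 0 →
      bergmanInner G q (derivative B) = 0 := by
    intro q hq hq0
    obtain ⟨Q, hQ, hQ0, hQd⟩ := q.exists_antiderivative
    set I := bergmanInner G q (derivative B) with hI
    set M := bergmanNormSq G q with hM
    have hM0 : 0 ≤ M := bergmanNormSq_nonneg q
    have h := hmin (B + C (-(1 / (M + 1) : ℝ) * conj I) * Q) ?_ ?_ ?_
    · change bergmanNormSq G _ ≤ bergmanNormSq G _ at h
      rw [derivative_add, derivative_C_mul, hQ, bergmanNormSq_add hb, bergmanNormSq_C_mul,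
        bergmanInner_C_mul_left, ← hI, ← hM, mul_assoc, mul_comm (conj I), Complex.mul_conj,
        norm_mul, Complex.normSq_eq_norm_sq] at h
      have h2 : (-((1 / (M + 1) : ℝ) : ℂ) * ((‖I‖ ^ 2 : ℝ) : ℂ)).re
          = -(1 / (M + 1)) * ‖I‖ ^ 2 := by
        rw [← Complex.ofReal_neg, ← Complex.ofReal_mul, Complex.ofReal_re]
      rw [h2, norm_neg, Complex.norm_real, RCLike.norm_conj, Real.norm_of_nonneg (by positivity)]
        at h
      have h3 : 0 ≤ ‖I‖ ^ 2 * (-2 * (M + 1) + M) := by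
        have : 0 ≤ (2 * (-(1 / (M + 1)) * ‖I‖ ^ 2) + (1 / (M + 1) * ‖I‖) ^ 2 * M) *
            (M + 1) ^ 2 := by
          apply mul_nonneg _ (by positivity)
          linarith
        have e : (2 * (-(1 / (M + 1)) * ‖I‖ ^ 2) + (1 / (M + 1) * ‖I‖) ^ 2 * M) *
            (M + 1) ^ 2 = ‖I‖ ^ 2 * (-2 * (M + 1) + M) := by
          field_simp
        rwa [e] at this
      have h4 : ‖I‖ ^ 2 = 0 := by nlinarith [sq_nonneg ‖I‖]
      simpa using h4
    · refine (natDegree_add_le _ _).trans (max_le hdeg ?_)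
      exact (natDegree_C_mul_le _ _).trans (hQd.trans (by lia))
    · simp [hB0, hQ0]
    · simp [hB1, hQ, hq0]
  have h := key (p - C (p.eval 0) * derivative B) ?_ ?_
  · rw [bergmanInner_sub_left hb, bergmanInner_C_mul_left, bergmanInner_self] at h
    linear_combination h
  · refine (natDegree_sub_le _ _).trans (max_le hp ?_)
    refine (natDegree_C_mul_le _ _).trans ((natDegree_derivative_le _).trans ?_)
    omega
  · simp [hB1]

end Kernel

section Rotation

theorem setIntegral_comp_rotation {u : ℂ} (hu : ‖u‖ = 1) (f : ℂ → ℂ) {S : Set ℂ}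
    (hS : (fun w => u * w) ⁻¹' S = S) : ∫ w in S, f (u * w) = ∫ w in S, f w := by
  let c : Circle := ⟨u, by simpa [Submonoid.unitSphere] using hu⟩
  have hm : MeasurePreserving (fun w : ℂ => u * w) := (rotation c).measurePreserving
  have he : MeasurableEmbedding (fun w : ℂ => u * w) :=
    (rotation c).toHomeomorph.measurableEmbedding
  conv_lhs => rw [← hS]
  exact hm.setIntegral_preimage_emb he f S

theorem setIntegral_zpow_eq_zero {S : Set ℂ}
    (hS : ∀ u : ℂ, ‖u‖ = 1 → (fun w => u * w) ⁻¹' S = S) {n : ℤ} (hn : n ≠ 0) :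
    ∫ w in S, w ^ n = 0 := by
  have hu : ‖Complex.exp ((Real.pi / n : ℝ) * Complex.I)‖ = 1 := Complex.norm_exp_ofReal_mul_I _
  have h := setIntegral_comp_rotation hu (fun w => w ^ n) (hS _ hu)
  have hneg : Complex.exp ((Real.pi / n : ℝ) * Complex.I) ^ n = -1 := by
    rw [← Complex.exp_int_mul, ← Complex.exp_pi_mul_I]
    congr 1
    have : (n : ℂ) ≠ 0 := by exact_mod_cast hn
    push_cast
    field_simp
  simp only [mul_zpow, hneg, integral_const_mul] at h
  linear_combination (-1 / 2 : ℂ) * h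

theorem preimage_mul_ball_zero {u : ℂ} (hu : ‖u‖ = 1) (r : ℝ) :
    (fun w => u * w) ⁻¹' Metric.ball (0 : ℂ) r = Metric.ball 0 r := by
  ext w; simp [hu]

end Rotation

section MeanValue

open Polynomial ComplexConjugate

theorem setIntegral_ball_eval (p : ℂ[X]) (z : ℂ) (r : ℝ) :
    ∫ w in Metric.ball z r, p.eval w = p.eval z * volume.real (Metric.ball z r) := by
  have h1 : ∫ w in Metric.ball z r, p.eval w = ∫ w in Metric.ball 0 r, (p.comp (X + C z)).eval w := by
    have hp := (measurePreserving_add_right (volume : Measure ℂ) z).setIntegral_preimage_emb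
      (Homeomorph.addRight z).measurableEmbedding (fun w => p.eval w) (Metric.ball z r)
    rw [← hp]
    simp [Metric.preimage_add_right_ball]
  have h2 : volume.real (Metric.ball z r) = volume.real (Metric.ball (0 : ℂ) r) := by
    simp [Measure.real, Measure.addHaar_ball_center]
  have h3 : p.eval z = (p.comp (X + C z)).coeff 0 := by
    rw [coeff_zero_eq_eval_zero]; simp
  rw [h1, h2, h3]
  generalize p.comp (X + C z) = q
  simp_rw [eval_eq_sum_range]
  rw [integral_finsetSum]
  · rw [Finset.sum_eq_single 0]
    · simp [mul_comm]
    · intro i _ hi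
      rw [integral_const_mul]
      have := setIntegral_zpow_eq_zero (fun u hu => preimage_mul_ball_zero hu r)
        (n := i) (by exact_mod_cast hi)
      simp only [zpow_natCast] at this
      rw [this, mul_zero]
    · simp
  · intro i _
    exact Continuous.integrableOn_of_isBounded (by fun_prop) Metric.isBounded_ball

theorem bergmanNormSq_mono {G H : Set ℂ} (hb : Bornology.IsBounded H) (h : G ⊆ H) (p : ℂ[X]) :
    bergmanNormSq G p ≤ bergmanNormSq H p :=
  setIntegral_mono_set (integrableOn_bergmanNormSq hb p)
    (Eventually.of_forall fun _ => by positivity) h.eventuallyLE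

/-- The area mean value inequality for polynomials. -/
theorem norm_sq_eval_mul_le_bergmanNormSq {G : Set ℂ} (hb : Bornology.IsBounded G) (p : ℂ[X])
    {z : ℂ} {r : ℝ} (h : Metric.ball z r ⊆ G) :
    ‖p.eval z‖ ^ 2 * volume.real (Metric.ball z r) ≤ bergmanNormSq G p := by
  refine le_trans ?_ (bergmanNormSq_mono hb h p)
  have hbb : Bornology.IsBounded (Metric.ball z r) := Metric.isBounded_ball
  have e : p = C (p.eval z) + (p - C (p.eval z)) := by ring
  have hc : bergmanNormSq (Metric.ball z r) (C (p.eval z)) =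
      ‖p.eval z‖ ^ 2 * volume.real (Metric.ball z r) := by
    simp [bergmanNormSq, mul_comm]
  have hi : bergmanInner (Metric.ball z r) (p - C (p.eval z)) (C (p.eval z)) = 0 := by
    have : bergmanInner (Metric.ball z r) (p - C (p.eval z)) (C (p.eval z)) =
        conj (p.eval z) * ∫ w in Metric.ball z r, (p - C (p.eval z)).eval w := by
      rw [bergmanInner, ← integral_const_mul]
      simp [mul_comm]
    rw [this, setIntegral_ball_eval]
    simp
  conv_rhs => rw [e]
  rw [bergmanNormSq_add hbb, hc, hi]
  have := bergmanNormSq_nonneg (G := Metric.ball z r) (p - C (p.eval z))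
  simp
  linarith

end MeanValue

section LowerBound

open Polynomial ComplexConjugate

/-- A polynomial orthogonal to all polynomials of smaller degree is controlled by its value at
any point that is separated from the domain by a line. -/
theorem bergmanNormSq_le_of_orthogonal {G : Set ℂ} (hb : Bornology.IsBounded G)
    (hm : MeasurableSet G) {D : ℂ[X]}
    (hD : ∀ p : ℂ[X], p.natDegree < D.natDegree → bergmanInner G p D = 0) {ζ ω : ℂ}
    {δ M : ℝ} (hω : ‖ω‖ = 1) (hδ : 0 < δ) (hsep : ∀ z ∈ G, (ω * (z - ζ)).re ≤ -δ)
    (hM : ∀ z ∈ G, ‖z - ζ‖ ≤ M) :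
    bergmanNormSq G D ≤ 2 * volume.real G * (M ^ 2 / δ ^ 2 + 1) * ‖D.eval ζ‖ ^ 2 := by
  obtain ⟨s, hs⟩ : (X - C ζ) ∣ D - C (D.eval ζ) := by
    simpa using X_sub_C_dvd_sub_C_eval (p := D) (a := ζ)
  have hDs : D = (X - C ζ) * s + C (D.eval ζ) := by rw [← hs]; ring
  set c := D.eval ζ with hc
  have hA : 0 ≤ volume.real G := measureReal_nonneg
  have hfin : volume G ≠ ⊤ := hb.measure_lt_top.ne
  have hcst : IntegrableOn (fun _ : ℂ => (1 : ℝ)) G := by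
    simp [hfin.lt_top]
  have hs2 := integrableOn_bergmanNormSq hb s
  have hE : bergmanNormSq G s ≤ ‖c‖ ^ 2 * volume.real G / δ ^ 2 := by
    by_cases hs0 : s = 0
    · simp [hs0, bergmanNormSq]; positivity
    have hdeg : s.natDegree < D.natDegree := by
      have : (D - C c).natDegree = s.natDegree + 1 := by
        rw [hs, natDegree_mul (X_sub_C_ne_zero ζ) hs0, natDegree_X_sub_C, add_comm]
      rw [natDegree_sub_C] at this
      omega
    have h0 := hD s hdeg
    have hint := integrableOn_bergmanInner hb s D
    have h1 : ∫ z in G, (conj ω * (s.eval z * conj (D.eval z))).re = 0 := by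
      rw [← RCLike.re_eq_complex_re, integral_re (hint.const_mul _), integral_const_mul]
      change (conj ω * bergmanInner G s D).re = 0
      rw [h0]; simp
    have h2 : ∫ z in G, (conj ω * (s.eval z * conj (D.eval z))).re ≤
        ∫ z in G, ((-δ / 2) * ‖s.eval z‖ ^ 2 + ‖c‖ ^ 2 / (2 * δ) * 1) := by
      refine setIntegral_mono_on (hint.const_mul _).re
        ((hs2.const_mul _).add (hcst.const_mul _)) hm fun z hz => ?_
      have e : conj ω * (s.eval z * conj (D.eval z)) =
          conj (ω * (z - ζ)) * ((‖s.eval z‖ ^ 2 : ℝ) : ℂ) + conj ω * (s.eval z * conj c) := by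
        conv_lhs => rw [hDs]
        rw [← Complex.normSq_eq_norm_sq, ← Complex.mul_conj]
        simp
        ring
      rw [e, Complex.add_re, Complex.re_mul_ofReal, Complex.conj_re]
      have h3 : (conj ω * (s.eval z * conj c)).re ≤ ‖s.eval z‖ * ‖c‖ := by
        refine (Complex.re_le_norm _).trans ?_
        simp [hω]
      have h4 := mul_le_mul_of_nonneg_right (hsep z hz) (sq_nonneg ‖s.eval z‖)
      have h5 : ‖s.eval z‖ * ‖c‖ ≤ δ / 2 * ‖s.eval z‖ ^ 2 + ‖c‖ ^ 2 / (2 * δ) := by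
        have : δ / 2 * ‖s.eval z‖ ^ 2 + ‖c‖ ^ 2 / (2 * δ) - ‖s.eval z‖ * ‖c‖ =
            (δ * ‖s.eval z‖ - ‖c‖) ^ 2 / (2 * δ) := by field_simp; ring
        have h6 : 0 ≤ (δ * ‖s.eval z‖ - ‖c‖) ^ 2 / (2 * δ) := by positivity
        linarith
      linarith
    rw [h1, integral_add (hs2.const_mul _) (hcst.const_mul _), integral_const_mul,
      integral_const_mul] at h2
    change 0 ≤ -δ / 2 * bergmanNormSq G s + _ at h2
    simp only [integral_const, smul_eq_mul, mul_one, measureReal_restrict_apply,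
      MeasurableSet.univ, Set.univ_inter] at h2
    rw [le_div_iff₀ (by positivity)]
    have h7 : ‖c‖ ^ 2 / (2 * δ) * volume.real G * (2 * δ) = ‖c‖ ^ 2 * volume.real G := by
      field_simp
    have h8 := mul_le_mul_of_nonneg_right h2 (by positivity : (0:ℝ) ≤ 2 * δ)
    rw [add_mul, h7] at h8
    linarith
  have h2 : bergmanNormSq G D ≤ ∫ z in G, (2 * M ^ 2 * ‖s.eval z‖ ^ 2 + 2 * ‖c‖ ^ 2 * 1) := by
    refine setIntegral_mono_on (integrableOn_bergmanNormSq hb D)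
      ((hs2.const_mul _).add (hcst.const_mul _)) hm fun z hz => ?_
    have e : D.eval z = (z - ζ) * s.eval z + c := by
      conv_lhs => rw [hDs]
      simp
    rw [e]
    have h3 : ‖(z - ζ) * s.eval z + c‖ ≤ M * ‖s.eval z‖ + ‖c‖ := by
      refine (norm_add_le _ _).trans ?_
      rw [norm_mul]
      gcongr
      exact hM z hz
    calc ‖(z - ζ) * s.eval z + c‖ ^ 2 ≤ (M * ‖s.eval z‖ + ‖c‖) ^ 2 := by gcongr
      _ ≤ _ := by nlinarith [sq_nonneg (M * ‖s.eval z‖ - ‖c‖)]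
  have h3 : ∫ z in G, (2 * M ^ 2 * ‖s.eval z‖ ^ 2 + 2 * ‖c‖ ^ 2 * 1) =
      2 * M ^ 2 * bergmanNormSq G s + 2 * ‖c‖ ^ 2 * volume.real G := by
    rw [integral_add (hs2.const_mul _) (hcst.const_mul _), integral_const_mul, integral_const_mul]
    simp [bergmanNormSq]
  rw [h3] at h2
  calc bergmanNormSq G D ≤ _ := h2
    _ ≤ 2 * M ^ 2 * (‖c‖ ^ 2 * volume.real G / δ ^ 2) + 2 * ‖c‖ ^ 2 * volume.real G := by gcongr
    _ = _ := by ring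

end LowerBound

section Growth

open Polynomial ComplexConjugate

/-- If every root is at least `ρ` times farther from `x` than from `y`, then
`p` grows by a factor `ρ ^ natDegree` from `y` to `x`. -/
theorem Polynomial.mul_pow_natDegree_le_norm_eval {p : ℂ[X]} {x y : ℂ} {ρ : ℝ} (hρ : 0 ≤ ρ)
    (h : ∀ a ∈ p.roots, ‖y - a‖ * ρ ≤ ‖x - a‖) :
    ‖p.eval y‖ * ρ ^ p.natDegree ≤ ‖p.eval x‖ := by
  have hs := IsAlgClosed.splits p
  have hn : ∀ w : ℂ, ‖(p.roots.map (w - ·)).prod‖ = (p.roots.map (‖w - ·‖)).prod := fun w => by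
    have := map_multiset_prod (normHom : ℂ →*₀ ℝ) (p.roots.map (w - ·))
    simpa [Multiset.map_map, Function.comp_def] using this
  rw [hs.eval_eq_prod_roots, hs.eval_eq_prod_roots, norm_mul, norm_mul, hn, hn, mul_assoc,
    hs.natDegree_eq_card_roots]
  refine mul_le_mul_of_nonneg_left ?_ (norm_nonneg _)
  have e : (p.roots.map (‖y - ·‖)).prod * ρ ^ p.roots.card =
      (p.roots.map fun a => ‖y - a‖ * ρ).prod := by
    rw [Multiset.prod_map_mul, Multiset.map_const', Multiset.prod_replicate]
  rw [e]
  exact Multiset.prod_map_le_prod_map₀ _ _ (fun a _ => by positivity) h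

variable {G : Set ℂ}

theorem eval_ne_zero_of_orthogonal (ho : IsOpen G) (hb : Bornology.IsBounded G)
    (hne : G.Nonempty) {D : ℂ[X]} (hD0 : D ≠ 0)
    (hD : ∀ p : ℂ[X], p.natDegree < D.natDegree → bergmanInner G p D = 0) {ζ ω : ℂ}
    {δ : ℝ} (hω : ‖ω‖ = 1) (hδ : 0 < δ) (hsep : ∀ z ∈ G, (ω * (z - ζ)).re ≤ -δ) :
    D.eval ζ ≠ 0 := by
  intro h
  obtain ⟨M, hM⟩ := hb.subset_closedBall ζ
  have := bergmanNormSq_le_of_orthogonal hb ho.measurableSet hD hω hδ hsep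
    (fun z hz => by simpa [dist_eq_norm] using hM hz)
  rw [h] at this
  exact hD0 (bergmanNormSq_eq_zero ho hb hne
    (le_antisymm (by simpa using this) (bergmanNormSq_nonneg D)))

theorem exists_growth_of_orthogonal (ho : IsOpen G) (hb : Bornology.IsBounded G)
    (hne : G.Nonempty) {ξ x₁ : ℝ} (hhalf : ∀ z ∈ G, z.re < ξ) (hx₁ : ξ < x₁) :
    ∃ c > 0, ∃ ρ > 1, ∀ D : ℂ[X], D ≠ 0 →
      (∀ p : ℂ[X], p.natDegree < D.natDegree → bergmanInner G p D = 0) →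
      ∀ x : ℝ, x₁ ≤ x → c * √(bergmanNormSq G D) * ρ ^ D.natDegree ≤ ‖D.eval (x : ℂ)‖ := by
  obtain ⟨R, hRpos, hR⟩ := hb.subset_closedBall_lt 0 0
  have hR' : ∀ z ∈ G, ‖z‖ ≤ R := fun z hz => by simpa using hR hz
  set y : ℝ := (ξ + x₁) / 2 with hy
  have hξy : ξ < y := by rw [hy]; linarith
  have hyx : y < x₁ := by rw [hy]; linarith
  set M : ℝ := |y| + R with hM
  have hMpos : 0 < M := by positivity
  have hMy : ∀ z : ℂ, ‖z‖ ≤ R → ‖(y : ℂ) - z‖ ≤ M := fun z hz =>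
    (norm_sub_le _ _).trans (by simpa [hM] using hz)
  set L : ℝ := 2 * volume.real G * (M ^ 2 / (y - ξ) ^ 2 + 1) + 1 with hL
  have hLpos : 0 < L := by
    have : 0 ≤ volume.real G := measureReal_nonneg
    positivity
  refine ⟨1 / √L, by positivity, √(1 + (x₁ - y) ^ 2 / M ^ 2), ?_, ?_⟩
  · rw [gt_iff_lt, Real.lt_sqrt (by norm_num)]
    have : 0 < (x₁ - y) ^ 2 / M ^ 2 := by have := sub_pos.2 hyx; positivity
    linarith
  intro D hD0 hD x hx
  have hroots : ∀ a ∈ D.roots, a.re ≤ ξ ∧ ‖a‖ ≤ R := by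
    intro a ha
    have ha0 : D.eval a = 0 := isRoot_of_mem_roots ha
    constructor
    · by_contra! hlt
      refine eval_ne_zero_of_orthogonal ho hb hne hD0 hD (ω := 1) (by simp) (sub_pos.2 hlt)
        (fun z hz => ?_) ha0
      have := hhalf z hz
      simp; linarith
    · by_contra! hlt
      have hpos : 0 < ‖a‖ := hRpos.trans hlt
      refine eval_ne_zero_of_orthogonal ho hb hne hD0 hD (ω := conj a / ‖a‖) (by
        simp [hpos.ne']) (sub_pos.2 hlt) (fun z hz => ?_) ha0
      have e : conj a / ‖a‖ * (z - a) = conj a * z / ‖a‖ - (‖a‖ : ℂ) := by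
        have : (‖a‖ : ℂ) ≠ 0 := by exact_mod_cast hpos.ne'
        have h2 := Complex.mul_conj a
        rw [Complex.normSq_eq_norm_sq] at h2
        push_cast at h2
        field_simp
        linear_combination -h2
      have h3 : (conj a * z / ‖a‖).re ≤ R := by
        refine (Complex.re_le_norm _).trans ?_
        simp [hpos.ne', hR' z hz]
      rw [e, Complex.sub_re, Complex.ofReal_re]
      linarith
  have hgrow : ‖D.eval (y : ℂ)‖ * √(1 + (x₁ - y) ^ 2 / M ^ 2) ^ D.natDegree ≤
      ‖D.eval (x : ℂ)‖ := by
    refine D.mul_pow_natDegree_le_norm_eval (by positivity) fun a ha => ?_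
    obtain ⟨h1, h2⟩ := hroots a ha
    rw [← abs_of_nonneg (norm_nonneg ((x : ℂ) - a)),
      ← abs_of_nonneg (a := ‖(y : ℂ) - a‖ * _) (by positivity), ← sq_le_sq, mul_pow,
      Real.sq_sqrt (by positivity)]
    have h3 : ‖(y : ℂ) - a‖ ^ 2 * ((x₁ - y) ^ 2 / M ^ 2) ≤ (x₁ - y) ^ 2 := by
      rw [← mul_div_assoc, div_le_iff₀ (by positivity), mul_comm]
      gcongr
      exact hMy a h2
    have h4 : ‖(x : ℂ) - a‖ ^ 2 = (x - a.re) ^ 2 + a.im ^ 2 := by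
      rw [← Complex.normSq_eq_norm_sq, Complex.normSq_apply]; simp; ring
    have h5 : ‖(y : ℂ) - a‖ ^ 2 = (y - a.re) ^ 2 + a.im ^ 2 := by
      rw [← Complex.normSq_eq_norm_sq, Complex.normSq_apply]; simp; ring
    rw [mul_add, mul_one]
    refine (add_le_add_right h3 _).trans ?_
    rw [h4, h5]
    nlinarith
  refine le_trans ?_ hgrow
  gcongr
  have h := bergmanNormSq_le_of_orthogonal hb ho.measurableSet hD (ζ := (y : ℂ)) (ω := 1)
    (by simp) (sub_pos.2 hξy) (fun z hz => by have := hhalf z hz; simp; linarith)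
    (fun z hz => by rw [norm_sub_rev]; exact hMy z (hR' z hz))
  have h' : bergmanNormSq G D ≤ L * ‖D.eval (y : ℂ)‖ ^ 2 :=
    h.trans (by gcongr; rw [hL]; linarith)
  rw [one_div, inv_mul_le_iff₀ (by positivity)]
  refine (Real.sqrt_le_sqrt h').trans ?_
  rw [Real.sqrt_mul hLpos.le, Real.sqrt_sq (norm_nonneg _)]

end Growth

section BernsteinWalsh

open Polynomial ComplexConjugate Polynomial.Chebyshev

theorem sum_prod_chebyshev_node (n : ℕ) (t : ℝ) :
    ∑ i ∈ Finset.range (n + 1), ∏ j ∈ (Finset.range (n + 1)).erase i,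
      ((Real.cosh t - node n j) / |node n i - node n j|) = Real.cosh (n * t) := by
  have hinj : Set.InjOn (node n) (Finset.range (n + 1) : Set ℕ) := by
    refine (strictAntiOn_node n).injOn.mono fun i hi => ?_
    simpa [Nat.lt_succ_iff] using hi
  have h := Lagrange.eq_interpolate_of_eval_eq (f := T ℝ n) (s := Finset.range (n + 1))
    (v := node n) (fun i => (-1 : ℝ) ^ i) hinj
    (by rw [degree_T]; simp; exact_mod_cast Nat.lt_succ_self n)
    (fun i hi => eval_T_real_node (by simpa [Nat.lt_succ_iff] using hi))
  have h2 := congrArg (Polynomial.eval (Real.cosh t)) h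
  have h3 := T_real_cosh t n
  rw [h2, Lagrange.interpolate_apply, eval_finsetSum] at h3
  rw [Int.cast_natCast] at h3
  rw [← h3]
  refine Finset.sum_congr rfl fun i hi => ?_
  have hpos := zero_lt_prod_node_sub_node (n := n) (i := i)
    (by simpa [Nat.lt_succ_iff] using hi)
  rw [eval_mul, eval_C, Lagrange.basis, eval_prod, Finset.prod_div_distrib, ← Finset.abs_prod]
  have habs : |∏ j ∈ (Finset.range (n + 1)).erase i, (node n i - node n j)| =
      (-1) ^ i * ∏ j ∈ (Finset.range (n + 1)).erase i, (node n i - node n j) := by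
    conv_rhs => rw [← abs_of_pos hpos, abs_mul, abs_pow]
    simp
  simp only [Lagrange.basisDivisor, eval_mul, eval_C, eval_sub, eval_X, Finset.prod_mul_distrib,
    Finset.prod_inv_distrib]
  rw [habs, div_eq_mul_inv, mul_inv, ← inv_pow, inv_neg_one]
  ring

/-- If a set meets every circle of radius in `[δ, r]` around `ζ`, a polynomial
bounded on that set grows at most like a Chebyshev polynomial near `ζ`. -/
theorem norm_eval_le_of_circles {K : Set ℂ} {ζ z : ℂ} {δ r t : ℝ} (hδr : δ < r)
    (hK : ∀ s ∈ Set.Icc δ r, ∃ w ∈ K, ‖w - ζ‖ = s) (ht : 0 ≤ t)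
    (hz : ‖z - ζ‖ + (r + δ) / 2 ≤ (r - δ) / 2 * Real.cosh t) {p : ℂ[X]} {n : ℕ}
    (hp : p.natDegree ≤ n) {A : ℝ} (hA : ∀ w ∈ K, ‖p.eval w‖ ≤ A) :
    ‖p.eval z‖ ≤ A * Real.exp t ^ n := by
  have hpos : 0 < (r - δ) / 2 := by linarith
  have hmem : ∀ j : ℕ, (r + δ) / 2 - (r - δ) / 2 * node n j ∈ Set.Icc δ r := fun j => by
    obtain ⟨h1, h2⟩ := node_mem_Icc (n := n) (i := j)
    constructor <;> nlinarith
  choose w hwK hw using fun j => hK _ (hmem j)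
  have hA0 : 0 ≤ A := (norm_nonneg _).trans (hA _ (hwK 0))
  have hdist : ∀ i j, (r - δ) / 2 * |node n i - node n j| ≤ ‖w i - w j‖ := fun i j => by
    have := abs_norm_sub_norm_le (w i - ζ) (w j - ζ)
    rw [hw, hw, sub_sub_sub_cancel_right, sub_sub_sub_cancel_left, ← mul_sub, abs_mul,
      abs_of_pos hpos, abs_sub_comm] at this
    exact this
  have hinj0 : Set.InjOn (node n) (Finset.range (n + 1) : Set ℕ) := by
    refine (strictAntiOn_node n).injOn.mono fun i hi => ?_
    simpa [Nat.lt_succ_iff] using hi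
  have hinj : Set.InjOn w (Finset.range (n + 1) : Set ℕ) := fun i hi j hj hij => by
    refine hinj0 hi hj ?_
    have := hdist i j
    rw [hij, sub_self, norm_zero] at this
    have h2 : |node n i - node n j| ≤ 0 := by
      by_contra! h
      have := mul_pos hpos h
      linarith
    exact sub_eq_zero.1 (abs_nonpos_iff.1 h2)
  have hint := Lagrange.eq_interpolate (f := p) (s := Finset.range (n + 1)) hinj (by
    refine degree_le_natDegree.trans_lt ?_
    rw [Finset.card_range]
    exact_mod_cast Nat.lt_succ_of_le hp)
  have hcosh : Real.cosh (n * t) ≤ Real.exp t ^ n := by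
    rw [← Real.exp_nat_mul, Real.cosh_eq]
    have h1 : 0 ≤ n * t := by positivity
    have h2 : Real.exp (-(n * t)) ≤ Real.exp (n * t) := Real.exp_le_exp.2 (by linarith)
    linarith
  calc ‖p.eval z‖
      = ‖∑ i ∈ Finset.range (n + 1), p.eval (w i) *
          ∏ j ∈ (Finset.range (n + 1)).erase i, ((w i - w j)⁻¹ * (z - w j))‖ := by
        conv_lhs => rw [hint, Lagrange.interpolate_apply, eval_finsetSum]
        simp [Lagrange.basis, eval_prod, Lagrange.basisDivisor]
    _ ≤ ∑ i ∈ Finset.range (n + 1), A * ∏ j ∈ (Finset.range (n + 1)).erase i,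
          ((Real.cosh t - node n j) / |node n i - node n j|) := by
        refine norm_sum_le_of_le _ fun i hi => ?_
        rw [norm_mul, norm_prod]
        refine mul_le_mul (hA _ (hwK i)) ?_ (by positivity) hA0
        refine Finset.prod_le_prod (fun _ _ => norm_nonneg _) fun j hj => ?_
        have hne : 0 < |node n i - node n j| := by
          rw [abs_pos, sub_ne_zero]
          exact fun h => (Finset.mem_erase.1 hj).1 (hinj0 (Finset.mem_erase.1 hj).2 hi h.symm)
        rw [norm_mul, norm_inv, inv_mul_eq_div]
        have h1 : ‖z - w j‖ ≤ (r - δ) / 2 * (Real.cosh t - node n j) := by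
          have := norm_sub_le (z - ζ) (w j - ζ)
          rw [sub_sub_sub_cancel_right, hw] at this
          linarith
        calc ‖z - w j‖ / ‖w i - w j‖ ≤ ((r - δ) / 2 * (Real.cosh t - node n j)) /
              ((r - δ) / 2 * |node n i - node n j|) := by
              gcongr
              · exact (norm_nonneg _).trans h1
              · exact hdist i j
          _ = _ := by rw [mul_div_mul_left _ _ hpos.ne']
    _ = A * Real.cosh (n * t) := by rw [← Finset.mul_sum, sum_prod_chebyshev_node]
    _ ≤ _ := by gcongr

variable {G : Set ℂ}

theorem exists_norm_eval_le_of_isCompact (ho : IsOpen G) (hb : Bornology.IsBounded G) {K : Set ℂ}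
    (hK : IsCompact K) (hKG : K ⊆ G) :
    ∃ C : ℝ, 0 ≤ C ∧ ∀ (p : ℂ[X]), ∀ z ∈ K, ‖p.eval z‖ ≤ C * √(bergmanNormSq G p) := by
  obtain ⟨δ, hδ, hth⟩ := hK.exists_thickening_subset_open ho hKG
  have hV : 0 < volume.real (Metric.ball (0 : ℂ) δ) :=
    ENNReal.toReal_pos (Metric.measure_ball_pos _ _ hδ).ne' measure_ball_lt_top.ne
  refine ⟨1 / √(volume.real (Metric.ball (0 : ℂ) δ)), by positivity, fun p z hz => ?_⟩
  have h := norm_sq_eval_mul_le_bergmanNormSq hb p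
    ((Metric.ball_subset_thickening hz δ).trans hth)
  have e : volume.real (Metric.ball z δ) = volume.real (Metric.ball (0 : ℂ) δ) := by
    simp [Measure.real, Measure.addHaar_ball_center]
  rw [e] at h
  rw [one_div_mul_eq_div, le_div_iff₀ (by positivity)]
  refine Real.le_sqrt_of_sq_le ?_
  rwa [mul_pow, Real.sq_sqrt hV.le]

theorem exists_ball_norm_eval_le (ho : IsOpen G) (hb : Bornology.IsBounded G)
    (hc : IsPreconnected G) (h0 : (0 : ℂ) ∈ G) {q : ℝ} (hq : 1 < q) {ζ : ℂ} (hζ : ζ ∈ closure G) :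
    ∃ ε > 0, ∃ C : ℝ, 0 ≤ C ∧ ∀ (p : ℂ[X]) (n : ℕ), p.natDegree ≤ n → ∀ z ∈ Metric.ball ζ ε,
      ‖p.eval z‖ ≤ C * q ^ n * √(bergmanNormSq G p) := by
  by_cases hζG : ζ ∈ G
  · obtain ⟨ε, hε, hball⟩ := Metric.nhds_basis_closedBall.mem_iff.1 (ho.mem_nhds hζG)
    obtain ⟨C, hC0, hC⟩ := exists_norm_eval_le_of_isCompact ho hb
      (isCompact_closedBall ζ ε) hball
    refine ⟨ε, hε, C, hC0, fun p n _ z hz => (hC p z (Metric.ball_subset_closedBall hz)).trans ?_⟩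
    gcongr
    exact le_mul_of_one_le_right hC0 (one_le_pow₀ hq.le)
  have hr : 0 < ‖ζ‖ := norm_pos_iff.2 fun h => hζG (h ▸ h0)
  set r := ‖ζ‖ with hr_def
  set t := Real.log q with ht
  have htpos : 0 < t := Real.log_pos hq
  have hexp : Real.exp t = q := Real.exp_log (by linarith)
  have hY : 1 < Real.cosh t := Real.one_lt_cosh.2 htpos.ne'
  set Y := Real.cosh t with hYdef
  set δ := r * (Y - 1) / (3 + Y) with hδ
  have hδpos : 0 < δ := by
    have : 0 < Y - 1 := by linarith
    positivity
  have hδmul : δ * (3 + Y) = r * (Y - 1) := by rw [hδ]; field_simp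
  have hδr : δ < r := by nlinarith
  obtain ⟨w₁, hw₁G, hw₁⟩ := Metric.mem_closure_iff.1 hζ δ hδpos
  have hpc : IsPathConnected G := (ho.isConnected_iff_isPathConnected).1 ⟨⟨0, h0⟩, hc⟩
  obtain ⟨γ, hγ⟩ := hpc.joinedIn w₁ hw₁G 0 h0
  obtain ⟨C, hC0, hC⟩ := exists_norm_eval_le_of_isCompact ho hb
    (isCompact_range γ.continuous) (Set.range_subset_iff.2 hγ)
  refine ⟨δ, hδpos, C, hC0, fun p n hp z hz => ?_⟩
  have hmain := norm_eval_le_of_circles (K := Set.range γ) (ζ := ζ) (z := z) hδr ?_ htpos.le ?_ hp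
    (hC p)
  · rw [hexp] at hmain
    linarith
  · intro s hs
    have hcont : Continuous fun x => ‖γ x - ζ‖ := by fun_prop
    obtain ⟨x, hx⟩ := mem_range_of_exists_le_of_exists_ge hcont (c := s)
      ⟨0, by rw [γ.source, ← dist_eq_norm, dist_comm]; exact hw₁.le.trans hs.1⟩
      ⟨1, by rw [γ.target, zero_sub, norm_neg]; exact hs.2⟩
    exact ⟨γ x, ⟨x, rfl⟩, hx⟩
  · rw [mem_ball_iff_norm] at hz
    nlinarith

/-- A Bernstein-Walsh type estimate in a connected neighbourhood of the closure. -/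
theorem exists_isOpen_norm_eval_le (ho : IsOpen G) (hb : Bornology.IsBounded G)
    (hc : IsPreconnected G) (h0 : (0 : ℂ) ∈ G) {q : ℝ} (hq : 1 < q) :
    ∃ U : Set ℂ, IsOpen U ∧ IsPreconnected U ∧ closure G ⊆ U ∧ ∃ C : ℝ, 0 ≤ C ∧
      ∀ (p : ℂ[X]) (n : ℕ), p.natDegree ≤ n → ∀ z ∈ U,
        ‖p.eval z‖ ≤ C * q ^ n * √(bergmanNormSq G p) := by
  choose! ε hε C hC0 hC using fun ζ (hζ : ζ ∈ closure G) =>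
    exists_ball_norm_eval_le ho hb hc h0 hq hζ
  obtain ⟨s, hs, hcov⟩ := hb.isCompact_closure.elim_nhds_subcover (fun ζ => Metric.ball ζ (ε ζ))
    (fun ζ hζ => Metric.ball_mem_nhds ζ (hε ζ hζ))
  refine ⟨⋃ ζ ∈ s, Metric.ball ζ (ε ζ), isOpen_biUnion fun _ _ => Metric.isOpen_ball, ?_, hcov,
    ∑ ζ ∈ s, C ζ, Finset.sum_nonneg fun ζ hζ => hC0 ζ (hs ζ hζ), fun p n hp z hz => ?_⟩
  · have e : (⋃ ζ ∈ s, Metric.ball ζ (ε ζ)) =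
        ⋃ ζ : s, (closure G ∪ Metric.ball (ζ : ℂ) (ε ζ)) ∪ closure G := by
      apply Set.Subset.antisymm
      · intro z hz
        simp only [Set.mem_iUnion] at hz ⊢
        obtain ⟨ζ, hζ, hz⟩ := hz
        exact ⟨⟨ζ, hζ⟩, Or.inl (Or.inr hz)⟩
      · refine Set.iUnion_subset fun ζ => Set.union_subset (Set.union_subset hcov ?_) hcov
        exact Set.subset_biUnion_of_mem (u := fun ζ => Metric.ball ζ (ε ζ)) ζ.2
    rw [e]
    refine isPreconnected_iUnion ⟨0, ?_⟩ fun ζ => ?_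
    · exact Set.mem_iInter.2 fun ζ => Or.inr (subset_closure h0)
    · rw [Set.union_assoc, Set.union_comm (Metric.ball _ _), ← Set.union_assoc, Set.union_self]
      exact hc.closure.union (ζ : ℂ) (hs ζ ζ.2) (Metric.mem_ball_self (hε ζ (hs ζ ζ.2)))
        (convex_ball _ _).isPreconnected
  · simp only [Set.mem_iUnion] at hz
    obtain ⟨ζ, hζ, hz⟩ := hz
    refine (hC ζ (hs ζ hζ) p n hp z hz).trans ?_
    gcongr
    exact Finset.single_le_sum (f := C) (fun ζ hζ => hC0 ζ (hs ζ hζ)) hζ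

end BernsteinWalsh

section KernelPolynomials

open Polynomial ComplexConjugate

/-- `K` is the `n`-th polynomial Bergman kernel of `G` at `0`: it reproduces the value at `0` of
every polynomial of degree at most `n`. -/
def IsBergmanKernelPoly (G : Set ℂ) (n : ℕ) (K : ℂ[X]) : Prop :=
  K.natDegree ≤ n ∧ ∀ p : ℂ[X], p.natDegree ≤ n → bergmanInner G p K = p.eval 0

variable {G : Set ℂ}

namespace IsBergmanKernelPoly

variable {m n : ℕ} {K L : ℂ[X]}

theorem bergmanNormSq_sub (hb : Bornology.IsBounded G) (hK : IsBergmanKernelPoly G m K)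
    (hL : IsBergmanKernelPoly G n L) (hmn : m ≤ n) :
    (bergmanNormSq G (L - K) : ℂ) = L.eval 0 - K.eval 0 := by
  have hKK : ((bergmanNormSq G K : ℝ) : ℂ) = K.eval 0 := by
    rw [← bergmanInner_self, hK.2 K hK.1]
  rw [← bergmanInner_self, bergmanInner_sub_left hb, bergmanInner_sub_right hb,
    bergmanInner_sub_right hb, hL.2 L hL.1, hL.2 K (hK.1.trans hmn),
    ← bergmanInner_conj_symm K L, hL.2 K (hK.1.trans hmn), bergmanInner_self, hKK, ← hKK,
    Complex.conj_ofReal]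
  ring

theorem eq (ho : IsOpen G) (hb : Bornology.IsBounded G) (hne : G.Nonempty)
    (hK : IsBergmanKernelPoly G n K) (hL : IsBergmanKernelPoly G n L) : K = L := by
  have h1 : bergmanInner G (K - L) (K - L) = 0 := by
    have hd : (K - L).natDegree ≤ n := (natDegree_sub_le _ _).trans (max_le hK.1 hL.1)
    rw [bergmanInner_sub_right hb, hK.2 _ hd, hL.2 _ hd, sub_self]
  rw [bergmanInner_self, Complex.ofReal_eq_zero] at h1
  exact sub_eq_zero.1 (bergmanNormSq_eq_zero ho hb hne h1)

theorem bergmanInner_sub_eq_zero (hb : Bornology.IsBounded G) (hK : IsBergmanKernelPoly G n K)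
    (hL : IsBergmanKernelPoly G (n + 1) L) {p : ℂ[X]} (hp : p.natDegree ≤ n) :
    bergmanInner G p (L - K) = 0 := by
  rw [bergmanInner_sub_right hb, hL.2 p (by omega), hK.2 p hp, sub_self]

theorem natDegree_sub (ho : IsOpen G) (hb : Bornology.IsBounded G) (hne : G.Nonempty)
    (hK : IsBergmanKernelPoly G n K) (hL : IsBergmanKernelPoly G (n + 1) L) (hKL : L - K ≠ 0) :
    (L - K).natDegree = n + 1 := by
  have hle : (L - K).natDegree ≤ n + 1 :=
    (natDegree_sub_le _ _).trans (max_le hL.1 (hK.1.trans n.le_succ))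
  by_contra! hne'
  have h := hK.bergmanInner_sub_eq_zero hb hL (p := L - K) (by omega)
  rw [bergmanInner_self, Complex.ofReal_eq_zero] at h
  exact hKL (bergmanNormSq_eq_zero ho hb hne h)

theorem eval_zero_re_pos (ho : IsOpen G) (hb : Bornology.IsBounded G) (hne : G.Nonempty)
    (hK : IsBergmanKernelPoly G n K) : 0 < (K.eval 0).re := by
  have h1 : (K.eval 0).re = bergmanNormSq G K := by
    rw [← hK.2 K hK.1, bergmanInner_self, Complex.ofReal_re]
  rw [h1]
  refine lt_of_le_of_ne (bergmanNormSq_nonneg K) fun h => ?_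
  have h2 := hK.2 1 (by simp)
  rw [bergmanNormSq_eq_zero ho hb hne h.symm] at h2
  simp [bergmanInner] at h2

/-- The kernel polynomials of a domain symmetric in the real axis have real coefficients. -/
theorem map_conj (ho : IsOpen G) (hb : Bornology.IsBounded G) (hne : G.Nonempty)
    (hsym : ∀ z : ℂ, z ∈ G ↔ conj z ∈ G) (hK : IsBergmanKernelPoly G n K) :
    K.map (starRingEnd ℂ) = K := by
  have hev : ∀ (p : ℂ[X]) (z : ℂ), (p.map (starRingEnd ℂ)).eval z = conj (p.eval (conj z)) := by
    intro p z
    rw [eval_map, ← eval₂_at_apply, Complex.conj_conj]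
  refine eq ho hb hne ⟨natDegree_map_le.trans hK.1, fun p hp => ?_⟩ hK
  have hpre : Complex.conjLIE ⁻¹' G = G := by
    ext z; exact (hsym z).symm
  have hm : MeasurePreserving (Complex.conjLIE : ℂ → ℂ) := Complex.conjLIE.measurePreserving
  have h := hm.setIntegral_preimage_emb Complex.conjLIE.toHomeomorph.measurableEmbedding
    (fun z => p.eval z * conj ((K.map (starRingEnd ℂ)).eval z)) G
  have h2 := hK.2 (p.map (starRingEnd ℂ)) (natDegree_map_le.trans hp)
  rw [bergmanInner, ← h, hpre]
  rw [hev, map_zero] at h2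
  rw [← Complex.conj_conj (p.eval 0), ← h2, bergmanInner, ← integral_conj]
  congr 1 with z
  simp [hev]

end IsBergmanKernelPoly

theorem bergmanNormSq_derivative_pos (ho : IsOpen G) (hb : Bornology.IsBounded G)
    (hne : G.Nonempty) {n : ℕ} {B : ℂ[X]} (hB : IsBieberbachPoly G 0 n B) :
    0 < bergmanNormSq G (derivative B) := by
  refine lt_of_le_of_ne (bergmanNormSq_nonneg _) fun h => ?_
  have h2 := hB.2.2.1
  rw [bergmanNormSq_eq_zero ho hb hne h.symm] at h2
  simp at h2

theorem IsBieberbachPoly.isBergmanKernelPoly (ho : IsOpen G) (hb : Bornology.IsBounded G)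
    (hne : G.Nonempty) {n : ℕ} {B : ℂ[X]} (hB : IsBieberbachPoly G 0 (n + 1) B) :
    IsBergmanKernelPoly G n
      (derivative (C ((1 / bergmanNormSq G (derivative B) : ℝ) : ℂ) * B)) := by
  have hpos := bergmanNormSq_derivative_pos ho hb hne hB
  rw [derivative_C_mul]
  refine ⟨(natDegree_C_mul_le _ _).trans ((natDegree_derivative_le _).trans ?_), fun p hp => ?_⟩
  · have := hB.1
    omega
  · rw [bergmanInner_C_mul_right, hB.bergmanInner_derivative hb hp, Complex.conj_ofReal]
    have : (bergmanNormSq G (derivative B) : ℂ) ≠ 0 := by exact_mod_cast hpos.ne'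
    push_cast
    field_simp

end KernelPolynomials

section RealLine

theorem mul_le_abs_sub_of_deriv_ne_zero {g f : ℝ → ℝ} (hg : ∀ x, HasDerivAt g (f x) x)
    (hf : Continuous f) {a b c m : ℝ} (hab : a < b) (hbc : b < c)
    (hne : ∀ x ∈ Set.Ioc a c, f x ≠ 0) (hm : ∀ x ∈ Set.Icc b c, m ≤ |f x|) :
    m * (c - b) ≤ |g c - g a| := by
  wlog hc : 0 < f c generalizing g f
  · have := this (g := fun x => -g x) (f := fun x => -f x) (fun x => (hg x).neg) hf.neg
      (fun x hx => neg_ne_zero.2 (hne x hx)) (fun x hx => by rw [abs_neg]; exact hm x hx)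
      (neg_pos.2 (lt_of_le_of_ne (not_lt.1 hc) (hne c ⟨hab.trans hbc, le_rfl⟩)))
    rwa [neg_sub_neg, abs_sub_comm] at this
  have hpos : ∀ x ∈ Set.Ioc a c, 0 < f x := by
    intro x hx
    by_contra! hle
    obtain ⟨y, hy, hy0⟩ := intermediate_value_Icc hx.2 hf.continuousOn ⟨hle, hc.le⟩
    exact hne y ⟨hx.1.trans_le hy.1, hy.2⟩ hy0
  have hcont : Continuous g := continuous_iff_continuousAt.2 fun x => (hg x).continuousAt
  have h1 : g a ≤ g b := by
    refine (monotoneOn_of_deriv_nonneg (convex_Icc a b) hcont.continuousOn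
      (fun x _ => (hg x).differentiableAt.differentiableWithinAt) fun x hx => ?_)
      ⟨le_rfl, hab.le⟩ ⟨hab.le, le_rfl⟩ hab.le
    rw [interior_Icc] at hx
    rw [(hg x).deriv]
    exact (hpos x ⟨hx.1, (hx.2.trans hbc).le⟩).le
  have h2 : m * (c - b) ≤ g c - g b := by
    obtain ⟨y, hy, hy'⟩ := exists_hasDerivAt_eq_slope g f hbc hcont.continuousOn fun x _ => hg x
    have h3 := hm y ⟨hy.1.le, hy.2.le⟩
    rw [abs_of_pos (hpos y ⟨hab.trans hy.1, hy.2.le⟩), hy', le_div_iff₀ (by linarith)] at h3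
    exact h3
  exact (by linarith : m * (c - b) ≤ g c - g a).trans (le_abs_self _)

end RealLine

section Limit

open Polynomial ComplexConjugate Topology

variable {G : Set ℂ}

theorem eval_ofReal_im_eq_zero {p : ℂ[X]} (hp : p.map (starRingEnd ℂ) = p) (x : ℝ) :
    (p.eval (x : ℂ)).im = 0 := by
  rw [← Complex.conj_eq_iff_im, ← eval₂_at_apply, Complex.conj_ofReal, ← eval_map, hp]

theorem hasDerivAt_re_eval (p : ℂ[X]) (x : ℝ) :
    HasDerivAt (fun t : ℝ => (p.eval (t : ℂ)).re) ((derivative p).eval (x : ℂ)).re x :=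
  (p.hasDerivAt (x : ℂ)).real_of_complex

/-- If antiderivatives of the differences of the kernel polynomials stay bounded at a point to the
right of `G`, then the differences decay geometrically, faster than their growth near `G`. -/
theorem exists_summable_bound (ho : IsOpen G) (hb : Bornology.IsBounded G)
    (hc : IsPreconnected G) (h0 : (0 : ℂ) ∈ G) (hsym : ∀ z : ℂ, z ∈ G ↔ conj z ∈ G)
    {ξ x₀ : ℝ} (hξ : (ξ : ℂ) ∈ closure G) (hhalf : ∀ z ∈ G, z.re < ξ) (hx₀ : ξ < x₀)
    {S : ℕ → ℂ[X]} (hS : ∀ n, IsBergmanKernelPoly G n (derivative (S n)))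
    (hS0 : ∀ n, (S n).eval 0 = 0) {M : ℝ} (hM : ∀ n, ‖(S n).eval (x₀ : ℂ)‖ ≤ M) :
    ∃ U : Set ℂ, IsOpen U ∧ IsPreconnected U ∧ closure G ⊆ U ∧ ∃ u : ℕ → ℝ, Summable u ∧
      ∀ n, ∀ z ∈ U, ‖(derivative (S (n + 1) - S n)).eval z‖ ≤ u n := by
  have hne : G.Nonempty := ⟨0, h0⟩
  set x₁ : ℝ := (ξ + x₀) / 2 with hx₁
  have hξ₁ : ξ < x₁ := by rw [hx₁]; linarith
  have h₁₀ : x₁ < x₀ := by rw [hx₁]; linarith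
  obtain ⟨c, hcpos, ρ, hρ, hgrow⟩ := exists_growth_of_orthogonal ho hb hne hhalf hξ₁
  obtain ⟨q', hq', hq'ρ⟩ := exists_between hρ
  obtain ⟨q, hq, hqq'⟩ := exists_between hq'
  obtain ⟨U, hUo, hUc, hGU, C, hC0, hC⟩ := exists_isOpen_norm_eval_le ho hb hc h0 hq
  set Q : ℕ → ℂ[X] := fun n => S (n + 1) - S n with hQ
  set d : ℕ → ℝ := fun n => √(bergmanNormSq G (derivative (Q n))) with hd
  have hd0 : ∀ n, 0 ≤ d n := fun n => Real.sqrt_nonneg _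
  have hQ' : ∀ n, derivative (Q n) = derivative (S (n + 1)) - derivative (S n) := fun n => by
    simp [hQ]
  have hdeg : ∀ n, (derivative (Q n)).natDegree ≤ n + 1 := fun n => by
    rw [hQ']
    exact (natDegree_sub_le _ _).trans (max_le (hS _).1 ((hS n).1.trans n.le_succ))
  have hUbd : ∀ n, ∀ z ∈ U, ‖(derivative (Q n)).eval z‖ ≤ C * q ^ (n + 1) * d n :=
    fun n z hz => hC _ _ (hdeg n) z hz
  have hq'pos : 0 < q' := by linarith
  -- the antiderivatives at `ξ`
  obtain ⟨C', hC'⟩ : ∃ C', ∀ n, ‖(Q n).eval (ξ : ℂ)‖ ≤ C' * (q' ^ n * d n) := by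
    have hsum : Summable fun n : ℕ => C * q * (q / q') ^ n :=
      (summable_geometric_of_lt_one (by positivity) ((div_lt_one hq'pos).2 hqq')).mul_left _
    have hs := summable_of_summable_hasDerivAt_of_isPreconnected hsum hUo hUc
      (g := fun n z => (Q n).eval z / ((q' ^ n * d n : ℝ) : ℂ))
      (g' := fun n z => (derivative (Q n)).eval z / ((q' ^ n * d n : ℝ) : ℂ))
      (fun n z _ => ((Q n).hasDerivAt z).div_const _) (fun n z hz => by
        rw [norm_div, Complex.norm_real, Real.norm_of_nonneg (by have := hd0 n; positivity)]
        rcases (hd0 n).eq_or_lt with h | h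
        · simp only [← h, mul_zero, div_zero]; positivity
        · rw [div_le_iff₀ (by positivity)]
          refine (hUbd n z hz).trans (le_of_eq ?_)
          rw [div_pow]
          field_simp
          ring) (hGU (subset_closure h0)) (by simp [hQ, hS0]) (hGU hξ)
    obtain ⟨C', hC'⟩ := hs.tendsto_atTop_zero.norm.bddAbove_range
    refine ⟨C', fun n => ?_⟩
    have h1 := hC' ⟨n, rfl⟩
    simp only [norm_div, Complex.norm_real] at h1
    rw [Real.norm_of_nonneg (by have := hd0 n; positivity)] at h1
    rcases (hd0 n).eq_or_lt with h | h
    · have h2 : derivative (Q n) = 0 := bergmanNormSq_eq_zero ho hb hne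
        ((Real.sqrt_eq_zero (bergmanNormSq_nonneg _)).1 h.symm)
      rw [eq_C_of_natDegree_eq_zero (derivative_eq_zero.1 h2)]
      have h4 : (Q n).eval 0 = 0 := by simp [hQ, hS0]
      rw [← coeff_zero_eq_eval_zero] at h4
      simp [h4, ← h]
    · rwa [div_le_iff₀ (by positivity)] at h1
  -- comparison on the real axis
  have hM0 : 0 ≤ M := (norm_nonneg _).trans (hM 0)
  have hkey : ∀ n, c * d n * ρ ^ (n + 1) * (x₀ - x₁) ≤ 2 * M + C' * (q' ^ n * d n) := by
    intro n
    by_cases hD0 : derivative (Q n) = 0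
    · have : d n = 0 := by simp [hd, hD0, bergmanNormSq]
      simp [this, hM0]
    have hD0' := hD0
    rw [hQ'] at hD0'
    have hdeg' : (derivative (Q n)).natDegree = n + 1 := by
      rw [hQ']
      exact (hS n).natDegree_sub ho hb hne (hS (n + 1)) hD0'
    have horth : ∀ p : ℂ[X], p.natDegree < (derivative (Q n)).natDegree →
        bergmanInner G p (derivative (Q n)) = 0 := fun p hp => by
      rw [hQ']
      exact (hS n).bergmanInner_sub_eq_zero hb (hS (n + 1)) (by omega)
    have hreal : (derivative (Q n)).map (starRingEnd ℂ) = derivative (Q n) := by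
      rw [hQ', Polynomial.map_sub, (hS n).map_conj ho hb hne hsym,
        (hS (n + 1)).map_conj ho hb hne hsym]
    have hnorm : ∀ x : ℝ, |((derivative (Q n)).eval (x : ℂ)).re| =
        ‖(derivative (Q n)).eval (x : ℂ)‖ := fun x =>
      Complex.abs_re_eq_norm.2 (eval_ofReal_im_eq_zero hreal x)
    have hmain := mul_le_abs_sub_of_deriv_ne_zero (hasDerivAt_re_eval (Q n)) (by fun_prop) hξ₁ h₁₀
      (m := c * d n * ρ ^ (n + 1)) (fun x hx h => by
        rw [← abs_eq_zero, hnorm, norm_eq_zero] at h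
        refine eval_ne_zero_of_orthogonal ho hb hne hD0 horth (ω := 1) (by simp)
          (sub_pos.2 hx.1) (fun z hz => ?_) h
        have := hhalf z hz
        simp; linarith) (fun x hx => by
        rw [hnorm]
        have := hgrow _ hD0 horth x hx.1
        rwa [hdeg'] at this)
    refine hmain.trans ((abs_sub _ _).trans (add_le_add ?_ ?_))
    · refine (Complex.abs_re_le_norm _).trans ?_
      simp only [hQ, eval_sub]
      refine (norm_sub_le _ _).trans ?_
      linarith [hM n, hM (n + 1)]
    · exact (Complex.abs_re_le_norm _).trans (hC' n)
  set κ := c * ρ * (x₀ - x₁) with hκ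
  have hκpos : 0 < κ := by
    have : 0 < x₀ - x₁ := by linarith
    positivity
  have hdecay : ∀ᶠ n in atTop, d n * ρ ^ n ≤ 4 * M / κ := by
    have ht : Tendsto (fun n : ℕ => C' * (q' / ρ) ^ n) atTop (𝓝 (C' * 0)) :=
      (tendsto_pow_atTop_nhds_zero_of_lt_one (by positivity)
        ((div_lt_one (by linarith)).2 hq'ρ)).const_mul _
    rw [mul_zero] at ht
    filter_upwards [ht.eventually_le_const (half_pos hκpos)] with n hn
    have hρn : 0 < ρ ^ n := by positivity
    have h1 : C' * q' ^ n ≤ κ / 2 * ρ ^ n := by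
      rwa [div_pow, ← mul_div_assoc, div_le_iff₀ hρn] at hn
    have h2 := mul_le_mul_of_nonneg_right h1 (hd0 n)
    have h3 := hkey n
    rw [le_div_iff₀ hκpos]
    have h4 : c * d n * ρ ^ (n + 1) * (x₀ - x₁) = d n * ρ ^ n * κ := by rw [hκ]; ring
    rw [h4] at h3
    linarith
  refine ⟨U, hUo, hUc, hGU, fun n => C * q ^ (n + 1) * d n, ?_, hUbd⟩
  have hsum : Summable fun n : ℕ => C * q * (4 * M / κ) * (q / ρ) ^ n :=
    (summable_geometric_of_lt_one (by positivity)
      ((div_lt_one (by linarith)).2 (hqq'.trans hq'ρ))).mul_left _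
  refine hsum.of_norm_bounded_eventually_nat ?_
  filter_upwards [hdecay] with n hn
  have := hd0 n
  rw [Real.norm_of_nonneg (by positivity)]
  have hρn : 0 < ρ ^ n := by positivity
  rw [← le_div_iff₀ hρn] at hn
  calc C * q ^ (n + 1) * d n ≤ C * q ^ (n + 1) * (4 * M / κ / ρ ^ n) := by gcongr
    _ = _ := by rw [div_pow]; field_simp; ring

/-- The kernel polynomials converge near `closure G` to the Bergman kernel. -/
theorem exists_bergman_kernel (ho : IsOpen G) (hb : Bornology.IsBounded G)
    (hc : IsPreconnected G) (h0 : (0 : ℂ) ∈ G) (hsym : ∀ z : ℂ, z ∈ G ↔ conj z ∈ G)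
    {ξ x₀ : ℝ} (hξ : (ξ : ℂ) ∈ closure G) (hhalf : ∀ z ∈ G, z.re < ξ) (hx₀ : ξ < x₀)
    {S : ℕ → ℂ[X]} (hS : ∀ n, IsBergmanKernelPoly G n (derivative (S n)))
    (hS0 : ∀ n, (S n).eval 0 = 0) {M : ℝ} (hM : ∀ n, ‖(S n).eval (x₀ : ℂ)‖ ≤ M) :
    ∃ (U : Set ℂ) (Φ F : ℂ → ℂ), IsOpen U ∧ closure G ⊆ U ∧ (∀ z ∈ U, HasDerivAt Φ (F z) z) ∧
      Φ 0 = 0 ∧ F 0 ≠ 0 ∧ ∀ p : ℂ[X], ∫ z in G, p.eval z * conj (F z) = p.eval 0 := by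
  obtain ⟨U, hUo, hUc, hGU, u, hu, hbd⟩ :=
    exists_summable_bound ho hb hc h0 hsym hξ hhalf hx₀ hS hS0 hM
  have h0U : (0 : ℂ) ∈ U := hGU (subset_closure h0)
  set F : ℂ → ℂ := fun z => (derivative (S 0)).eval z +
    ∑' n, (derivative (S (n + 1) - S n)).eval z with hF
  have htend : ∀ z ∈ U, Tendsto (fun n => (derivative (S n)).eval z) atTop (𝓝 (F z)) := by
    intro z hz
    have h1 : Summable fun n => (derivative (S (n + 1) - S n)).eval z :=
      Summable.of_norm_bounded hu fun n => hbd n z hz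
    refine (h1.hasSum.tendsto_sum_nat.const_add ((derivative (S 0)).eval z)).congr fun n => ?_
    simp only [derivative_sub, eval_sub]
    rw [Finset.sum_range_sub (fun n => (derivative (S n)).eval z)]
    ring
  refine ⟨U, fun z => (S 0).eval z + ∑' n, (S (n + 1) - S n).eval z, F, hUo, hGU,
    fun z hz => ?_, by simp [hS0], fun hF0 => ?_, fun p => ?_⟩
  · exact ((S 0).hasDerivAt z).add (hasDerivAt_tsum_of_isPreconnected hu hUo hUc
      (fun n y _ => (S (n + 1) - S n).hasDerivAt y) hbd h0U (by simp [hS0]) hz)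
  · have h1 : ∀ n, ((derivative (S 0)).eval 0).re ≤ ((derivative (S n)).eval 0).re := fun n => by
      have h := congrArg Complex.re ((hS 0).bergmanNormSq_sub hb (hS n) n.zero_le)
      have h2 := bergmanNormSq_nonneg (G := G) (derivative (S n) - derivative (S 0))
      rw [Complex.ofReal_re, Complex.sub_re] at h
      linarith
    have h2 := ge_of_tendsto' ((Complex.continuous_re.tendsto _).comp (htend 0 h0U)) h1
    rw [hF0, Complex.zero_re] at h2
    exact absurd ((hS 0).eval_zero_re_pos ho hb ⟨0, h0⟩) (not_lt.2 h2)
  · have hcl : IsCompact (closure G) := hb.isCompact_closure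
    obtain ⟨A, hA⟩ := hcl.exists_bound_of_continuousOn
      (f := fun z => p.eval z) (by fun_prop)
    obtain ⟨A', hA'⟩ := hcl.exists_bound_of_continuousOn
      (f := fun z => (derivative (S 0)).eval z) (by fun_prop)
    have hlim : Tendsto (fun n => ∫ z in G, p.eval z * conj ((derivative (S n)).eval z)) atTop
        (𝓝 (∫ z in G, p.eval z * conj (F z))) := by
      refine tendsto_integral_of_dominated_convergence (fun _ => A * (A' + ∑' n, u n))
        (fun n => ?_) ?_ (fun n => ?_) ?_
      · exact (Continuous.aestronglyMeasurable (by fun_prop))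
      · exact integrableOn_const hb.measure_lt_top.ne
      · refine ae_restrict_of_forall_mem ho.measurableSet fun z hz => ?_
        have hz' := subset_closure hz
        rw [norm_mul, RCLike.norm_conj]
        refine mul_le_mul (hA z hz') ?_ (norm_nonneg _) ((norm_nonneg _).trans (hA z hz'))
        have e : (derivative (S n)).eval z = (derivative (S 0)).eval z +
            ∑ i ∈ Finset.range n, (derivative (S (i + 1) - S i)).eval z := by
          simp only [derivative_sub, eval_sub]
          rw [Finset.sum_range_sub (fun n => (derivative (S n)).eval z)]
          ring
        rw [e]
        refine (norm_add_le _ _).trans (add_le_add (hA' z hz') ?_)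
        refine (norm_sum_le_of_le _ fun i _ => hbd i z (hGU hz')).trans ?_
        exact hu.sum_le_tsum _ fun i _ => (norm_nonneg _).trans (hbd i z (hGU hz'))
      · refine ae_restrict_of_forall_mem ho.measurableSet fun z hz => ?_
        exact (((Complex.continuous_conj.tendsto _).comp
          (htend z (hGU (subset_closure hz)))).const_mul _)
    refine tendsto_nhds_unique hlim (tendsto_const_nhds.congr' ?_)
    filter_upwards [eventually_ge_atTop p.natDegree] with n hn
    exact ((hS n).2 p hn).symm

end Limit

section Bieberbach

open Polynomial ComplexConjugate Topology

theorem exists_bergman_kernel_of_bieberbach {G : Set ℂ} (ho : IsOpen G)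
    (hb : Bornology.IsBounded G) (hc : IsPreconnected G) (h0 : (0 : ℂ) ∈ G)
    (hsym : ∀ z : ℂ, z ∈ G ↔ conj z ∈ G) {ξ x₀ : ℝ} (hξ : (ξ : ℂ) ∈ closure G)
    (hhalf : ∀ z ∈ G, z.re < ξ) (hx₀ : ξ < x₀) {B : ℕ → ℂ[X]}
    (hB : ∀ n, 1 ≤ n → IsBieberbachPoly G 0 n (B n)) {M : ℝ}
    (hM : ∀ᶠ n in atTop, ‖(B n).eval (x₀ : ℂ)‖ ≤ M) :
    ∃ (U : Set ℂ) (Φ F : ℂ → ℂ), IsOpen U ∧ closure G ⊆ U ∧ (∀ z ∈ U, HasDerivAt Φ (F z) z) ∧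
      Φ 0 = 0 ∧ F 0 ≠ 0 ∧ ∀ p : ℂ[X], ∫ z in G, p.eval z * conj (F z) = p.eval 0 := by
  have hne : G.Nonempty := ⟨0, h0⟩
  obtain ⟨r, hr, hball⟩ := Metric.isOpen_iff.1 ho 0 h0
  have hV : 0 < volume.real (Metric.ball (0 : ℂ) r) :=
    ENNReal.toReal_pos (Metric.measure_ball_pos _ _ hr).ne' measure_ball_lt_top.ne
  set V := volume.real (Metric.ball (0 : ℂ) r)
  set N : ℕ → ℝ := fun n => bergmanNormSq G (derivative (B (n + 1))) with hN
  have hVN : ∀ n, V ≤ N n := fun n => by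
    have := norm_sq_eval_mul_le_bergmanNormSq hb (derivative (B (n + 1))) hball
    rwa [(hB (n + 1) (by omega)).2.2.1, norm_one, one_pow, one_mul] at this
  have hNpos : ∀ n, 0 < N n := fun n => hV.trans_le (hVN n)
  set S : ℕ → ℂ[X] := fun n => C ((1 / N n : ℝ) : ℂ) * B (n + 1) with hS
  have hSev : ∀ n z, ‖(S n).eval z‖ = 1 / N n * ‖(B (n + 1)).eval z‖ := fun n z => by
    rw [hS, eval_mul, eval_C, norm_mul, Complex.norm_real,
      Real.norm_of_nonneg (one_div_nonneg.2 (hNpos n).le)]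
  have hbdd : IsBoundedUnder (· ≤ ·) atTop fun n => ‖(S n).eval (x₀ : ℂ)‖ := by
    refine isBoundedUnder_of_eventually_le (a := 1 / V * M) ?_
    filter_upwards [(tendsto_add_atTop_nat 1).eventually hM] with n hn
    rw [hSev]
    have := hVN n
    gcongr
  obtain ⟨M', hM'⟩ := hbdd.bddAbove_range
  exact exists_bergman_kernel ho hb hc h0 hsym hξ hhalf hx₀ (S := S)
    (fun n => (hB (n + 1) (by omega)).isBergmanKernelPoly ho hb hne)
    (fun n => by simp [hS, (hB (n + 1) (by omega)).2.1]) (fun n => hM' ⟨n, rfl⟩)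

end Bieberbach

section CauchyTransform

open ComplexConjugate Topology

/-- The Cauchy transform of the restriction of `f` to `G`. -/
noncomputable def cauchyTransform (G : Set ℂ) (f : ℂ → ℂ) (z : ℂ) : ℂ :=
  ∫ w in G, f w * (w - z)⁻¹

theorem integrableOn_norm_inv_sub (z : ℂ) (r : ℝ) :
    IntegrableOn (fun w : ℂ => ‖w - z‖⁻¹) (Metric.ball z r) := by
  have h : IntegrableOn (fun w : ℂ => ‖w‖⁻¹) (Metric.ball 0 r) := by
    refine integrableOn_ball_of_norm_le_rpow (C := 1) (α := 1) (by simp) (by simp)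
      (Eventually.of_forall fun x => ?_) (by fun_prop)
    simp [Real.rpow_neg_one]
  have hp := (measurePreserving_sub_right (volume : Measure ℂ) z).integrableOn_comp_preimage
    (Homeomorph.subRight z).measurableEmbedding (f := fun w : ℂ => ‖w‖⁻¹) (s := Metric.ball 0 r)
  have e : (fun w : ℂ => w - z) ⁻¹' Metric.ball 0 r = Metric.ball z r := by
    ext w; simp [dist_eq_norm]
  rw [e] at hp
  exact hp.2 h

theorem setIntegral_norm_inv_sub (z : ℂ) {r : ℝ} (hr : 0 < r) :
    ∫ w in Metric.ball z r, ‖w - z‖⁻¹ = r * ∫ w in Metric.ball (0 : ℂ) 1, ‖w‖⁻¹ := by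
  have hp := (measurePreserving_sub_right (volume : Measure ℂ) z).setIntegral_preimage_emb
    (Homeomorph.subRight z).measurableEmbedding (fun w : ℂ => ‖w‖⁻¹) (Metric.ball 0 r)
  have e : (fun w : ℂ => w - z) ⁻¹' Metric.ball 0 r = Metric.ball z r := by
    ext w; simp [dist_eq_norm]
  rw [e] at hp
  rw [hp]
  have h := Measure.setIntegral_comp_smul_of_pos (volume : Measure ℂ) (fun w : ℂ => ‖w‖⁻¹)
    (Metric.ball 0 1) hr
  rw [smul_unitBall_of_pos hr, Complex.finrank_real_complex] at h
  simp only [norm_smul, mul_inv, Real.norm_of_nonneg hr.le, integral_const_mul, smul_eq_mul] at h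
  field_simp at h
  simpa only [one_div] using h.symm

variable {G : Set ℂ} {f g : ℂ → ℂ} {C : ℝ}

theorem integrableOn_mul_inv_sub (hb : Bornology.IsBounded G) (hm : MeasurableSet G)
    (hf : AEStronglyMeasurable f (volume.restrict G)) (hC : ∀ w ∈ G, ‖f w‖ ≤ C) (z : ℂ) :
    IntegrableOn (fun w => f w * (w - z)⁻¹) G := by
  obtain ⟨r, hr⟩ := hb.subset_ball z
  refine Integrable.mono' (((integrableOn_norm_inv_sub z r).mono_set hr).const_mul C)
    (hf.mul (by fun_prop)) (ae_restrict_of_forall_mem hm fun w hw => ?_)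
  rw [norm_mul, norm_inv]
  exact mul_le_mul_of_nonneg_right (hC w hw) (by positivity)

theorem continuous_cauchyTransform (hb : Bornology.IsBounded G) (hm : MeasurableSet G)
    (hf : AEStronglyMeasurable f (volume.restrict G)) (hC : ∀ w ∈ G, ‖f w‖ ≤ C) :
    Continuous (cauchyTransform G f) := by
  wlog hC0 : 0 < C generalizing C
  · exact this (C := |C| + 1) (fun w hw => (hC w hw).trans ((le_abs_self C).trans (by linarith)))
      (by positivity)
  set η := ∫ w in Metric.ball (0 : ℂ) 1, ‖w‖⁻¹ with hη
  have hη0 : 0 ≤ η := integral_nonneg fun _ => by positivity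
  refine continuous_of_uniform_approx_of_continuous fun u hu => ?_
  obtain ⟨δ, hδ, hδu⟩ := Metric.mem_uniformity_dist.1 hu
  obtain ⟨ε, hε, hεδ⟩ : ∃ ε > 0, C * (2 * (ε * η)) < δ := by
    refine ⟨δ / (2 * C * (η + 1)), by positivity, ?_⟩
    rw [show C * (2 * (δ / (2 * C * (η + 1)) * η)) = δ * (η / (η + 1)) by field_simp]
    exact mul_lt_of_lt_one_right hδ ((div_lt_one (by linarith)).2 (by linarith))
  set k : ℂ → ℂ := fun w => conj w / ((max ‖w‖ ε ^ 2 : ℝ) : ℂ) with hk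
  have hmax : ∀ w : ℂ, 0 < max ‖w‖ ε := fun w => lt_max_of_lt_right hε
  have hkcont : Continuous k := by
    refine Complex.continuous_conj.div (by fun_prop) fun w => ?_
    exact_mod_cast (pow_pos (hmax w) 2).ne'
  have hknorm : ∀ w, ‖k w‖ = ‖w‖ / max ‖w‖ ε ^ 2 := fun w => by
    rw [hk, norm_div, RCLike.norm_conj, Complex.norm_real, Real.norm_of_nonneg (by positivity)]
  have hkbd : ∀ w, ‖k w‖ ≤ 1 / ε := fun w => by
    rw [hknorm, div_le_div_iff₀ (pow_pos (hmax w) 2) hε, one_mul, sq]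
    exact mul_le_mul (le_max_left _ _) (le_max_right _ _) hε.le (hmax w).le
  have hkeq : ∀ w, ε ≤ ‖w‖ → k w = w⁻¹ := fun w hw => by
    rw [hk]
    simp only [max_eq_left hw]
    rw [Complex.inv_def, Complex.normSq_eq_norm_sq, div_eq_mul_inv, Complex.ofReal_inv]
  have hkdiff : ∀ w, ‖w‖ < ε → ‖w⁻¹ - k w‖ ≤ 2 * ‖w‖⁻¹ := fun w hw => by
    refine (norm_sub_le _ _).trans ?_
    rw [hknorm, max_eq_right hw.le, norm_inv, two_mul]
    gcongr
    rcases (norm_nonneg w).eq_or_lt with h | h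
    · simp [← h]
    · rw [inv_eq_one_div, div_le_div_iff₀ (by positivity) h]
      nlinarith
  have hint : ∀ z, IntegrableOn (fun w => f w * k (w - z)) G := fun z => by
    refine Integrable.mono' (g := fun _ => C * (1 / ε))
      (integrableOn_const hb.measure_lt_top.ne)
      (hf.mul (by fun_prop)) (ae_restrict_of_forall_mem hm fun w hw => ?_)
    rw [norm_mul]
    exact mul_le_mul (hC w hw) (hkbd _) (norm_nonneg _) hC0.le
  refine ⟨fun z => ∫ w in G, f w * k (w - z), ?_, fun z => hδu ?_⟩
  · refine continuous_of_dominated (bound := fun _ => C * (1 / ε)) (fun z => (hint z).1)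
      (fun z => ae_restrict_of_forall_mem hm fun w hw => ?_)
      (integrableOn_const hb.measure_lt_top.ne)
      (Eventually.of_forall fun w => by fun_prop)
    rw [norm_mul]
    exact mul_le_mul (hC w hw) (hkbd _) (norm_nonneg _) hC0.le
  · rw [dist_eq_norm, cauchyTransform,
      ← integral_sub (integrableOn_mul_inv_sub hb hm hf hC z) (hint z)]
    refine lt_of_le_of_lt ?_ hεδ
    have hi := (integrableOn_norm_inv_sub z ε)
    have hi' : Integrable ((Metric.ball z ε).indicator fun w : ℂ => ‖w - z‖⁻¹) :=
      hi.integrable_indicator Metric.isOpen_ball.measurableSet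
    calc ‖∫ w in G, (f w * (w - z)⁻¹ - f w * k (w - z))‖
        ≤ ∫ w in G, C * (2 * (Metric.ball z ε).indicator (fun w : ℂ => ‖w - z‖⁻¹) w) := by
          refine norm_integral_le_of_norm_le
            ((hi'.integrableOn.const_mul 2).const_mul C)
            (ae_restrict_of_forall_mem hm fun w hw => ?_)
          rw [← mul_sub, norm_mul]
          refine mul_le_mul (hC w hw) ?_ (norm_nonneg _) hC0.le
          by_cases hwε : w ∈ Metric.ball z ε
          · rw [Set.indicator_of_mem hwε]
            exact hkdiff _ (by simpa [dist_eq_norm] using hwε)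
          · rw [Set.indicator_of_notMem hwε, hkeq, sub_self, norm_zero, mul_zero]
            simpa [dist_eq_norm] using hwε
      _ = C * (2 * ∫ w in G, (Metric.ball z ε).indicator (fun w : ℂ => ‖w - z‖⁻¹) w) := by
          rw [integral_const_mul, integral_const_mul]
      _ ≤ C * (2 * ∫ w, (Metric.ball z ε).indicator (fun w : ℂ => ‖w - z‖⁻¹) w) := by
          refine mul_le_mul_of_nonneg_left (mul_le_mul_of_nonneg_left
            (setIntegral_le_integral hi' (Eventually.of_forall fun w => ?_)) (by norm_num)) hC0.le
          exact Set.indicator_nonneg (fun _ _ => by positivity) _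
      _ = _ := by
          rw [integral_indicator Metric.isOpen_ball.measurableSet, setIntegral_norm_inv_sub z hε]

theorem ae_restrict_ne (z : ℂ) : ∀ᵐ w ∂volume.restrict G, w ≠ z :=
  ae_restrict_of_ae (Measure.ae_ne volume z)

/-- The Cauchy transform is complex differentiable at points where the density vanishes to first
order. -/
theorem differentiableAt_cauchyTransform (hb : Bornology.IsBounded G) (hm : MeasurableSet G)
    (hf : AEStronglyMeasurable f (volume.restrict G)) {z₀ : ℂ}
    (hC : ∀ w ∈ G, ‖f w‖ ≤ C * ‖w - z₀‖) : DifferentiableAt ℂ (cauchyTransform G f) z₀ := by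
  obtain ⟨r, hr⟩ := hb.subset_ball z₀
  have hbd : ∀ w ∈ G, ‖f w‖ ≤ |C| * r := fun w hw => by
    refine (hC w hw).trans ((mul_le_mul_of_nonneg_right (le_abs_self C) (norm_nonneg _)).trans ?_)
    gcongr
    have := hr hw
    rw [mem_ball_iff_norm] at this
    exact this.le
  set g : ℂ → ℂ := fun w => f w * (w - z₀)⁻¹ with hg
  have hgm : AEStronglyMeasurable g (volume.restrict G) := hf.mul (by fun_prop)
  have hgbd : ∀ w ∈ G, ‖g w‖ ≤ |C| := fun w hw => by
    rw [hg, norm_mul, norm_inv]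
    rcases (norm_nonneg (w - z₀)).eq_or_lt with h | h
    · rw [← h]; simp
    · rw [← div_eq_mul_inv, div_le_iff₀ h]
      exact (hC w hw).trans (mul_le_mul_of_nonneg_right (le_abs_self C) (norm_nonneg _))
  have hcont := continuous_cauchyTransform hb hm hgm hgbd
  refine HasDerivAt.differentiableAt (f' := cauchyTransform G g z₀) ?_
  rw [hasDerivAt_iff_tendsto_slope]
  refine ((hcont.tendsto z₀).mono_left nhdsWithin_le_nhds).congr' ?_
  filter_upwards [self_mem_nhdsWithin] with z hz
  have hz' : z - z₀ ≠ 0 := sub_ne_zero.2 hz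
  rw [slope_def_field, eq_div_iff hz', cauchyTransform, cauchyTransform, cauchyTransform,
    ← integral_sub (integrableOn_mul_inv_sub hb hm hf hbd z)
      (integrableOn_mul_inv_sub hb hm hf hbd z₀), ← integral_mul_const]
  refine integral_congr_ae ?_
  filter_upwards [ae_restrict_ne z, ae_restrict_ne z₀] with w h1 h2
  have h1' := sub_ne_zero.2 h1
  have h2' := sub_ne_zero.2 h2
  simp only [hg]
  field_simp
  ring

end CauchyTransform

section DiscTransform

open ComplexConjugate Topology Pointwise

theorem setIntegral_annulus_inv_sub_one {s : ℝ} :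
    ∫ u in Metric.ball (0 : ℂ) s \ Metric.ball 0 2, (u - 1)⁻¹ = 0 := by
  set S := Metric.ball (0 : ℂ) s \ Metric.ball 0 2 with hS
  have hmS : MeasurableSet S := Metric.isOpen_ball.measurableSet.diff Metric.isOpen_ball.measurableSet
  have hfin : volume S < ⊤ := (Metric.isBounded_ball.subset Set.sdiff_subset).measure_lt_top
  have hrot : ∀ u : ℂ, ‖u‖ = 1 → (fun w => u * w) ⁻¹' S = S := fun u hu => by
    rw [hS, Set.preimage_sdiff, preimage_mul_ball_zero hu, preimage_mul_ball_zero hu]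
  have hge : ∀ u ∈ S, 2 ≤ ‖u‖ := fun u hu => by simpa using hu.2
  have hinv : ∀ u ∈ S, ‖u⁻¹‖ ≤ 2⁻¹ := fun u hu => by
    rw [norm_inv]; exact inv_anti₀ (by norm_num) (hge u hu)
  have hsub : ∀ u ∈ S, ‖(u - 1)⁻¹‖ ≤ 1 := fun u hu => by
    rw [norm_inv]
    refine inv_le_one_of_one_le₀ ?_
    have := norm_sub_norm_le u 1
    rw [norm_one] at this
    linarith [hge u hu]
  have hbd : ∀ N : ℕ, ∀ u ∈ S, ‖u⁻¹ ^ N * (u - 1)⁻¹‖ ≤ 2⁻¹ ^ N := fun N u hu => by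
    rw [norm_mul, norm_pow]
    calc ‖u⁻¹‖ ^ N * ‖(u - 1)⁻¹‖ ≤ 2⁻¹ ^ N * 1 := by
          gcongr
          exacts [hinv u hu, hsub u hu]
      _ = _ := mul_one _
  have hi : ∀ N : ℕ, IntegrableOn (fun u => u⁻¹ ^ N * (u - 1)⁻¹) S := fun N =>
    Integrable.mono' (g := fun _ => 2⁻¹ ^ N) (integrableOn_const hfin.ne) (by fun_prop)
      (ae_restrict_of_forall_mem hmS (hbd N))
  have hi' : ∀ N : ℕ, IntegrableOn (fun u : ℂ => u⁻¹ ^ N) S := fun N =>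
    Integrable.mono' (g := fun _ => 2⁻¹ ^ N) (integrableOn_const hfin.ne) (by fun_prop)
      (ae_restrict_of_forall_mem hmS fun u hu => by
        rw [norm_pow]; exact pow_le_pow_left₀ (norm_nonneg _) (hinv u hu) N)
  have hstep : ∀ N : ℕ, ∫ u in S, u⁻¹ ^ N * (u - 1)⁻¹ = ∫ u in S, (u - 1)⁻¹ := fun N => by
    induction N with
    | zero => simp
    | succ N ih =>
      have h0 : ∫ u in S, u⁻¹ ^ (N + 1) = 0 := by
        have := setIntegral_zpow_eq_zero hrot (n := -((N + 1 : ℕ) : ℤ)) (by omega)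
        simpa only [zpow_neg, zpow_natCast, inv_pow] using this
      rw [← ih, ← zero_add (∫ u in S, u⁻¹ ^ (N + 1) * (u - 1)⁻¹), ← h0,
        ← integral_add (hi' _) (hi _)]
      refine setIntegral_congr_fun hmS fun u hu => ?_
      have h1 : u ≠ 0 := fun h => by have := hge u hu; rw [h, norm_zero] at this; linarith
      have h2 : u - 1 ≠ 0 := fun h => by
        have := hge u hu; rw [sub_eq_zero.1 h, norm_one] at this; linarith
      simp only [pow_succ]
      field_simp
      ring
  have hlim : Tendsto (fun N : ℕ => (2⁻¹ : ℝ) ^ N * volume.real S) atTop (𝓝 (0 * volume.real S)) :=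
    (tendsto_pow_atTop_nhds_zero_of_lt_one (by norm_num) (by norm_num)).mul_const _
  rw [zero_mul] at hlim
  refine norm_le_zero_iff.1 (ge_of_tendsto' hlim fun N => ?_)
  rw [← hstep N]
  exact norm_setIntegral_le_of_norm_le_const hfin (hbd N)

/-- Inside a disc the Cauchy transform of its indicator is a universal multiple of the conjugate of
the distance to the centre. -/
theorem exists_cauchyTransform_ball :
    ∃ c : ℂ, ∀ (z₀ : ℂ) (r : ℝ), ∀ z ∈ Metric.ball z₀ (r / 2),
      cauchyTransform (Metric.ball z₀ r) (fun _ => 1) z = c * conj (z - z₀) := by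
  refine ⟨∫ u in Metric.ball (0 : ℂ) 2, (u - 1)⁻¹, fun z₀ r z hz => ?_⟩
  have htr : cauchyTransform (Metric.ball z₀ r) (fun _ => 1) z =
      ∫ w in Metric.ball (0 : ℂ) r, (w - (z - z₀))⁻¹ := by
    have hp := (measurePreserving_sub_right (volume : Measure ℂ) z₀).setIntegral_preimage_emb
      (Homeomorph.subRight z₀).measurableEmbedding (fun w : ℂ => (w - (z - z₀))⁻¹)
      (Metric.ball 0 r)
    have e : (fun w : ℂ => w - z₀) ⁻¹' Metric.ball 0 r = Metric.ball z₀ r := by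
      ext w; simp [dist_eq_norm]
    rw [e] at hp
    rw [← hp, cauchyTransform]
    simp
  rw [htr]
  rw [mem_ball_iff_norm] at hz
  generalize z - z₀ = a at hz
  rcases eq_or_ne a 0 with rfl | ha
  · have := setIntegral_zpow_eq_zero (S := Metric.ball (0 : ℂ) r)
      (fun u hu => preimage_mul_ball_zero hu r) (n := -1) (by norm_num)
    simpa using this
  have ha' : 0 < ‖a‖ := norm_pos_iff.2 ha
  have hac : (‖a‖ : ℂ) ≠ 0 := by exact_mod_cast ha'.ne'
  have hv : ‖a / ‖a‖‖ = 1 := by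
    rw [norm_div, Complex.norm_real, norm_norm, div_self ha'.ne']
  have h1 := setIntegral_comp_rotation hv (fun w => (w - a)⁻¹) (preimage_mul_ball_zero hv r)
  have h2 := Measure.setIntegral_comp_smul_of_pos (volume : Measure ℂ)
    (fun w : ℂ => (a / ‖a‖ * w - a)⁻¹) (Metric.ball 0 (r / ‖a‖)) ha'
  have h3 : ‖a‖ • Metric.ball (0 : ℂ) (r / ‖a‖) = Metric.ball 0 r := by
    rw [smul_ball ha'.ne', smul_zero, Real.norm_of_nonneg ha'.le, mul_div_cancel₀ _ ha'.ne']
  have h4 : ∀ w : ℂ, (a / ‖a‖ * (‖a‖ • w) - a)⁻¹ = a⁻¹ * (w - 1)⁻¹ := fun w => by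
    rw [Complex.real_smul, ← mul_assoc, div_mul_cancel₀ _ hac, ← mul_inv, mul_sub, mul_one]
  have hr2 : 2 ≤ r / ‖a‖ := by rw [le_div_iff₀ ha']; linarith
  have h5 : ∫ u in Metric.ball (0 : ℂ) (r / ‖a‖), (u - 1)⁻¹ =
      ∫ u in Metric.ball (0 : ℂ) 2, (u - 1)⁻¹ := by
    have hi : IntegrableOn (fun u : ℂ => (u - 1)⁻¹) (Metric.ball 0 (r / ‖a‖)) := by
      simpa using integrableOn_mul_inv_sub (f := fun _ => 1) (C := 1)
        (Metric.isBounded_ball (x := (0 : ℂ)) (r := r / ‖a‖)) Metric.isOpen_ball.measurableSet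
        aestronglyMeasurable_const (by simp) 1
    have := setIntegral_annulus_inv_sub_one (s := r / ‖a‖)
    rwa [setIntegral_sdiff Metric.isOpen_ball.measurableSet hi (Metric.ball_subset_ball hr2),
      sub_eq_zero] at this
  simp only [h4, h3, integral_const_mul, h5, h1, Complex.finrank_real_complex] at h2
  rw [Complex.real_smul, eq_comm] at h2
  push_cast at h2
  rw [inv_mul_eq_iff_eq_mul₀ (pow_ne_zero 2 hac)] at h2
  rw [h2, ← mul_assoc, mul_comm _ (conj a)]
  congr 1
  rw [← Complex.mul_conj']
  field_simp

end DiscTransform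

section KernelTransform

open ComplexConjugate Topology Polynomial

variable {G U : Set ℂ} {Φ F : ℂ → ℂ}

theorem exists_norm_le_mul_norm_sub {f : ℂ → ℂ} {C : ℝ} (hC : ∀ w ∈ G, ‖f w‖ ≤ C) {z₀ : ℂ} {K : ℝ}
    (hK : ∀ᶠ w in 𝓝 z₀, w ∈ G → ‖f w‖ ≤ K * ‖w - z₀‖) :
    ∃ C' : ℝ, ∀ w ∈ G, ‖f w‖ ≤ C' * ‖w - z₀‖ := by
  obtain ⟨δ, hδ, h⟩ := Metric.eventually_nhds_iff.1 hK
  refine ⟨max K (|C| / δ), fun w hw => ?_⟩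
  rcases lt_or_ge (dist w z₀) δ with h1 | h1
  · exact (h h1 hw).trans (mul_le_mul_of_nonneg_right (le_max_left _ _) (norm_nonneg _))
  · rw [dist_eq_norm] at h1
    calc ‖f w‖ ≤ |C| / δ * δ := by
          rw [div_mul_cancel₀ _ hδ.ne']; exact (hC w hw).trans (le_abs_self C)
      _ ≤ max K (|C| / δ) * ‖w - z₀‖ := by
          gcongr
          exact le_max_right _ _

theorem differentiableOn_cauchyTransform_compl_closure (hb : Bornology.IsBounded G)
    (hm : MeasurableSet G) {f : ℂ → ℂ} {C : ℝ} (hf : AEStronglyMeasurable f (volume.restrict G))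
    (hC : ∀ w ∈ G, ‖f w‖ ≤ C) : DifferentiableOn ℂ (cauchyTransform G f) (closure G)ᶜ := by
  intro z hz
  obtain ⟨C', hC'⟩ := exists_norm_le_mul_norm_sub (K := 0) hC (z₀ := z) (by
    filter_upwards [isClosed_closure.isOpen_compl.mem_nhds hz] with w hw hw'
    exact (hw (subset_closure hw')).elim)
  exact (differentiableAt_cauchyTransform hb hm hf hC').differentiableWithinAt

/-- If the moments of `f` are those of the point mass at `0`, then so is its Cauchy transform near
infinity. -/
theorem cauchyTransform_eq_neg_inv (hm : MeasurableSet G) {f : ℂ → ℂ} {C R : ℝ}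
    (hR : 0 < R) (hGR : G ⊆ Metric.ball 0 R)
    (hf : AEStronglyMeasurable f (volume.restrict G)) (hC : ∀ w ∈ G, ‖f w‖ ≤ C)
    (hmom : ∀ p : ℂ[X], ∫ w in G, p.eval w * f w = p.eval 0) {z : ℂ} (hz : 2 * R < ‖z‖) :
    cauchyTransform G f z = -z⁻¹ := by
  have hb : Bornology.IsBounded G := Metric.isBounded_ball.subset hGR
  have hfin : volume G < ⊤ := hb.measure_lt_top
  have hz0 : z ≠ 0 := norm_pos_iff.1 (by linarith)
  have hlt : ∀ w ∈ G, ‖w‖ < R := fun w hw => by simpa using hGR hw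
  have hquot : ∀ w ∈ G, ‖w / z‖ ≤ 2⁻¹ := fun w hw => by
    rw [norm_div, div_le_iff₀ (by linarith)]
    linarith [hlt w hw]
  have hpow : ∀ N : ℕ, ∀ w ∈ G, ‖f w * (w / z) ^ N‖ ≤ |C| * 2⁻¹ ^ N := fun N w hw => by
    rw [norm_mul, norm_pow]
    gcongr
    exacts [(hC w hw).trans (le_abs_self C), hquot w hw]
  have hinv : ∀ w ∈ G, ‖(w - z)⁻¹‖ ≤ R⁻¹ := fun w hw => by
    rw [norm_inv]
    refine inv_anti₀ hR ?_
    rw [norm_sub_rev]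
    linarith [norm_sub_norm_le z w, hlt w hw]
  have hbd : ∀ N : ℕ, ∀ w ∈ G, ‖f w * (w / z) ^ N * (w - z)⁻¹‖ ≤ |C| * 2⁻¹ ^ N * R⁻¹ :=
    fun N w hw => by
      rw [norm_mul]
      gcongr
      exacts [hpow N w hw, hinv w hw]
  have hi : ∀ N : ℕ, IntegrableOn (fun w => f w * (w / z) ^ N * (w - z)⁻¹) G := fun N =>
    Integrable.mono' (g := fun _ => |C| * 2⁻¹ ^ N * R⁻¹) (integrableOn_const hfin.ne)
      ((hf.mul (by fun_prop)).mul (by fun_prop)) (ae_restrict_of_forall_mem hm (hbd N))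
  have hi' : ∀ N : ℕ, IntegrableOn (fun w => -z⁻¹ * (f w * (w / z) ^ N)) G := fun N =>
    (Integrable.mono' (g := fun _ => |C| * 2⁻¹ ^ N) (integrableOn_const hfin.ne)
      (hf.mul (by fun_prop)) (ae_restrict_of_forall_mem hm (hpow N))).const_mul _
  have hmom' : ∀ N : ℕ, ∫ w in G, -z⁻¹ * (f w * (w / z) ^ N) = if N = 0 then -z⁻¹ else 0 :=
    fun N => by
      have h1 := hmom (X ^ N * Polynomial.C (-z⁻¹ * z⁻¹ ^ N))
      have h2 : ∀ w, -z⁻¹ * (f w * (w / z) ^ N) =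
          (X ^ N * Polynomial.C (-z⁻¹ * z⁻¹ ^ N)).eval w * f w := fun w => by
        simp only [eval_mul, eval_pow, eval_X, eval_C, div_eq_mul_inv, mul_pow]
        ring
      simp only [h2]
      rw [h1]
      rcases eq_or_ne N 0 with rfl | hN
      · simp
      · simp [hN]
  have hrec : ∀ N : ℕ, ∫ w in G, f w * (w / z) ^ N * (w - z)⁻¹ =
      (if N = 0 then -z⁻¹ else 0) + ∫ w in G, f w * (w / z) ^ (N + 1) * (w - z)⁻¹ := fun N => by
    rw [← hmom', ← integral_add (hi' N) (hi (N + 1))]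
    refine setIntegral_congr_fun hm fun w hw => ?_
    have h2 : w - z ≠ 0 := fun h => by
      have := hlt w hw
      rw [sub_eq_zero.1 h] at this
      linarith
    simp only [pow_succ]
    field_simp
    ring
  have hstep : ∀ N : ℕ, ∫ w in G, f w * (w / z) ^ (N + 1) * (w - z)⁻¹ =
      ∫ w in G, f w * (w / z) ^ 1 * (w - z)⁻¹ := fun N => by
    induction N with
    | zero => rfl
    | succ N ih => rw [← ih, hrec (N + 1), if_neg N.succ_ne_zero, zero_add]
  have hlim : Tendsto (fun N : ℕ => |C| * 2⁻¹ ^ (N + 1) * R⁻¹ * volume.real G) atTop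
      (𝓝 (|C| * 0 * R⁻¹ * volume.real G)) :=
    ((((tendsto_pow_atTop_nhds_zero_of_lt_one (by norm_num) (by norm_num)).comp
      (tendsto_add_atTop_nat 1)).const_mul _).mul_const _).mul_const _
  rw [mul_zero, zero_mul, zero_mul] at hlim
  have hzero : ∫ w in G, f w * (w / z) ^ 1 * (w - z)⁻¹ = 0 := by
    refine norm_le_zero_iff.1 (ge_of_tendsto' hlim fun N => ?_)
    rw [← hstep N]
    exact norm_setIntegral_le_of_norm_le_const hfin (hbd _)
  have := hrec 0
  rw [zero_add, hzero, if_pos rfl, add_zero] at this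
  simpa [cauchyTransform] using this

theorem exists_cauchyTransform_conj (ho : IsOpen G) (hb : Bornology.IsBounded G) (hU : IsOpen U)
    (hGU : closure G ⊆ U) (hΦ : ∀ z ∈ U, HasDerivAt Φ (F z) z)
    (hF : ∀ p : ℂ[X], ∫ z in G, p.eval z * conj (F z) = p.eval 0) :
    ∃ (h : ℂ → ℂ) (κ : ℂ) (R : ℝ), Continuous h ∧ (∀ z, R < ‖z‖ → h z = -z⁻¹) ∧
      DifferentiableOn ℂ h (closure G)ᶜ ∧ DifferentiableOn ℂ (fun z => h z + κ * conj (Φ z)) G := by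
  have hFdiff : DifferentiableOn ℂ F U :=
    (DifferentiableOn.deriv (fun z hz => (hΦ z hz).differentiableAt.differentiableWithinAt)
      hU).congr fun z hz => (hΦ z hz).deriv.symm
  obtain ⟨C, hC⟩ := hb.isCompact_closure.exists_bound_of_continuousOn (hFdiff.continuousOn.mono hGU)
  have hC' : ∀ w ∈ G, ‖conj (F w)‖ ≤ C := fun w hw => by
    rw [RCLike.norm_conj]; exact hC w (subset_closure hw)
  have hGsub : G ⊆ U := subset_closure.trans hGU
  have hmeas : AEStronglyMeasurable (fun w => conj (F w)) (volume.restrict G) :=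
    (Complex.continuous_conj.comp_continuousOn
      (hFdiff.continuousOn.mono hGsub)).aestronglyMeasurable ho.measurableSet
  obtain ⟨R, hR, hGR⟩ := hb.subset_ball_lt 0 0
  obtain ⟨c, hc⟩ := exists_cauchyTransform_ball
  have hm := ho.measurableSet
  refine ⟨cauchyTransform G fun w => conj (F w), -c, 2 * R,
    continuous_cauchyTransform hb hm hmeas hC', fun z hz =>
      cauchyTransform_eq_neg_inv hm hR hGR hmeas hC' hF hz,
    differentiableOn_cauchyTransform_compl_closure hb hm hmeas hC', fun z₀ hz₀ => ?_⟩
  obtain ⟨r, hr, hrG⟩ := Metric.isOpen_iff.1 ho z₀ hz₀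
  have hmb : MeasurableSet (Metric.ball z₀ r) := Metric.isOpen_ball.measurableSet
  set i : ℂ → ℂ := (Metric.ball z₀ r).indicator fun _ => conj (F z₀) with hi
  set f : ℂ → ℂ := fun w => conj (F w) - i w with hf
  have him : AEStronglyMeasurable i (volume.restrict G) :=
    (aestronglyMeasurable_const.indicator hmb)
  have hibd : ∀ w ∈ G, ‖i w‖ ≤ C := fun w _ =>
    (norm_indicator_le_norm_self _ _).trans (hC' z₀ hz₀)
  have hfm : AEStronglyMeasurable f (volume.restrict G) := hmeas.sub him
  have hfbd : ∀ w ∈ G, ‖f w‖ ≤ C + C := fun w hw =>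
    (norm_sub_le _ _).trans (add_le_add (hC' w hw) (hibd w hw))
  obtain ⟨K, hK⟩ :=
    (((hFdiff z₀ (hGsub hz₀)).differentiableAt (hU.mem_nhds (hGsub hz₀))).isBigO_sub).bound
  obtain ⟨C₁, hC₁⟩ := exists_norm_le_mul_norm_sub (K := K) hfbd (z₀ := z₀) (by
    filter_upwards [hK, Metric.ball_mem_nhds z₀ hr] with w hw hwr _
    rw [hf, hi]
    simp only [Set.indicator_of_mem hwr]
    rw [← map_sub, RCLike.norm_conj]
    exact hw)
  have hd1 := differentiableAt_cauchyTransform hb hm hfm hC₁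
  have hd2 : DifferentiableAt ℂ (fun z => conj (F z₀ * (z - z₀) - Φ z)) z₀ := by
    refine HasDerivAt.differentiableAt (f' := 0) ?_
    have h0 : HasDerivAt (fun z => F z₀ * (z - z₀) - Φ z) 0 z₀ := by
      have := (((hasDerivAt_id z₀).sub_const z₀).const_mul (F z₀)).sub (hΦ z₀ (hGsub hz₀))
      rw [mul_one, sub_self] at this
      exact this
    rw [hasDerivAt_iff_isLittleO] at h0 ⊢
    refine Asymptotics.IsLittleO.of_norm_left ?_
    simpa only [smul_zero, sub_zero, ← map_sub, RCLike.norm_conj] using h0.norm_left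
  refine DifferentiableAt.differentiableWithinAt ?_
  refine (hd1.add (hd2.const_mul c)).congr_of_eventuallyEq ?_
  filter_upwards [Metric.ball_mem_nhds z₀ (half_pos hr)] with z hz
  have e1 : cauchyTransform G (fun w => conj (F w)) z =
      cauchyTransform G f z + cauchyTransform G i z := by
    rw [cauchyTransform, cauchyTransform, cauchyTransform,
      ← integral_add (integrableOn_mul_inv_sub hb hm hfm hfbd z)
        (integrableOn_mul_inv_sub hb hm him hibd z)]
    refine integral_congr_ae (Eventually.of_forall fun w => ?_)
    simp only [hf]
    ring
  have e2 : cauchyTransform G i z = conj (F z₀) * (c * conj (z - z₀)) := by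
    rw [← hc z₀ r z hz, cauchyTransform, cauchyTransform, ← integral_const_mul]
    have : ∀ w, i w * (w - z)⁻¹ =
        (Metric.ball z₀ r).indicator (fun w => conj (F z₀) * (1 * (w - z)⁻¹)) w := fun w => by
      by_cases hw : w ∈ Metric.ball z₀ r <;> simp [hi, hw]
    simp only [this]
    rw [setIntegral_indicator hmb, Set.inter_eq_self_of_subset_right hrG]
  simp only [Pi.add_apply, e1, e2, map_sub, map_mul]
  ring

end KernelTransform

section JordanExterior

open Topology Complex ComplexOrder

theorem isPreconnected_setOf_lt_norm {R : ℝ} (hR : 0 < R) : IsPreconnected {z : ℂ | R < ‖z‖} := by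
  have h : {z : ℂ | R < ‖z‖} = Complex.exp '' {z | Real.log R < z.re} := by
    ext z
    constructor
    · intro hz
      have hz0 : z ≠ 0 := norm_pos_iff.1 (hR.trans hz)
      exact ⟨Complex.log z, by
        simpa [Complex.log_re] using Real.log_lt_log hR hz, Complex.exp_log hz0⟩
    · rintro ⟨w, hw, rfl⟩
      rw [Set.mem_ofPred_eq, Complex.norm_exp]
      exact (Real.log_lt_iff_lt_exp hR).1 hw
  rw [h]
  exact (convex_halfSpace_re_gt _).isPreconnected.image _ Complex.continuous_exp.continuousOn

/-- There is no continuous logarithm of the identity on a neighbourhood of infinity. -/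
theorem not_exp_eq_self_of_continuous {L : ℂ → ℂ} (hL : Continuous L) {R : ℝ} (hR : 0 < R)
    (h : ∀ z, ‖z‖ = R → Complex.exp (L z) = z) : False := by
  set D : ℝ → ℂ := fun t => L (R * Complex.exp (t * I)) - t * I with hD
  have hDexp : ∀ t, Complex.exp (D t) = R := fun t => by
    rw [hD]
    simp only [Complex.exp_sub]
    rw [h, mul_div_cancel_right₀ _ (Complex.exp_ne_zero _)]
    rw [norm_mul, Complex.norm_exp_ofReal_mul_I, mul_one, Complex.norm_real,
      Real.norm_of_nonneg hR.le]
  have hDcont : Continuous D := by fun_prop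
  set g : ℝ → ℝ := fun t => ((D t - D 0) / (2 * Real.pi * I)).re with hg
  have hpi : (2 * Real.pi * I : ℂ) ≠ 0 := Complex.two_pi_I_ne_zero
  have hgcont : Continuous g := Complex.continuous_re.comp ((hDcont.sub continuous_const).div_const _)
  have hgint : ∀ t, ∃ n : ℤ, g t = n := fun t => by
    obtain ⟨n, hn⟩ := Complex.exp_eq_exp_iff_exists_int.1 ((hDexp t).trans (hDexp 0).symm)
    refine ⟨n, ?_⟩
    simp only [hg]
    rw [hn, add_sub_cancel_left, mul_div_cancel_right₀ _ hpi]
    simp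
  have hg0 : g 0 = 0 := by simp [hg]
  have hg1 : g (2 * Real.pi) = -1 := by
    have : D (2 * Real.pi) - D 0 = -(2 * Real.pi * I) := by
      simp only [hD]
      push_cast
      rw [Complex.exp_two_pi_mul_I]
      simp
    simp only [hg]
    rw [this, neg_div, div_self hpi]
    simp
  obtain ⟨t, ht⟩ := mem_range_of_exists_le_of_exists_ge hgcont (c := -1 / 2)
    ⟨2 * Real.pi, by rw [hg1]; norm_num⟩ ⟨0, by rw [hg0]; norm_num⟩
  obtain ⟨n, hn⟩ := hgint t
  rw [ht] at hn
  have h2 : (2 * n : ℤ) = -1 := by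
    have : (2 * n : ℝ) = -1 := by linarith
    exact_mod_cast this
  omega

theorem frontier_connectedComponentIn_subset {s : Set ℂ} (hs : IsOpen s) (x : ℂ) :
    frontier (connectedComponentIn s x) ⊆ sᶜ := by
  intro y hy hys
  rw [(hs.connectedComponentIn).frontier_eq] at hy
  obtain ⟨w, hw1, hw2⟩ := mem_closure_iff.1 hy.1 _ (hs.connectedComponentIn (x := y))
    (mem_connectedComponentIn hys)
  refine hy.2 ?_
  rw [connectedComponentIn_eq hw2, ← connectedComponentIn_eq hw1]
  exact mem_connectedComponentIn hys

theorem isSimplyConnected_univ_of_normedSpace {E : Type*} [NormedAddCommGroup E]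
    [NormedSpace ℝ E] : IsSimplyConnected (Set.univ : Set E) := by
  have := (convex_univ (𝕜 := ℝ) (E := E)).contractibleSpace Set.univ_nonempty
  exact SimplyConnectedSpace.ofContractible _

/-- A curve that omits `0` has a continuous logarithm on the circle minus a point. -/
theorem exists_continuousOn_log_circle {γ : C(Metric.sphere (0 : ℂ) 1, ℂ)} (hγ : ∀ s, γ s ≠ 0)
    (s₀ : Metric.sphere (0 : ℂ) 1) :
    ∃ θ : Metric.sphere (0 : ℂ) 1 → ℂ, ContinuousOn θ {s₀}ᶜ ∧ ∀ s, Complex.exp (θ s) = γ s := by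
  have hs1 : ∀ s : Metric.sphere (0 : ℂ) 1, ‖(s : ℂ)‖ = 1 := fun s => by simp
  have hs0 : ∀ s : Metric.sphere (0 : ℂ) 1, (s : ℂ) ≠ 0 := fun s h => by
    have := hs1 s; rw [h] at this; simp at this
  let p : C(ℝ, Metric.sphere (0 : ℂ) 1) :=
    ⟨fun t => ⟨s₀ * Complex.exp (t * I), by
      simp [Complex.norm_exp_ofReal_mul_I]⟩, by fun_prop⟩
  obtain ⟨l, hl, hle⟩ := exists_continuousOn_eqOn_exp_comp (X := ℝ) (U := Set.univ)
    isSimplyConnected_univ_of_normedSpace isOpen_univ (g := fun t => γ (p t)) (by fun_prop) (by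
      rintro ⟨t, -, ht⟩; exact hγ _ ht)
  rw [continuousOn_univ] at hl
  refine ⟨fun s => l (Complex.arg (-s / s₀) + Real.pi), ?_, fun s => ?_⟩
  · refine hl.comp_continuousOn (ContinuousOn.add ?_ continuousOn_const)
    intro s hs
    have : ContinuousAt (fun s : Metric.sphere (0 : ℂ) 1 => Complex.arg (-s / s₀)) s := by
      refine ContinuousAt.comp (g := Complex.arg) (Complex.continuousAt_arg ?_) (by fun_prop)
      rw [Complex.mem_slitPlane_iff_not_le_zero]
      intro hle
      have h1 := Complex.eq_coe_norm_of_nonneg (neg_nonneg.2 hle)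
      rw [norm_neg, norm_div, norm_neg, hs1, hs1, div_one, Complex.ofReal_one, neg_div, neg_neg,
        div_eq_one_iff_eq (hs0 s₀)] at h1
      exact hs (Subtype.ext h1)
    exact this.continuousWithinAt
  · have := hle (Set.mem_univ (Complex.arg (-s / s₀) + Real.pi))
    simp only [Function.comp_apply] at this
    rw [this]
    congr 1
    ext
    have h1 := Complex.norm_mul_exp_arg_mul_I (-(s : ℂ) / s₀)
    rw [norm_div, norm_neg, hs1, hs1, div_one, Complex.ofReal_one, one_mul] at h1
    simp only [p, ContinuousMap.coe_mk]
    push_cast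
    rw [add_mul, Complex.exp_add, h1, Complex.exp_pi_mul_I]
    field_simp [hs0 s₀]

theorem IsJordanDomain.exists_exterior {G : Set ℂ} (hG : IsJordanDomain G) (h0 : 0 ∈ G) {R : ℝ}
    (hR : 0 < R) (hGR : G ⊆ Metric.ball 0 R) :
    ∃ V : Set ℂ, IsOpen V ∧ IsPreconnected V ∧ V ⊆ (closure G)ᶜ ∧ {z | R < ‖z‖} ⊆ V ∧
      frontier G ⊆ closure V := by
  obtain ⟨ho, hb, -, γ, hinj, hrange⟩ := hG
  have hext : {z : ℂ | R < ‖z‖} ⊆ (closure G)ᶜ := fun z hz hzG => by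
    have := closure_minimal (hGR.trans Metric.ball_subset_closedBall) Metric.isClosed_closedBall hzG
    rw [mem_closedBall_zero_iff] at this
    exact absurd hz (not_lt.2 this)
  have hmem : ((2 * R : ℝ) : ℂ) ∈ {z : ℂ | R < ‖z‖} := by
    rw [Set.mem_ofPred_eq, Complex.norm_real, Real.norm_of_nonneg (by positivity)]
    linarith
  have hcl : IsOpen (closure G)ᶜ := isClosed_closure.isOpen_compl
  set V := connectedComponentIn (closure G)ᶜ ((2 * R : ℝ) : ℂ) with hV
  have hVo : IsOpen V := hcl.connectedComponentIn
  have hVsub : V ⊆ (closure G)ᶜ := connectedComponentIn_subset _ _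
  have hRV : {z : ℂ | R < ‖z‖} ⊆ V :=
    (isPreconnected_setOf_lt_norm hR).subset_connectedComponentIn hmem hext
  refine ⟨V, hVo, isPreconnected_connectedComponentIn, hVsub, hRV, fun ζ hζ => ?_⟩
  by_contra hζV
  obtain ⟨s₀, hs₀⟩ : ζ ∈ Set.range γ := hrange ▸ hζ
  have hVG : frontier V ⊆ Set.range γ := fun z hz => by
    rw [hrange, ho.frontier_eq]
    refine ⟨not_not.1 (frontier_connectedComponentIn_subset hcl _ hz), fun hzG => ?_⟩
    obtain ⟨w, hw1, hw2⟩ := mem_closure_iff.1 (frontier_subset_closure hz) _ ho hzG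
    exact hVsub hw2 (subset_closure hw1)
  have hγ0 : ∀ s, γ s ≠ 0 := fun s hs => by
    have : γ s ∈ frontier G := hrange ▸ Set.mem_range_self s
    rw [hs, ho.frontier_eq] at this
    exact this.2 h0
  obtain ⟨θ, hθ, hθe⟩ := exists_continuousOn_log_circle hγ0 s₀
  set K : Set (Metric.sphere (0 : ℂ) 1) := γ ⁻¹' frontier V with hK
  have hKc : IsClosed K := isClosed_frontier.preimage γ.continuous
  have hKs : K ⊆ {s₀}ᶜ := fun s hs hss => by
    rw [Set.mem_singleton_iff.1 hss] at hs
    exact hζV (hs₀ ▸ frontier_subset_closure hs)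
  have hemb : IsClosedEmbedding (γ.comp ⟨((↑) : K → _), continuous_subtype_val⟩) :=
    (γ.continuous.isClosedEmbedding hinj).comp hKc.isClosedEmbedding_subtypeVal
  obtain ⟨θ', hθ'⟩ := ContinuousMap.exists_extension hemb
    (⟨K.domRestrict θ, (hθ.mono hKs).domRestrict⟩ : C(K, ℂ))
  have hfr : ∀ z ∈ frontier V, z = Complex.exp (θ' z) := fun z hz => by
    obtain ⟨s, rfl⟩ := hVG hz
    have := DFunLike.congr_fun hθ' ⟨s, hz⟩
    simp only [ContinuousMap.comp_apply, ContinuousMap.coe_mk] at this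
    rw [this, Set.domRestrict_apply, hθe]
  classical
  set f : ℂ → ℂ := V.piecewise id fun z => Complex.exp (θ' z) with hf
  have hfc : Continuous f := Continuous.piecewise hfr continuous_id (by fun_prop)
  have hf0 : ∀ z, f z ≠ 0 := fun z => by
    by_cases hz : z ∈ V
    · rw [hf, Set.piecewise_eq_of_mem _ _ _ hz]
      rintro h
      rw [id_eq] at h
      exact hVsub (h ▸ hz) (subset_closure h0)
    · rw [hf, Set.piecewise_eq_of_notMem _ _ _ hz]
      exact Complex.exp_ne_zero _
  obtain ⟨L, hL, hLe⟩ := exists_continuousOn_eqOn_exp_comp (X := ℂ) (U := Set.univ)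
    isSimplyConnected_univ_of_normedSpace isOpen_univ (g := f) hfc.continuousOn (by
      rintro ⟨t, -, ht⟩; exact hf0 _ ht)
  rw [continuousOn_univ] at hL
  refine not_exp_eq_self_of_continuous hL (R := 2 * R) (by positivity) fun z hz => ?_
  have hzV : z ∈ V := hRV (by rw [Set.mem_ofPred_eq, hz]; linarith)
  have := hLe (Set.mem_univ z)
  rwa [hf, Set.piecewise_eq_of_mem _ _ _ hzV] at this

end JordanExterior

section BoundaryValues

open ComplexConjugate Topology

variable {G : Set ℂ}

theorem isCompact_setOf_norm_le_of_bijOn_ball (ho : IsOpen G) (hc : IsPreconnected G) {R₀ t : ℝ}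
    (ht : t < R₀) {φ : ℂ → ℂ} (hφ : DifferentiableOn ℂ φ G)
    (hbij : Set.BijOn φ G (Metric.ball 0 R₀)) : IsCompact {z ∈ G | ‖φ z‖ ≤ t} := by
  rcases lt_or_ge t 0 with h | hR
  · convert isCompact_empty
    ext z
    simpa using fun _ => h.trans_le (norm_nonneg _)
  have hR₀ : 0 < R₀ := hR.trans_lt ht
  have hopen : ∀ s ⊆ G, IsOpen s → IsOpen (φ '' s) := by
    refine ((hφ.analyticOnNhd ho).is_constant_or_isOpen hc).resolve_left ?_
    rintro ⟨w, hw⟩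
    obtain ⟨a, ha, ha'⟩ := hbij.surjOn (Metric.mem_ball_self hR₀)
    have : ((R₀ / 2 : ℝ) : ℂ) ∈ Metric.ball (0 : ℂ) R₀ := by
      rw [mem_ball_zero_iff, Complex.norm_real, Real.norm_of_nonneg (by positivity)]
      linarith
    obtain ⟨b, hb, hb'⟩ := hbij.surjOn this
    rw [hw a ha] at ha'
    rw [hw b hb, ha'] at hb'
    have : (0 : ℝ) = R₀ / 2 := by exact_mod_cast hb'
    linarith
  set ψ := Function.invFunOn φ G with hψ
  have hinv : Set.InvOn ψ φ G (Metric.ball 0 R₀) := hbij.invOn_invFunOn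
  have hmaps : Set.MapsTo ψ (Metric.ball 0 R₀) G := hbij.surjOn.mapsTo_invFunOn
  have hψc : ContinuousOn ψ (Metric.ball 0 R₀) := by
    rw [continuousOn_iff']
    intro s hs
    refine ⟨φ '' (s ∩ G), hopen _ Set.inter_subset_right (hs.inter ho), ?_⟩
    ext w
    constructor
    · rintro ⟨h1, h2⟩
      exact ⟨⟨ψ w, ⟨h1, hmaps h2⟩, hinv.2 h2⟩, h2⟩
    · rintro ⟨⟨z, ⟨hz, hzG⟩, rfl⟩, h2⟩
      refine ⟨?_, h2⟩
      rw [Set.mem_preimage, hinv.1 hzG]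
      exact hz
  have hsub : Metric.closedBall (0 : ℂ) t ⊆ Metric.ball 0 R₀ := Metric.closedBall_subset_ball ht
  have : {z ∈ G | ‖φ z‖ ≤ t} = ψ '' Metric.closedBall 0 t := by
    ext z
    constructor
    · rintro ⟨h1, h2⟩
      exact ⟨φ z, by simpa using h2, hinv.1 h1⟩
    · rintro ⟨w, hw, rfl⟩
      refine ⟨hmaps (hsub hw), ?_⟩
      rw [hinv.2 (hsub hw)]
      simpa using hw
  rw [this]
  exact (isCompact_closedBall 0 t).image_of_continuousOn (hψc.mono hsub)

theorem continuous_indicator_sub_norm_of_bijOn_ball (ho : IsOpen G) (hc : IsPreconnected G) {R₀ : ℝ}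
    {φ : ℂ → ℂ} (hφ : DifferentiableOn ℂ φ G) (hbij : Set.BijOn φ G (Metric.ball 0 R₀)) :
    Continuous (G.indicator fun z => R₀ - ‖φ z‖) := by
  refine continuous_iff_continuousAt.2 fun z => ?_
  by_cases hz : z ∈ G
  · have h1 : ContinuousAt (fun z => R₀ - ‖φ z‖) z :=
      continuousAt_const.sub (hφ.continuousOn.continuousAt (ho.mem_nhds hz)).norm
    refine h1.congr ?_
    filter_upwards [ho.mem_nhds hz] with w hw
    rw [Set.indicator_of_mem hw]
  · rw [Metric.continuousAt_iff']
    intro ε hε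
    have hK := isCompact_setOf_norm_le_of_bijOn_ball ho hc (sub_lt_self R₀ hε) hφ hbij
    filter_upwards [hK.isClosed.isOpen_compl.mem_nhds fun h => hz h.1] with w hw
    rw [Set.indicator_of_notMem hz, dist_zero_right]
    by_cases hwG : w ∈ G
    · have h1 : ‖φ w‖ < R₀ := by simpa using hbij.mapsTo hwG
      rw [Set.indicator_of_mem hwG, Real.norm_of_nonneg (by linarith)]
      by_contra! h
      exact hw ⟨hwG, by linarith⟩
    · rw [Set.indicator_of_notMem hwG, norm_zero]
      exact hε

/-- A holomorphic function on a bounded domain that is real on the boundary is constant. -/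
theorem eqOn_const_of_im_eq_zero_on_frontier (ho : IsOpen G) (hc : IsPreconnected G)
    (hb : Bornology.IsBounded G) {f : ℂ → ℂ} (hf : DiffContOnCl ℂ f G)
    (him : ∀ z ∈ frontier G, (f z).im = 0) : ∃ c, ∀ z ∈ closure G, f z = c := by
  have key : ∀ a : ℂ, (∀ z ∈ frontier G, (a * f z).re = 0) → ∀ z ∈ G, (a * f z).re ≤ 0 := by
    intro a ha z hz
    have h1 : DiffContOnCl ℂ (fun z => Complex.exp (a * f z)) G :=
      ⟨(hf.1.const_mul a).cexp, (continuousOn_const.mul hf.2).cexp⟩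
    have := Complex.norm_le_of_forall_mem_frontier_norm_le hb h1 (C := 1) (fun w hw => by
      rw [Complex.norm_exp, ha w hw, Real.exp_zero]) (subset_closure hz)
    rwa [Complex.norm_exp, Real.exp_le_one_iff] at this
  have hre : ∀ z ∈ G, (f z).im = 0 := fun z hz => by
    have h1 := key Complex.I (fun w hw => by simp [him w hw]) z hz
    have h2 := key (-Complex.I) (fun w hw => by simp [him w hw]) z hz
    simp only [neg_mul, Complex.neg_re, Complex.I_mul_re] at h1 h2
    linarith
  have hconst : ∃ c, ∀ z ∈ G, f z = c := by
    refine ((hf.1.analyticOnNhd ho).is_constant_or_isOpen hc).elim id fun h => ?_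
    rcases G.eq_empty_or_nonempty with rfl | ⟨a, ha⟩
    · exact ⟨0, by simp⟩
    obtain ⟨ε, hε, hball⟩ := Metric.isOpen_iff.1 (h G subset_rfl ho) (f a) ⟨a, ha, rfl⟩
    obtain ⟨b, hb, hb'⟩ := hball (a := f a + (ε / 2 : ℝ) * Complex.I) (by
      rw [mem_ball_iff_norm, add_sub_cancel_left, norm_mul, Complex.norm_I, mul_one,
        Complex.norm_real, Real.norm_of_nonneg (by positivity)]
      linarith)
    have := hre b hb
    rw [hb', Complex.add_im, hre a ha] at this
    simp at this
    exact absurd this hε.ne'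
  obtain ⟨c, hc⟩ := hconst
  exact ⟨c, Set.EqOn.of_subset_closure (g := fun _ => c) hc hf.2 continuousOn_const
    subset_closure subset_rfl⟩

end BoundaryValues

section ConstantQuotient

open ComplexConjugate Topology Polynomial

variable {G U : Set ℂ} {Φ F : ℂ → ℂ}

/-- The conjugate of the primitive of the Bergman kernel agrees on the boundary with the sum of
`κ⁻¹ / z` and a function holomorphic inside. -/
theorem IsJordanDomain.exists_boundary_identity (hG : IsJordanDomain G) (h0 : 0 ∈ G)
    (hU : IsOpen U) (hGU : closure G ⊆ U) (hΦ : ∀ z ∈ U, HasDerivAt Φ (F z) z)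
    (hF : ∀ p : ℂ[X], ∫ z in G, p.eval z * conj (F z) = p.eval 0) :
    ∃ (A : ℂ → ℂ) (κ : ℂ), DiffContOnCl ℂ A G ∧
      ∀ z ∈ frontier G, (A z - κ * conj (Φ z)) * z = -1 := by
  obtain ⟨h, κ, R, hc, hinf, hext, hint⟩ := exists_cauchyTransform_conj hG.1 hG.2.1 hU hGU hΦ hF
  obtain ⟨R', hR', hGR'⟩ := hG.2.1.subset_ball_lt (max R 0) 0
  obtain ⟨V, hVo, hVc, hVG, hRV, hfr⟩ := hG.exists_exterior h0 ((le_max_right _ _).trans_lt hR') hGR'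
  have hΦc : ContinuousOn Φ U := fun z hz => (hΦ z hz).continuousAt.continuousWithinAt
  refine ⟨fun z => h z + κ * conj (Φ z), κ, ⟨hint, hc.continuousOn.add (continuousOn_const.mul
    (Complex.continuous_conj.comp_continuousOn (hΦc.mono hGU)))⟩, fun z hz => ?_⟩
  rw [add_sub_cancel_right]
  have hV : ∀ w ∈ V, h w * w = -1 := by
    have han : AnalyticOnNhd ℂ (fun w => h w * w) V :=
      ((hext.mono hVG).mul differentiableOn_id).analyticOnNhd hVo
    have hR'0 : 0 ≤ R' := (le_max_right _ _).trans hR'.le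
    have hmem : ((R' + 1 : ℝ) : ℂ) ∈ {w : ℂ | R' < ‖w‖} := by
      rw [Set.mem_ofPred_eq, Complex.norm_real, Real.norm_of_nonneg (by positivity)]
      linarith
    refine han.eqOn_of_preconnected_of_eventuallyEq (g := fun _ => -1) analyticOnNhd_const hVc
      (hRV hmem) ?_
    filter_upwards [(isOpen_lt continuous_const continuous_norm).mem_nhds hmem] with w hw
    have hw' : R' < ‖w‖ := hw
    rw [hinf w ((le_max_left _ _).trans_lt (hR'.trans hw')), neg_mul, inv_mul_cancel₀]
    exact norm_pos_iff.1 (hR'0.trans_lt hw')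
  exact Set.EqOn.of_subset_closure (f := fun w => h w * w) (g := fun _ => -1) hV
    (hc.mul continuous_id).continuousOn continuousOn_const subset_closure subset_rfl (hfr hz)

theorem dslope_zero_of_ne {f : ℂ → ℂ} (hf : f 0 = 0) {z : ℂ} (hz : z ≠ 0) :
    dslope f 0 z = f z / z := by
  rw [dslope_of_ne _ hz, slope_def_field, hf, sub_zero, sub_zero]

/-- If the Bergman kernel of a Jordan domain extends across the boundary, then its primitive has
constant modulus on the boundary and a single simple zero. -/
theorem IsJordanDomain.norm_primitive_eq (hG : IsJordanDomain G) (h0 : 0 ∈ G)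
    (hU : IsOpen U) (hGU : closure G ⊆ U) (hΦ : ∀ z ∈ U, HasDerivAt Φ (F z) z) (hΦ0 : Φ 0 = 0)
    (hF0 : F 0 ≠ 0) (hF : ∀ p : ℂ[X], ∫ z in G, p.eval z * conj (F z) = p.eval 0) :
    ∃ r > 0, (∀ z ∈ frontier G, ‖Φ z‖ = r) ∧ ∀ z ∈ G, dslope Φ 0 z ≠ 0 := by
  obtain ⟨A, κ, hA, hAκ⟩ := hG.exists_boundary_identity h0 hU hGU hΦ hF
  obtain ⟨ho, hb, hsc, -⟩ := hG
  have hc : IsPreconnected G := isPreconnected_iff_preconnectedSpace.2 inferInstance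
  have h0U : (0 : ℂ) ∈ U := hGU (subset_closure h0)
  have hΦd : DifferentiableOn ℂ Φ U := fun z hz => (hΦ z hz).differentiableAt.differentiableWithinAt
  have hsd : DifferentiableOn ℂ (dslope Φ 0) U :=
    (Complex.differentiableOn_dslope (hU.mem_nhds h0U)).2 hΦd
  have hcl : ∀ {f : ℂ → ℂ}, DifferentiableOn ℂ f U → DiffContOnCl ℂ f G := fun hf =>
    (hf.mono hGU).diffContOnCl
  have hs0 : dslope Φ 0 0 = F 0 := by rw [dslope_same, (hΦ 0 h0U).deriv]
  have hne : ∀ z ∈ frontier G, z ≠ 0 := fun z hz h => by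
    rw [h, ho.frontier_eq] at hz
    exact hz.2 h0
  set W : ℂ → ℂ := fun z => A z * Φ z + dslope Φ 0 z with hW
  have hWd : DiffContOnCl ℂ W G :=
    ⟨(hA.1.mul (hcl hΦd).1).add (hcl hsd).1, (hA.2.mul (hcl hΦd).2).add (hcl hsd).2⟩
  have hW0 : W 0 = F 0 := by simp only [hW]; rw [hΦ0, hs0, mul_zero, zero_add]
  have hWfr : ∀ z ∈ frontier G, W z = κ * (‖Φ z‖ ^ 2 : ℝ) := fun z hz => by
    have h1 := hAκ z hz
    have h2 := hne z hz
    have h3 : A z = κ * conj (Φ z) - z⁻¹ := by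
      field_simp
      linear_combination h1
    simp only [hW]
    rw [dslope_zero_of_ne hΦ0 h2, h3, Complex.ofReal_pow, ← Complex.mul_conj']
    field_simp
    ring
  have hκ : κ ≠ 0 := by
    rintro rfl
    have := Complex.eqOn_closure_of_eqOn_frontier (g := fun _ => (0 : ℂ)) hb hWd
      diffContOnCl_const (fun z hz => by rw [hWfr z hz, zero_mul]) (subset_closure h0)
    exact hF0 (hW0 ▸ this)
  obtain ⟨c, hcW⟩ := eqOn_const_of_im_eq_zero_on_frontier ho hc hb (hWd.const_smul κ⁻¹)
    (fun z hz => by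
      rw [Pi.smul_apply, smul_eq_mul, hWfr z hz, inv_mul_cancel_left₀ hκ, Complex.ofReal_im])
  have hcW' : ∀ z ∈ closure G, W z = κ * c := fun z hz => by
    rw [← hcW z hz, Pi.smul_apply, smul_eq_mul, mul_inv_cancel_left₀ hκ]
  have hc0 : c ≠ 0 := fun h => hF0 (by rw [← hW0, hcW' 0 (subset_closure h0), h, mul_zero])
  refine ⟨Real.sqrt ‖c‖, Real.sqrt_pos.2 (norm_pos_iff.2 hc0), fun z hz => ?_, fun z hz hz0 => ?_⟩
  · have h1 := hWfr z hz
    rw [hcW' z (frontier_subset_closure hz)] at h1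
    rw [mul_left_cancel₀ hκ h1, Complex.norm_real, Real.norm_of_nonneg (by positivity),
      Real.sqrt_sq (norm_nonneg _)]
  · have hzne : z ≠ 0 := by
      rintro rfl
      exact hF0 (hs0.symm.trans hz0)
    have hΦz : Φ z = 0 := by
      have := dslope_zero_of_ne hΦ0 hzne
      rwa [hz0, eq_comm, div_eq_zero_iff, or_iff_left hzne] at this
    have := hcW' z (subset_closure hz)
    simp only [hW] at this
    rw [hΦz, hz0, mul_zero, zero_add, eq_comm] at this
    exact mul_ne_zero hκ hc0 this

/-- A conformal map onto a disc is proportional to any holomorphic function with a single simple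
zero at the same point and constant modulus on the boundary. -/
theorem exists_eq_const_mul_of_bijOn_ball (ho : IsOpen G) (hc : IsPreconnected G)
    (hb : Bornology.IsBounded G) (h0 : 0 ∈ G) {R₀ r : ℝ} (hr : 0 < r) {φ : ℂ → ℂ}
    (hφ : DifferentiableOn ℂ φ G) (hbij : Set.BijOn φ G (Metric.ball 0 R₀)) (hφ0 : φ 0 = 0)
    (hφ1 : deriv φ 0 ≠ 0) (hΦ : DiffContOnCl ℂ Φ G) (hΦ0 : Φ 0 = 0)
    (hΦr : ∀ z ∈ frontier G, ‖Φ z‖ = r) (hΦne : ∀ z ∈ G, dslope Φ 0 z ≠ 0) :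
    ∃ c : ℂ, ∀ z ∈ G, φ z = c * Φ z := by
  have hne : ∀ z ∈ G, dslope φ 0 z ≠ 0 := fun z hz h => by
    rcases eq_or_ne z 0 with rfl | hz0
    · rw [dslope_same] at h; exact hφ1 h
    · rw [dslope_zero_of_ne hφ0 hz0, div_eq_zero_iff, or_iff_left hz0] at h
      exact hz0 (hbij.injOn hz h0 (h.trans hφ0.symm))
  set q : ℂ → ℂ := fun z => dslope φ 0 z / dslope Φ 0 z with hq
  have hφs := (Complex.differentiableOn_dslope (ho.mem_nhds h0)).2 hφ
  have hΦs := (Complex.differentiableOn_dslope (ho.mem_nhds h0)).2 hΦ.1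
  have hqd : DifferentiableOn ℂ q G := hφs.div hΦs hΦne
  have hqne : ∀ z ∈ G, q z ≠ 0 := fun z hz => div_ne_zero (hne z hz) (hΦne z hz)
  have hqi : DifferentiableOn ℂ (fun z => (q z)⁻¹) G := hqd.inv hqne
  have hqz : ∀ z ∈ G, z ≠ 0 → ‖q z‖ = ‖φ z‖ / ‖Φ z‖ := fun z _ hz0 => by
    simp only [hq]
    rw [dslope_zero_of_ne hφ0 hz0, dslope_zero_of_ne hΦ0 hz0, div_div_div_cancel_right₀ hz0,
      norm_div]
  set μ : ℂ → ℝ := fun z => R₀ - G.indicator (fun z => R₀ - ‖φ z‖) z with hμ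
  have hμc : Continuous μ :=
    continuous_const.sub (continuous_indicator_sub_norm_of_bijOn_ball ho hc hφ hbij)
  have hμG : ∀ z ∈ G, μ z = ‖φ z‖ := fun z hz => by
    simp only [hμ]; rw [Set.indicator_of_mem hz, sub_sub_cancel]
  have hμn : ∀ z ∉ G, μ z = R₀ := fun z hz => by
    simp only [hμ]; rw [Set.indicator_of_notMem hz, sub_zero]
  classical
  set m : ℂ → ℝ := G.piecewise (fun z => ‖q z‖) fun _ => R₀ / r with hm
  have hmG : ∀ z ∈ G, m z = ‖q z‖ := fun z hz => Set.piecewise_eq_of_mem _ _ _ hz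
  have hmn : ∀ z ∉ G, m z = R₀ / r := fun z hz => Set.piecewise_eq_of_notMem _ _ _ hz
  have hmc : ContinuousOn m (closure G) := by
    intro z hz
    by_cases hzG : z ∈ G
    · have h1 : ContinuousAt (fun z => ‖q z‖) z :=
        (hqd.continuousOn.continuousAt (ho.mem_nhds hzG)).norm
      refine (h1.congr ?_).continuousWithinAt
      filter_upwards [ho.mem_nhds hzG] with w hw using (hmG w hw).symm
    · have hzf : z ∈ frontier G := by rw [ho.frontier_eq]; exact ⟨hz, hzG⟩
      have hz0 : z ≠ 0 := fun h => hzG (h ▸ h0)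
      have h1 : ContinuousWithinAt (fun w => μ w / ‖Φ w‖) (closure G) z :=
        hμc.continuousWithinAt.div (hΦ.2 z hz).norm (by rw [hΦr z hzf]; exact hr.ne')
      have hw : ∀ w ∈ closure G, w ≠ 0 → m w = μ w / ‖Φ w‖ := fun w hw hw0 => by
        by_cases hwG : w ∈ G
        · rw [hmG w hwG, hμG w hwG, hqz w hwG hw0]
        · rw [hmn w hwG, hμn w hwG, hΦr w (by rw [ho.frontier_eq]; exact ⟨hw, hwG⟩)]
      refine h1.congr_of_eventuallyEq ?_ (hw z hz hz0)
      filter_upwards [self_mem_nhdsWithin,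
        mem_nhdsWithin_of_mem_nhds (isOpen_ne.mem_nhds hz0)] with w h2 h3 using hw w h2 h3
  have hfin : ∀ p ∈ G, IsMaxOn (fun z => ‖q z‖) G p → ∃ c : ℂ, ∀ z ∈ G, q z = c := fun p hp hmax =>
    ⟨q p, Complex.eqOn_of_isPreconnected_of_isMaxOn_norm hc ho hqd hp hmax⟩
  have hqc : ∃ c : ℂ, ∀ z ∈ G, q z = c := by
    have hne' : (closure G).Nonempty := ⟨0, subset_closure h0⟩
    obtain ⟨p, hp, hpmax⟩ := hb.isCompact_closure.exists_isMaxOn hne' hmc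
    obtain ⟨p', hp', hpmin⟩ := hb.isCompact_closure.exists_isMinOn hne' hmc
    by_cases hpG : p ∈ G
    · refine hfin p hpG fun z hz => ?_
      have := hpmax (subset_closure hz)
      rw [Set.mem_ofPred_eq, hmG z hz, hmG p hpG] at this
      exact this
    by_cases hpG' : p' ∈ G
    · have h1 : IsMaxOn (fun z => ‖(q z)⁻¹‖) G p' := fun z hz => by
        have := hpmin (subset_closure hz)
        rw [Set.mem_ofPred_eq, hmG z hz, hmG p' hpG'] at this
        simp only [Set.mem_ofPred_eq, norm_inv]
        exact inv_anti₀ (norm_pos_iff.2 (hqne p' hpG')) this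
      refine ⟨q p', fun z hz => inv_injective ?_⟩
      exact Complex.eqOn_of_isPreconnected_of_isMaxOn_norm hc ho hqi hpG' h1 hz
    · have h1 : ∀ z ∈ G, ‖q z‖ = R₀ / r := fun z hz => by
        have h2 := hpmax (subset_closure hz)
        have h3 := hpmin (subset_closure hz)
        rw [Set.mem_ofPred_eq, hmG z hz] at h2 h3
        rw [hmn p hpG] at h2
        rw [hmn p' hpG'] at h3
        exact le_antisymm h2 h3
      exact hfin 0 h0 fun z hz => ((h1 z hz).trans (h1 0 h0).symm).le
  obtain ⟨c, hqc⟩ := hqc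
  refine ⟨c, fun z hz => ?_⟩
  rcases eq_or_ne z 0 with rfl | hz0
  · rw [hφ0, hΦ0, mul_zero]
  · have h1 := hqc z hz
    simp only [hq] at h1
    rw [div_eq_iff (hΦne z hz), dslope_zero_of_ne hφ0 hz0, dslope_zero_of_ne hΦ0 hz0,
      ← mul_div_assoc, div_left_inj' hz0] at h1
    exact h1

end ConstantQuotient

/-- **Lemma 5 of the paper.** If `G` is a Jordan domain symmetric in the real
axis, `0 ∈ G`, `ξ ∈ ∂G` is real with `G ⊆ {Re z < ξ}`, and the normalized
conformal map `φ` is not analytically continuable across `∂G`, then the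
Bieberbach polynomials satisfy `limsup_n |B_n(x)| = ∞` for every real `x > ξ`. -/
theorem bieberbach_poly_divergence_outside_symmetric_domain
    (G : Set ℂ) (hG : IsJordanDomain G)
    (hsym : ∀ z : ℂ, z ∈ G ↔ (starRingEnd ℂ) z ∈ G)
    (h0 : (0 : ℂ) ∈ G) (ξ : ℝ) (hξ : (ξ : ℂ) ∈ frontier G)
    (hhalf : G ⊆ {z : ℂ | z.re < ξ})
    (R₀ : ℝ) (hR₀ : 0 < R₀) (φ : ℂ → ℂ)
    (hφdiff : DifferentiableOn ℂ φ G)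
    (hφbij : Set.BijOn φ G (Metric.ball (0 : ℂ) R₀))
    (hφ0 : φ 0 = 0) (hφ1 : deriv φ 0 = 1)
    (hnoext : ¬ ∃ (U : Set ℂ) (g : ℂ → ℂ), IsOpen U ∧ closure G ⊆ U ∧
        DifferentiableOn ℂ g U ∧ Set.EqOn g φ G)
    (B : ℕ → Polynomial ℂ) (hB : ∀ n, 1 ≤ n → IsBieberbachPoly G 0 n (B n)) :
    ∀ x : ℝ, ξ < x → ∀ M : ℝ,
      ∃ᶠ n : ℕ in atTop, M < ‖(B n).eval (x : ℂ)‖ := by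
  intro x hx M
  by_contra hfreq
  have hM : ∀ᶠ n in atTop, ‖(B n).eval (x : ℂ)‖ ≤ M := by
    simpa only [not_lt] using not_frequently.1 hfreq
  have hsc : SimplyConnectedSpace G := hG.2.2.1
  have hc : IsPreconnected G := isPreconnected_iff_preconnectedSpace.2 inferInstance
  obtain ⟨U, Φ, F, hU, hGU, hΦ, hΦ0, hF0, hF⟩ := exists_bergman_kernel_of_bieberbach hG.1 hG.2.1 hc
    h0 hsym (frontier_subset_closure hξ) hhalf hx hB hM
  obtain ⟨r, hr, hΦr, hΦne⟩ := hG.norm_primitive_eq h0 hU hGU hΦ hΦ0 hF0 hF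
  have hΦd : DifferentiableOn ℂ Φ U := fun z hz => (hΦ z hz).differentiableAt.differentiableWithinAt
  obtain ⟨c, hc⟩ := exists_eq_const_mul_of_bijOn_ball hG.1 hc hG.2.1 h0 hr hφdiff hφbij hφ0
    (by rw [hφ1]; exact one_ne_zero) (hΦd.mono hGU).diffContOnCl hΦ0 hΦr hΦne
  exact hnoext ⟨U, fun z => c * Φ z, hU, hGU, hΦd.const_mul c, fun z hz => (hc z hz).symm⟩
end

section
/- There exists a Jordan domain G contained in the open unit disk {z : |z| < 1}, symmetric with respect to the real axis (invariant under complex conjugation), with 0 ∈ G, such that the Bieberbach polynomials B_n of G with respect to z₀ = 0 satisfy limsup_{n→∞} sup_{z ∈ cl(G)} |B_n(z)| = ∞; in particular the Bieberbach polynomials of G do not converge uniformly on the closure of G. -/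
open MeasureTheory Filter

open Topology
open scoped Pointwise

/-- The direction of a complex number, as a point of the unit circle. -/
noncomputable def direction (z : ℂ) : Circle := Circle.exp z.arg

/-- The domain star-shaped about `0` with radial function `ρ`. -/
def starDomain (ρ : C(Circle, ℝ)) : Set ℂ := {z | ‖z‖ < ρ (direction z)}

lemma norm_mul_direction (z : ℂ) : (‖z‖ : ℂ) * direction z = z := by
  simp [direction, Circle.coe_exp, Complex.norm_mul_exp_arg_mul_I]

lemma direction_real_mul {r : ℝ} (hr : 0 < r) (z : ℂ) : direction (r * z) = direction z := by
  rw [direction, Complex.arg_real_mul _ hr, direction]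

lemma direction_coe (v : Circle) : direction v = v := by
  rw [direction, Circle.exp_arg]

lemma direction_conj (z : ℂ) : direction ((starRingEnd ℂ) z) = (direction z)⁻¹ := by
  rcases eq_or_ne z 0 with rfl | hz
  · simp [direction]
  · have h : (starRingEnd ℂ) z = (‖z‖ : ℝ) * (((direction z)⁻¹ : Circle) : ℂ) := by
      conv_lhs => rw [← norm_mul_direction z]
      rw [Circle.coe_inv_eq_conj, map_mul, Complex.conj_ofReal]
    rw [h, direction_real_mul (norm_pos_iff.2 hz), direction_coe]

lemma coe_direction (z : ℂ) (hz : z ≠ 0) : (direction z : ℂ) = z / ‖z‖ := by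
  have : (‖z‖ : ℂ) ≠ 0 := by simpa using hz
  rw [eq_div_iff this, mul_comm, norm_mul_direction]

lemma continuousAt_direction {z : ℂ} (hz : z ≠ 0) : ContinuousAt direction z := by
  have hind : IsInducing (X := Circle) (fun v => (v : ℂ)) := ⟨rfl⟩
  rw [hind.continuousAt_iff]
  have h : ContinuousAt (fun w : ℂ => w / (‖w‖ : ℂ)) z :=
    continuousAt_id.div (by fun_prop) (by simpa using hz)
  refine h.congr ?_
  filter_upwards [isOpen_ne.mem_nhds hz] with w hw using (coe_direction w hw).symm

lemma exists_norm_le_of_circle (ρ : C(Circle, ℝ)) : ∃ C : ℝ, 0 < C ∧ ∀ v, |ρ v| ≤ C :=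
  ⟨‖ρ‖ + 1, by positivity, fun v => (ρ.norm_coe_le_norm v).trans (by linarith)⟩

lemma continuous_radial (ρ : C(Circle, ℝ)) :
    Continuous fun z : ℂ => (ρ (direction z) : ℂ) * z := by
  rw [continuous_iff_continuousAt]
  intro z
  rcases eq_or_ne z 0 with rfl | hz
  · obtain ⟨C, hC, h⟩ := exists_norm_le_of_circle ρ
    rw [ContinuousAt, mul_zero, tendsto_zero_iff_norm_tendsto_zero]
    refine squeeze_zero (g := fun z : ℂ => C * ‖z‖) (fun _ => norm_nonneg _) (fun w => ?_) ?_
    · rw [norm_mul, Complex.norm_real]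
      exact mul_le_mul_of_nonneg_right (h _) (norm_nonneg _)
    · have : Continuous fun z : ℂ => C * ‖z‖ := by fun_prop
      simpa using this.tendsto 0
  · exact (Complex.continuous_ofReal.continuousAt.comp
      (ρ.continuous.continuousAt.comp (continuousAt_direction hz))).mul continuousAt_id

/-- The homeomorphism of the plane stretching the unit disc onto a star-shaped domain. -/
noncomputable def radialHomeomorph (ρ : C(Circle, ℝ)) (hρ : ∀ v, 0 < ρ v) : ℂ ≃ₜ ℂ where
  toFun z := (ρ (direction z) : ℂ) * z
  invFun z := (((ρ (direction z))⁻¹ : ℝ) : ℂ) * z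
  left_inv z := by
    have := hρ (direction z)
    beta_reduce
    rw [direction_real_mul this, ← mul_assoc, ← Complex.ofReal_mul, inv_mul_cancel₀ this.ne']
    simp
  right_inv z := by
    have := hρ (direction z)
    beta_reduce
    rw [direction_real_mul (inv_pos.2 this), ← mul_assoc, ← Complex.ofReal_mul,
      mul_inv_cancel₀ this.ne']
    simp
  continuous_toFun := continuous_radial ρ
  continuous_invFun :=
    continuous_radial ⟨fun v => (ρ v)⁻¹, ρ.continuous.inv₀ fun v => (hρ v).ne'⟩

lemma radialHomeomorph_symm_apply (ρ : C(Circle, ℝ)) (hρ : ∀ v, 0 < ρ v) (z : ℂ) :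
    (radialHomeomorph ρ hρ).symm z = (((ρ (direction z))⁻¹ : ℝ) : ℂ) * z := rfl

lemma image_radialHomeomorph_ball (ρ : C(Circle, ℝ)) (hρ : ∀ v, 0 < ρ v) :
    radialHomeomorph ρ hρ '' Metric.ball 0 1 = starDomain ρ := by
  rw [← (radialHomeomorph ρ hρ).preimage_symm]
  ext z
  have h := hρ (direction z)
  rw [Set.mem_preimage, mem_ball_zero_iff, radialHomeomorph_symm_apply, norm_mul, Complex.norm_real,
      Real.norm_of_nonneg (inv_pos.2 h).le,
    inv_mul_lt_iff₀ h, mul_one]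
  rfl

lemma isOpen_starDomain {ρ : C(Circle, ℝ)} (hρ : ∀ v, 0 < ρ v) : IsOpen (starDomain ρ) := by
  rw [← image_radialHomeomorph_ball ρ hρ]
  exact (radialHomeomorph ρ hρ).isOpenMap _ Metric.isOpen_ball

lemma isPreconnected_starDomain {ρ : C(Circle, ℝ)} (hρ : ∀ v, 0 < ρ v) :
    IsPreconnected (starDomain ρ) := by
  rw [← image_radialHomeomorph_ball ρ hρ]
  exact (convex_ball _ _).isPreconnected.image _ (radialHomeomorph ρ hρ).continuous.continuousOn

lemma starDomain_subset_ball {ρ : C(Circle, ℝ)} {R : ℝ} (hρ : ∀ v, ρ v ≤ R) :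
    starDomain ρ ⊆ Metric.ball 0 R := fun z hz => by
  simpa using lt_of_lt_of_le (show ‖z‖ < ρ (direction z) from hz) (hρ _)

lemma ball_subset_starDomain {ρ : C(Circle, ℝ)} {R : ℝ} (hρ : ∀ v, R ≤ ρ v) :
    Metric.ball 0 R ⊆ starDomain ρ := fun z hz => by
  rw [mem_ball_zero_iff] at hz
  exact lt_of_lt_of_le hz (hρ _)

lemma isJordanDomain_starDomain {ρ : C(Circle, ℝ)} (hρ : ∀ v, 0 < ρ v) :
    IsJordanDomain (starDomain ρ) := by
  set φ := radialHomeomorph ρ hρ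
  obtain ⟨C, hC, h⟩ := exists_norm_le_of_circle ρ
  refine ⟨isOpen_starDomain hρ,
    Metric.isBounded_ball.subset (starDomain_subset_ball fun v => (le_abs_self _).trans (h v)),
    ?_, ⟨fun z => φ z, by fun_prop⟩, fun x y hxy => Subtype.ext (φ.injective hxy), ?_⟩
  · have : ContractibleSpace (Metric.ball (0 : ℂ) 1) :=
      (convex_ball _ _).contractibleSpace ⟨0, by simp⟩
    have : ContractibleSpace (starDomain ρ) := by
      rw [← image_radialHomeomorph_ball ρ hρ]
      exact (φ.image _).symm.contractibleSpace
    infer_instance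
  · rw [← image_radialHomeomorph_ball ρ hρ, ← φ.image_frontier, frontier_ball _ one_ne_zero]
    ext z
    simp [φ]

lemma conj_mem_starDomain {ρ : C(Circle, ℝ)} (hρ : ∀ v, ρ v⁻¹ = ρ v) (z : ℂ) :
    z ∈ starDomain ρ ↔ (starRingEnd ℂ) z ∈ starDomain ρ := by
  change ‖z‖ < ρ (direction z) ↔ ‖(starRingEnd ℂ) z‖ < ρ (direction ((starRingEnd ℂ) z))
  rw [direction_conj, hρ, Complex.norm_conj]

/-- The boundary of a star-shaped domain is a null set. -/
lemma volume_norm_eq_radial (ρ : C(Circle, ℝ)) (hρ : ∀ v, 0 < ρ v) :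
    volume {z : ℂ | ‖z‖ = ρ (direction z)} = 0 := by
  have hfr : {z : ℂ | ‖z‖ = ρ (direction z)} =
      radialHomeomorph ρ hρ '' Metric.sphere 0 1 := by
    rw [← (radialHomeomorph ρ hρ).preimage_symm]
    ext z
    have h := hρ (direction z)
    rw [Set.mem_preimage, mem_sphere_zero_iff_norm, radialHomeomorph_symm_apply, norm_mul, Complex.norm_real,
      Real.norm_of_nonneg (inv_pos.2 h).le,
      inv_mul_eq_one₀ h.ne', eq_comm]
    rfl
  have hcl : IsClosed {z : ℂ | ‖z‖ = ρ (direction z)} := by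
    rw [hfr]
    exact (radialHomeomorph ρ hρ).isClosedMap _ Metric.isClosed_sphere
  set E := {z : ℂ | ‖z‖ = ρ (direction z)} with hE
  by_contra hne
  have hmem : ∀ t : Set.Ioi (0 : ℝ), ∀ z ∈ (t : ℝ) • E, z ≠ 0 ∧ ‖z‖ = t * ρ (direction z) := by
    rintro ⟨t, ht⟩ _ ⟨w, hw, rfl⟩
    have ht' : 0 < t := ht
    have hw' : ‖w‖ = ρ (direction w) := hw
    have hw0 : w ≠ 0 := norm_pos_iff.1 (hw' ▸ hρ _)
    simp only [Complex.real_smul]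
    rw [direction_real_mul ht', norm_mul, Complex.norm_real, Real.norm_of_nonneg ht'.le, hw']
    exact ⟨mul_ne_zero (by exact_mod_cast ht'.ne') hw0, rfl⟩
  have hcount := Measure.countable_meas_pos_of_disjoint_iUnion (μ := (volume : Measure ℂ))
    (As := fun t : Set.Ioi (0 : ℝ) => (t : ℝ) • E)
    (fun t => (hcl.smul₀ (t : ℝ)).measurableSet)
    (fun s t hst => Set.disjoint_left.2 fun z hzs hzt => hst <| Subtype.ext <|
      mul_right_cancel₀ (hρ (direction z)).ne' ((hmem s z hzs).2.symm.trans (hmem t z hzt).2))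
  have huniv : {t : Set.Ioi (0 : ℝ) | 0 < volume ((t : ℝ) • E)} = Set.univ := by
    refine Set.eq_univ_of_forall fun t => ?_
    have ht : (0 : ℝ) < t := t.2
    change 0 < volume ((t : ℝ) • E)
    rw [Measure.addHaar_smul]
    refine ENNReal.mul_pos ?_ hne
    simpa using ht.ne'
  rw [huniv, Set.countable_univ_iff, Set.countable_coe_iff] at hcount
  have h01 : (Set.Ioo (0 : ℝ) 1).Countable := hcount.mono Set.Ioo_subset_Ioi_self
  exact absurd (Cardinal.Real.Ioo_countable_iff.1 h01) (by norm_num)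

lemma integrableOn_of_subset_ball {E : Type*} [NormedAddCommGroup E] {G : Set ℂ}
    (hG : G ⊆ Metric.ball 0 1) {f : ℂ → E} (hf : Continuous f) : IntegrableOn f G :=
  (hf.continuousOn.integrableOn_compact (isCompact_closedBall (0 : ℂ) 1)).mono_set
    (hG.trans Metric.ball_subset_closedBall)

lemma eq_zero_of_forall_quadratic_nonneg {a b : ℝ} (hb : 0 ≤ b)
    (h : ∀ t : ℝ, 0 ≤ 2 * t * a + t ^ 2 * b) : a = 0 := by
  have h1 := h (-a / (b + 1))
  have hb1 : 0 < b + 1 := by linarith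
  have h2 : 2 * (-a / (b + 1)) * a + (-a / (b + 1)) ^ 2 * b =
      -(a ^ 2 * (b + 2)) / (b + 1) ^ 2 := by
    field_simp
    ring
  rw [h2, neg_div, Left.nonneg_neg_iff, div_le_iff₀ (by positivity), zero_mul] at h1
  have h3 : a ^ 2 ≤ 0 := by nlinarith [sq_nonneg a]
  exact pow_eq_zero_iff two_ne_zero |>.1 (le_antisymm h3 (sq_nonneg a))

/-- Derivatives of Bieberbach polynomials are orthogonal to polynomials vanishing at `0`. -/
lemma IsBieberbachPoly.integral_inner_eq_zero {G : Set ℂ} (hG : G ⊆ Metric.ball 0 1) {n : ℕ}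
    {B Q : Polynomial ℂ} (hB : IsBieberbachPoly G 0 n B) (hdeg : Q.natDegree ≤ n)
    (h0 : Q.eval 0 = 0) (h1 : Q.derivative.eval 0 = 0) :
    ∫ z in G, inner ℝ (B.derivative.eval z) (Q.derivative.eval z) = 0 := by
  refine eq_zero_of_forall_quadratic_nonneg
    (b := ∫ z in G, ‖Q.derivative.eval z‖ ^ 2) (integral_nonneg fun _ => by positivity) fun t => ?_
  have hmin := hB.2.2.2 (B + Polynomial.C (t : ℂ) * Q)
    ((Polynomial.natDegree_add_le _ _).trans
      (max_le hB.1 ((Polynomial.natDegree_C_mul_le _ _).trans hdeg)))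
    (by simp [hB.2.1, h0]) (by simp [hB.2.2.1, h1])
  have hexp : ∫ z in G, ‖(B + Polynomial.C (t : ℂ) * Q).derivative.eval z‖ ^ 2 =
      (∫ z in G, ‖B.derivative.eval z‖ ^ 2) +
        (2 * t * (∫ z in G, inner ℝ (B.derivative.eval z) (Q.derivative.eval z)) +
          t ^ 2 * ∫ z in G, ‖Q.derivative.eval z‖ ^ 2) := by
    rw [← integral_const_mul, ← integral_const_mul, ← integral_add, ← integral_add]
    · refine integral_congr_ae (Eventually.of_forall fun z => ?_)
      have : (B + Polynomial.C (t : ℂ) * Q).derivative.eval z =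
          B.derivative.eval z + t • Q.derivative.eval z := by simp
      simp only [this]
      rw [norm_add_sq_real, inner_smul_right, norm_smul, Real.norm_eq_abs, mul_pow, sq_abs]
      ring
    all_goals exact integrableOn_of_subset_ball hG (by fun_prop)
  linarith

lemma IsBieberbachPoly.integral_norm_sub_sq {G : Set ℂ} (hG : G ⊆ Metric.ball 0 1) {k n : ℕ}
    (hkn : k ≤ n) {B C : Polynomial ℂ} (hB : IsBieberbachPoly G 0 n B)
    (hC : IsBieberbachPoly G 0 k C) :
    ∫ z in G, ‖C.derivative.eval z - B.derivative.eval z‖ ^ 2 =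
      (∫ z in G, ‖C.derivative.eval z‖ ^ 2) - ∫ z in G, ‖B.derivative.eval z‖ ^ 2 := by
  have horth := hB.integral_inner_eq_zero hG (Q := C - B)
    ((Polynomial.natDegree_sub_le _ _).trans (max_le (hC.1.trans hkn) hB.1))
    (by simp [hB.2.1, hC.2.1]) (by simp [hB.2.2.1, hC.2.2.1])
  have hexp : ∫ z in G, ‖C.derivative.eval z‖ ^ 2 =
      (∫ z in G, ‖B.derivative.eval z‖ ^ 2) +
        (2 * (∫ z in G, inner ℝ (B.derivative.eval z) ((C - B).derivative.eval z)) +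
          ∫ z in G, ‖C.derivative.eval z - B.derivative.eval z‖ ^ 2) := by
    rw [← integral_const_mul, ← integral_add, ← integral_add]
    · refine integral_congr_ae (Eventually.of_forall fun z => ?_)
      have := norm_add_sq_real (B.derivative.eval z) (C.derivative.eval z - B.derivative.eval z)
      rw [add_sub_cancel] at this
      simp only [Polynomial.derivative_sub, Polynomial.eval_sub]
      linarith
    all_goals exact integrableOn_of_subset_ball hG (by fun_prop)
  rw [horth] at hexp
  linarith

lemma IsBieberbachPoly.unique {G : Set ℂ} (hG : G ⊆ Metric.ball 0 1) (hGo : IsOpen G)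
    (h0 : (0 : ℂ) ∈ G) {n : ℕ} {B C : Polynomial ℂ} (hB : IsBieberbachPoly G 0 n B)
    (hC : IsBieberbachPoly G 0 n C) : C = B := by
  have hsub := hB.integral_norm_sub_sq hG le_rfl hC
  have hle := hC.2.2.2 B hB.1 hB.2.1 hB.2.2.1
  have hcont : Continuous fun z => ‖C.derivative.eval z - B.derivative.eval z‖ ^ 2 := by fun_prop
  have hint : ∫ z in G, ‖C.derivative.eval z - B.derivative.eval z‖ ^ 2 = 0 :=
    le_antisymm (by linarith) (integral_nonneg fun _ => by positivity)
  rw [setIntegral_eq_zero_iff_of_nonneg_ae (Eventually.of_forall fun _ => by positivity)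
    (integrableOn_of_subset_ball hG hcont)] at hint
  have heq : Set.EqOn (fun z => ‖C.derivative.eval z - B.derivative.eval z‖ ^ 2) 0 G :=
    Measure.eqOn_open_of_ae_eq hint hGo hcont.continuousOn continuousOn_const
  have hinf : G.Infinite := infinite_of_mem_nhds 0 (hGo.mem_nhds h0)
  have hder : C.derivative = B.derivative :=
    Polynomial.eq_of_infinite_eval_eq _ _ <| hinf.mono fun z hz => by
      simpa [sub_eq_zero] using heq hz
  have hconst : (C - B).natDegree = 0 := Polynomial.derivative_eq_zero.1 (by simp [hder])
  rw [← sub_eq_zero, Polynomial.eq_C_of_natDegree_eq_zero hconst,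
    Polynomial.coeff_zero_eq_eval_zero, Polynomial.eval_sub, hB.2.1, hC.2.1, sub_zero, map_zero]

lemma exists_antiderivative (P : Polynomial ℂ) :
    ∃ Q : Polynomial ℂ, Q.derivative = P ∧ Q.eval 0 = 0 ∧ Q.natDegree ≤ P.natDegree + 1 := by
  refine ⟨∑ i ∈ Finset.range (P.natDegree + 1),
    Polynomial.monomial (i + 1) (P.coeff i / ((i : ℂ) + 1)), ?_, ?_, ?_⟩
  · conv_rhs => rw [P.as_sum_range]
    rw [Polynomial.derivative_sum]
    refine Finset.sum_congr rfl fun i _ => ?_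
    have : (i : ℂ) + 1 ≠ 0 := Nat.cast_add_one_ne_zero i
    rw [Polynomial.derivative_monomial]
    simp [div_mul_cancel₀ _ this]
  · simp [Polynomial.eval_finsetSum]
  · refine Polynomial.natDegree_sum_le_of_forall_le _ _ fun i hi => ?_
    exact (Polynomial.natDegree_monomial_le _).trans (by have := Finset.mem_range.1 hi; omega)

lemma abs_integral_mul_re_pow_le {G : Set ℂ} (hG : G ⊆ Metric.ball 0 1) (hGm : MeasurableSet G)
    {k n : ℕ} (hn : n ≠ 0) {B C : Polynomial ℂ} (hB : IsBieberbachPoly G 0 (k + n) B)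
    (hC : IsBieberbachPoly G 0 k C) {t : ℝ} (ht : 0 < t) :
    |∫ z in G, ‖C.derivative.eval z‖ ^ 2 * (z ^ n).re| ≤
      t * (∫ z in G, ‖C.derivative.eval z‖ ^ 2) +
        t⁻¹ * ((∫ z in G, ‖C.derivative.eval z‖ ^ 2) - ∫ z in G, ‖B.derivative.eval z‖ ^ 2) := by
  have hk : k ≠ 0 := by
    rintro rfl
    have h := hC.2.2.1
    rw [Polynomial.derivative_of_natDegree_zero (Nat.le_zero.1 hC.1)] at h
    simp at h
  obtain ⟨Q, hQ, hQ0, hQdeg⟩ := exists_antiderivative (C.derivative * Polynomial.X ^ n)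
  have hdeg : Q.natDegree ≤ k + n := by
    have h1 := Polynomial.natDegree_mul_le (p := C.derivative) (q := Polynomial.X ^ n)
    have h2 := Polynomial.natDegree_derivative_le C
    have h3 := hC.1
    rw [Polynomial.natDegree_X_pow] at h1
    omega
  have horth := hB.integral_inner_eq_zero hG hdeg hQ0 (by rw [hQ]; simp [hn])
  rw [← hB.integral_norm_sub_sq hG (Nat.le_add_right k n) hC]
  have hkey : ∫ z in G, ‖C.derivative.eval z‖ ^ 2 * (z ^ n).re =
      ∫ z in G, inner ℝ (C.derivative.eval z - B.derivative.eval z) (Q.derivative.eval z) := by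
    simp_rw [inner_sub_left]
    rw [integral_sub, horth, sub_zero]
    · refine integral_congr_ae (Eventually.of_forall fun z => ?_)
      simp only [hQ, Polynomial.eval_mul, Polynomial.eval_pow, Polynomial.eval_X, Complex.inner]
      rw [mul_right_comm, Complex.mul_conj, Complex.re_ofReal_mul, Complex.normSq_eq_norm_sq]
    all_goals exact integrableOn_of_subset_ball hG (by fun_prop)
  rw [hkey, ← integral_const_mul, ← integral_const_mul, ← integral_add]
  · refine (abs_integral_le_integral_abs).trans (setIntegral_mono_on ?_ ?_ hGm fun z hz => ?_)
    · exact integrableOn_of_subset_ball hG (by fun_prop)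
    · exact integrableOn_of_subset_ball hG (by fun_prop)
    · have h1 := abs_real_inner_le_norm (C.derivative.eval z - B.derivative.eval z)
        (Q.derivative.eval z)
      have hz1 : ‖z‖ ≤ 1 := (mem_ball_zero_iff.1 (hG hz)).le
      have h2 : ‖Q.derivative.eval z‖ ≤ ‖C.derivative.eval z‖ := by
        rw [hQ]
        simp only [Polynomial.eval_mul, Polynomial.eval_pow, Polynomial.eval_X, norm_mul, norm_pow]
        exact mul_le_of_le_one_right (norm_nonneg _) (pow_le_one₀ (norm_nonneg _) hz1)
      refine h1.trans ((mul_le_mul_of_nonneg_left h2 (norm_nonneg _)).trans ?_)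
      set x := ‖C.derivative.eval z - B.derivative.eval z‖
      set y := ‖C.derivative.eval z‖
      have h3 : t * y ^ 2 + t⁻¹ * x ^ 2 - x * y = t⁻¹ * ((t * y - x / 2) ^ 2 + 3 / 4 * x ^ 2) := by
        field_simp
        ring
      have h4 : 0 ≤ t⁻¹ * ((t * y - x / 2) ^ 2 + 3 / 4 * x ^ 2) := by positivity
      linarith
  all_goals exact integrableOn_of_subset_ball hG (by fun_prop)

lemma tendsto_integral_mul_re_pow {G : Set ℂ} (hG : G ⊆ Metric.ball 0 1) (hGm : MeasurableSet G)
    {K : ℕ} {B : ℕ → Polynomial ℂ} (hB : ∀ k, IsBieberbachPoly G 0 (k + K) (B k))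
    {n : ℕ} (hn : n ≠ 0) :
    Tendsto (fun k => ∫ z in G, ‖(B k).derivative.eval z‖ ^ 2 * (z ^ n).re) atTop (𝓝 0) := by
  set m : ℕ → ℝ := fun k => ∫ z in G, ‖(B k).derivative.eval z‖ ^ 2 with hm
  have hm0 : ∀ k, 0 ≤ m k := fun k => integral_nonneg fun _ => by positivity
  have hanti : Antitone m := antitone_nat_of_succ_le fun k =>
    (hB (k + 1)).2.2.2 (B k) ((hB k).1.trans (by omega)) (hB k).2.1 (hB k).2.2.1
  have hlim := tendsto_atTop_ciInf hanti ⟨0, Set.forall_mem_range.2 hm0⟩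
  have hdiff : Tendsto (fun k => m k - m (k + n)) atTop (𝓝 0) := by
    simpa using hlim.sub (hlim.comp (tendsto_add_atTop_nat n))
  rw [Metric.tendsto_atTop] at hdiff ⊢
  intro e he
  set t := e / (2 * (m 0 + 1)) with ht
  have hm1 : 0 < m 0 + 1 := by linarith [hm0 0]
  have htpos : 0 < t := by positivity
  obtain ⟨N, hN⟩ := hdiff (t * (e / 2)) (by positivity)
  refine ⟨N, fun k hk => ?_⟩
  have h1 := hN k hk
  rw [Real.dist_eq, sub_zero] at h1 ⊢
  have hBn : IsBieberbachPoly G 0 (k + K + n) (B (k + n)) := by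
    have := hB (k + n)
    rwa [show k + n + K = k + K + n by omega] at this
  have h2 := abs_integral_mul_re_pow_le hG hGm hn hBn (hB k) htpos
  have h3 : t⁻¹ * (m k - m (k + n)) < e / 2 := by
    rw [inv_mul_lt_iff₀ htpos]
    exact (le_abs_self _).trans_lt h1
  have h4 : t * m k ≤ e / 2 := by
    calc t * m k ≤ t * (m 0 + 1) :=
          mul_le_mul_of_nonneg_left (by linarith [hanti (Nat.zero_le k)]) htpos.le
      _ = e / 2 := by rw [ht]; field_simp
  calc _ ≤ t * m k + t⁻¹ * (m k - m (k + n)) := h2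
    _ < e := by linarith

lemma tendsto_setIntegral_of_ae_eventually_mem_iff {S : ℕ → Set ℂ} {T : Set ℂ}
    (hS : ∀ j, S j ⊆ Metric.ball 0 1) (hSm : ∀ j, MeasurableSet (S j)) (hTm : MeasurableSet T)
    (hST : ∀ᵐ z : ℂ, ∀ᶠ j in atTop, z ∈ S j ↔ z ∈ T) {f : ℕ → ℂ → ℝ} {g : ℂ → ℝ}
    (hf : ∀ j, Continuous (f j)) {C : ℝ} (hC : ∀ j, ∀ z ∈ Metric.ball (0 : ℂ) 1, |f j z| ≤ C)
    (hfg : ∀ z, Tendsto (fun j => f j z) atTop (𝓝 (g z))) :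
    Tendsto (fun j => ∫ z in S j, f j z) atTop (𝓝 (∫ z in T, g z)) := by
  simp_rw [← integral_indicator (hSm _), ← integral_indicator hTm]
  refine tendsto_integral_of_dominated_convergence
    ((Metric.ball (0 : ℂ) 1).indicator fun _ => C) (fun j => ?_) ?_ (fun j => ?_) ?_
  · exact ((hf j).stronglyMeasurable.indicator (hSm j)).aestronglyMeasurable
  · exact (integrable_indicator_iff Metric.isOpen_ball.measurableSet).2
      (integrableOn_of_subset_ball subset_rfl continuous_const)
  · refine Eventually.of_forall fun z => ?_
    by_cases hz : z ∈ S j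
    · rw [Set.indicator_of_mem hz, Set.indicator_of_mem (hS j hz)]
      exact hC j z (hS j hz)
    · rw [Set.indicator_of_notMem hz, norm_zero]
      refine Set.indicator_nonneg (fun w hw => ?_) z
      exact (abs_nonneg _).trans (hC j w hw)
  · filter_upwards [hST] with z hz
    by_cases hzT : z ∈ T
    · rw [Set.indicator_of_mem hzT]
      refine (hfg z).congr' ?_
      filter_upwards [hz] with j hj
      rw [Set.indicator_of_mem (hj.2 hzT)]
    · rw [Set.indicator_of_notMem hzT]
      refine tendsto_const_nhds.congr' ?_
      filter_upwards [hz] with j hj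
      rw [Set.indicator_of_notMem (mt hj.1 hzT)]

/-- A sequence of polynomials of bounded degree that is bounded on a small disc has a
subsequence that converges, together with its derivatives. -/
lemma exists_subseq_tendsto_eval {n : ℕ} {M : ℝ} {B : ℕ → Polynomial ℂ}
    (hdeg : ∀ j, (B j).natDegree ≤ n)
    (hM : ∀ j, ∀ z ∈ Metric.ball (0 : ℂ) (1 / 4), ‖(B j).eval z‖ ≤ M) :
    ∃ (P : Polynomial ℂ) (φ : ℕ → ℕ) (D : ℝ), StrictMono φ ∧ P.natDegree ≤ n ∧
      (∀ z, Tendsto (fun j => (B (φ j)).eval z) atTop (𝓝 (P.eval z))) ∧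
      (∀ z, Tendsto (fun j => (B (φ j)).derivative.eval z) atTop (𝓝 (P.derivative.eval z))) ∧
      ∀ j, ∀ z ∈ Metric.ball (0 : ℂ) 1, ‖(B (φ j)).derivative.eval z‖ ≤ D := by
  set v : Fin (n + 1) → ℂ := fun i => ((i : ℕ) : ℂ) / (4 * (n + 1)) with hv
  have hn : (4 * ((n : ℂ) + 1)) ≠ 0 := mul_ne_zero (by norm_num) (Nat.cast_add_one_ne_zero n)
  have hvinj : Set.InjOn v (Finset.univ : Finset (Fin (n + 1))) := fun i _ j _ hij => by
    rw [hv] at hij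
    simp only [div_left_inj' hn, Nat.cast_inj] at hij
    exact Fin.ext hij
  have hvball : ∀ i, v i ∈ Metric.ball (0 : ℂ) (1 / 4) := fun i => by
    have h1 : ‖(n : ℂ) + 1‖ = n + 1 := by exact_mod_cast Complex.norm_natCast (n + 1)
    have h2 : ((i : ℕ) : ℝ) < n + 1 := by exact_mod_cast i.2
    rw [mem_ball_zero_iff, hv]
    simp only [norm_div, norm_mul, h1, Complex.norm_natCast, Complex.norm_ofNat]
    rw [div_lt_div_iff₀ (by positivity) (by norm_num)]
    linarith
  set L := Lagrange.basis Finset.univ v with hL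
  set I : (Fin (n + 1) → ℂ) → Polynomial ℂ := fun y => ∑ i, Polynomial.C (y i) * L i with hI
  have hIeq : ∀ y, I y = Lagrange.interpolate Finset.univ v y := fun y =>
    (Lagrange.interpolate_apply _ _ _).symm
  have hrec : ∀ j, B j = I fun i => (B j).eval (v i) := fun j => by
    rw [hIeq]
    refine Lagrange.eq_interpolate hvinj ?_
    rw [Finset.card_univ, Fintype.card_fin]
    exact (Polynomial.degree_le_natDegree).trans_lt
      (by exact_mod_cast Nat.lt_succ_of_le (hdeg j))
  obtain ⟨y, -, φ, hφ, hy⟩ := (isCompact_closedBall (0 : Fin (n + 1) → ℂ) |M|).tendsto_subseq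
    (x := fun j i => (B j).eval (v i)) fun j => by
      rw [mem_closedBall_zero_iff, pi_norm_le_iff_of_nonneg (abs_nonneg M)]
      exact fun i => (hM j _ (hvball i)).trans (le_abs_self M)
  have hyi := tendsto_pi_nhds.1 hy
  have heval : ∀ y z, (I y).eval z = ∑ i, y i * (L i).eval z := fun y z => by
    simp [hI, Polynomial.eval_finsetSum]
  have hderiv : ∀ y z, (I y).derivative.eval z = ∑ i, y i * (L i).derivative.eval z :=
    fun y z => by simp [hI, Polynomial.eval_finsetSum]
  obtain ⟨D, hD⟩ := (isCompact_closedBall (0 : ℂ) 1).exists_bound_of_continuousOn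
    (f := fun z => ∑ i, ‖(L i).derivative.eval z‖) (by fun_prop)
  refine ⟨I y, φ, |M| * D, hφ, ?_, fun z => ?_, fun z => ?_, fun j z hz => ?_⟩
  · rw [hIeq]
    refine Polynomial.natDegree_le_of_degree_le ?_
    simpa using Lagrange.degree_interpolate_le (s := Finset.univ) (r := y) hvinj
  · rw [heval]
    refine (tendsto_finsetSum _ fun i _ => (hyi i).mul_const _).congr fun j => ?_
    conv_rhs => rw [hrec (φ j), heval]
    rfl
  · rw [hderiv]
    refine (tendsto_finsetSum _ fun i _ => (hyi i).mul_const _).congr fun j => ?_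
    conv_rhs => rw [hrec (φ j), hderiv]
    rfl
  · rw [hrec, hderiv]
    have h1 := (le_abs_self _).trans (hD z (Metric.ball_subset_closedBall hz))
    refine (norm_sum_le _ _).trans (le_trans ?_ (mul_le_mul_of_nonneg_left h1 (abs_nonneg M)))
    rw [Finset.mul_sum]
    refine Finset.sum_le_sum fun i _ => ?_
    rw [norm_mul]
    exact mul_le_mul_of_nonneg_right ((hM _ _ (hvball i)).trans (le_abs_self M)) (norm_nonneg _)

lemma exists_subseq_tendsto_bieberbachPoly {n : ℕ} {M : ℝ} {S : ℕ → Set ℂ} {T : Set ℂ}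
    (hS : ∀ j, S j ⊆ Metric.ball 0 1) (hSm : ∀ j, MeasurableSet (S j)) (hTm : MeasurableSet T)
    (hST : ∀ᵐ z : ℂ, ∀ᶠ j in atTop, z ∈ S j ↔ z ∈ T) {B : ℕ → Polynomial ℂ}
    (hB : ∀ j, IsBieberbachPoly (S j) 0 n (B j))
    (hM : ∀ j, ∀ z ∈ Metric.ball (0 : ℂ) (1 / 4), ‖(B j).eval z‖ ≤ M) :
    ∃ (P : Polynomial ℂ) (φ : ℕ → ℕ), StrictMono φ ∧ IsBieberbachPoly T 0 n P ∧
      ∀ z, Tendsto (fun j => (B (φ j)).eval z) atTop (𝓝 (P.eval z)) := by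
  obtain ⟨P, φ, D, hφ, hdeg, hev, hder, hD⟩ := exists_subseq_tendsto_eval (fun j => (hB j).1) hM
  refine ⟨P, φ, hφ, ⟨hdeg, ?_, ?_, fun Q hQ hQ0 hQ1 => ?_⟩, hev⟩
  · exact tendsto_nhds_unique (hev 0) (by simp [(hB _).2.1])
  · exact tendsto_nhds_unique (hder 0) (by simp [(hB _).2.2.1])
  · have hST' : ∀ᵐ z : ℂ, ∀ᶠ j in atTop, z ∈ S (φ j) ↔ z ∈ T := by
      filter_upwards [hST] with z hz using hφ.tendsto_atTop.eventually hz
    obtain ⟨E, hE⟩ := (isCompact_closedBall (0 : ℂ) 1).exists_bound_of_continuousOn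
      (f := fun z => ‖Q.derivative.eval z‖ ^ 2) (by fun_prop)
    refine le_of_tendsto_of_tendsto'
      (tendsto_setIntegral_of_ae_eventually_mem_iff (fun j => hS (φ j)) (fun j => hSm (φ j)) hTm
        hST' (f := fun j z => ‖(B (φ j)).derivative.eval z‖ ^ 2) (C := D ^ 2)
        (fun j => by fun_prop) (fun j z hz => ?_) fun z => ((hder z).norm.pow 2))
      (tendsto_setIntegral_of_ae_eventually_mem_iff (fun j => hS (φ j)) (fun j => hSm (φ j)) hTm
        hST' (f := fun _ z => ‖Q.derivative.eval z‖ ^ 2)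
        (fun j => by fun_prop) (fun j z hz => hE z (Metric.ball_subset_closedBall hz))
        fun z => tendsto_const_nhds)
      fun j => (hB (φ j)).2.2.2 Q hQ hQ0 hQ1
    rw [abs_of_nonneg (by positivity)]
    exact pow_le_pow_left₀ (norm_nonneg _) (hD j z hz) 2

lemma exists_tendstoLocallyUniformlyOn_of_norm_le {U : Set ℂ} (hU : IsOpen U) {M : ℝ}
    {f : ℕ → ℂ → ℂ} (hf : ∀ n, DifferentiableOn ℂ (f n) U) (hM : ∀ n, ∀ z ∈ U, ‖f n z‖ ≤ M)
    (l : Ultrafilter ℕ) : ∃ F : ℂ → ℂ, TendstoLocallyUniformlyOn f F l U := by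
  have key : ∀ z ∈ U, ∃ w, Tendsto (fun n => f n z) l (𝓝 w) := by
    intro z hz
    obtain ⟨w, -, hw⟩ := (isCompact_closedBall (0 : ℂ) M).ultrafilter_le_nhds
      (l.map fun n => f n z) (by
        simp only [le_principal_iff, Ultrafilter.mem_coe, Ultrafilter.mem_map]
        exact Filter.Eventually.of_forall fun n => by simpa using hM n z hz)
    exact ⟨w, hw⟩
  choose! F hF using key
  refine ⟨F, Metric.tendstoLocallyUniformlyOn_iff.2 fun ε hε x hx => ?_⟩
  obtain ⟨r, hr, hrU⟩ := Metric.isOpen_iff.1 hU x hx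
  have hM0 : 0 ≤ M := (norm_nonneg _).trans (hM 0 x hx)
  have hLip : ∀ n, ∀ y ∈ Metric.ball x r, dist (f n y) (f n x) ≤ (2 * M + 1) / r * dist y x := by
    intro n y hy
    refine Complex.dist_le_div_mul_dist_of_mapsTo_ball ((hf n).mono hrU) ?_ hy
    intro w hw
    rw [Metric.mem_closedBall, dist_eq_norm]
    linarith [norm_sub_le (f n w) (f n x), hM n w (hrU hw), hM n x hx]
  have hLipF : ∀ y ∈ Metric.ball x r, dist (F y) (F x) ≤ (2 * M + 1) / r * dist y x := by
    intro y hy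
    exact le_of_tendsto ((hF y (hrU hy)).dist (hF x hx)) (Eventually.of_forall fun n => hLip n y hy)
  have hL : 0 < (2 * M + 1) / r := by positivity
  set δ := min r (ε / (3 * ((2 * M + 1) / r))) with hδ
  have hδ0 : 0 < δ := by positivity
  refine ⟨Metric.ball x δ, mem_nhdsWithin_of_mem_nhds (Metric.ball_mem_nhds x hδ0), ?_⟩
  filter_upwards [Metric.tendsto_nhds.1 (hF x hx) (ε / 3) (by positivity)] with n hn y hy
  have hyr : y ∈ Metric.ball x r := Metric.ball_subset_ball (min_le_left _ _) hy
  have h1 := hLip n y hyr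
  have h2 := hLipF y hyr
  have h3 : (2 * M + 1) / r * dist y x < ε / 3 := by
    have : dist y x < ε / (3 * ((2 * M + 1) / r)) := lt_of_lt_of_le hy (min_le_right _ _)
    rw [lt_div_iff₀ (by positivity)] at this
    linarith
  calc dist (F y) (f n y) ≤ dist (F y) (F x) + dist (F x) (f n x) + dist (f n x) (f n y) :=
        dist_triangle4 _ _ _ _
    _ < ε := by linarith [dist_comm (F x) (f n x), dist_comm (f n x) (f n y)]

lemma exists_pow_le_norm_of_analyticOnNhd {U : Set ℂ} (hU : IsOpen U) (hUc : IsPreconnected U)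
    {f : ℂ → ℂ} (hf : DifferentiableOn ℂ f U) {w : ℂ} (hw : w ∈ U) (hfw : f w ≠ 0) {p : ℂ}
    (hp : p ∈ U) :
    ∃ (m : ℕ) (c δ : ℝ), 0 < c ∧ 0 < δ ∧
      ∀ z ∈ Metric.ball p δ, z ∈ U ∧ c * ‖z - p‖ ^ m ≤ ‖f z‖ := by
  have hfa : AnalyticOnNhd ℂ f U := hf.analyticOnNhd hU
  have hne : ¬ ∀ᶠ z in 𝓝 p, f z = 0 := fun h =>
    hfw (hfa.eqOn_zero_of_preconnected_of_eventuallyEq_zero hUc hp h hw)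
  obtain ⟨m, g, hg, hgp, hfg⟩ := (hfa p hp).exists_eventuallyEq_pow_smul_nonzero_iff.2 hne
  have hgn : 0 < ‖g p‖ := norm_pos_iff.2 hgp
  have h1 : ∀ᶠ z in 𝓝 p, ‖g p‖ / 2 < ‖g z‖ :=
    hg.continuousAt.norm.eventually_const_lt (by linarith)
  obtain ⟨δ, hδ, h⟩ := Metric.eventually_nhds_iff_ball.1 (h1.and (hfg.and (hU.mem_nhds hp)))
  refine ⟨m, ‖g p‖ / 2, δ, by positivity, hδ, fun z hz => ⟨(h z hz).2.2, ?_⟩⟩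
  rw [(h z hz).2.1, norm_smul, norm_pow, mul_comm]
  gcongr
  exact (h z hz).1.le

lemma norm_circle_pow_sub_one_le (u : Circle) (n : ℕ) :
    ‖(u : ℂ) ^ n - 1‖ ≤ n * ‖(u : ℂ) - 1‖ := by
  induction n with
  | zero => simp
  | succ n ih =>
    calc ‖(u : ℂ) ^ (n + 1) - 1‖ = ‖(u : ℂ) * ((u : ℂ) ^ n - 1) + (u - 1)‖ := by ring_nf
      _ ≤ ‖(u : ℂ) * ((u : ℂ) ^ n - 1)‖ + ‖(u : ℂ) - 1‖ := norm_add_le _ _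
      _ ≤ n * ‖(u : ℂ) - 1‖ + ‖(u : ℂ) - 1‖ := by
        rw [norm_mul, Circle.norm_coe, one_mul]; gcongr
      _ = (n + 1 : ℕ) * ‖(u : ℂ) - 1‖ := by push_cast; ring

lemma half_norm_pow_le_re_pow {z : ℂ} {n : ℕ} (h : n * ‖(direction z : ℂ) - 1‖ ≤ 1 / 2) :
    ‖z‖ ^ n / 2 ≤ (z ^ n).re := by
  have h1 : (1 : ℝ) / 2 ≤ ((direction z : ℂ) ^ n).re := by
    have h2 := (Complex.abs_re_le_norm _).trans
      ((norm_circle_pow_sub_one_le (direction z) n).trans h)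
    rw [Complex.sub_re, Complex.one_re] at h2
    linarith [neg_le_of_abs_le h2]
  have h3 : (z ^ n).re = ‖z‖ ^ n * ((direction z : ℂ) ^ n).re := by
    conv_lhs => rw [← norm_mul_direction z, mul_pow, ← Complex.ofReal_pow, Complex.re_ofReal_mul]
  rw [h3]
  nlinarith [pow_nonneg (norm_nonneg z) n]

lemma norm_direction_sub_one_le {x r : ℝ} (hx : 0 < x) {z : ℂ} (hz : ‖z - x‖ ≤ r)
    (hr : 1 / 8 ≤ ‖z‖) : ‖(direction z : ℂ) - 1‖ ≤ 16 * r := by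
  have hz0 : 0 < ‖z‖ := by linarith
  have h1 : |x - ‖z‖| ≤ r := by
    have := abs_norm_sub_norm_le (x : ℂ) z
    rw [Complex.norm_real, Real.norm_of_nonneg hx.le, norm_sub_rev] at this
    exact this.trans hz
  have h2 : ‖z - (‖z‖ : ℂ)‖ ≤ 2 * r := by
    calc ‖z - (‖z‖ : ℂ)‖ = ‖(z - x) + ((x - ‖z‖ : ℝ) : ℂ)‖ := by push_cast; ring_nf
      _ ≤ ‖z - x‖ + |x - ‖z‖| := by
        simpa [← Complex.ofReal_sub] using norm_add_le (z - x) ((x - ‖z‖ : ℝ) : ℂ)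
      _ ≤ 2 * r := by linarith
  have h3 : (direction z : ℂ) - 1 = (z - ‖z‖) / ‖z‖ := by
    have : (‖z‖ : ℂ) ≠ 0 := by exact_mod_cast hz0.ne'
    rw [coe_direction z (norm_pos_iff.1 hz0)]
    field_simp
  rw [h3, norm_div, Complex.norm_real, norm_norm, div_le_iff₀ hz0]
  nlinarith [norm_nonneg (z - x)]

lemma IsBieberbachPoly.integral_le_pi {G : Set ℂ} (hG : G ⊆ Metric.ball 0 1) {n : ℕ}
    (hn : 1 ≤ n) {B : Polynomial ℂ} (hB : IsBieberbachPoly G 0 n B) :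
    ∫ z in G, ‖B.derivative.eval z‖ ^ 2 ≤ Real.pi := by
  refine (hB.2.2.2 Polynomial.X (by simpa using hn) (by simp) (by simp)).trans ?_
  simp only [Polynomial.derivative_X, Polynomial.eval_one, norm_one, one_pow, integral_const,
    smul_eq_mul, mul_one, measureReal_restrict_apply_univ]
  refine (measureReal_mono hG (by simp)).trans ?_
  simp [Measure.real, Complex.volume_ball]

lemma half_pow_mul_le_of_ball_subset {G : Set ℂ} (hG : G ⊆ Metric.ball 0 1)
    (hGm : MeasurableSet G) {s t d τ E : ℝ} {n : ℕ} {c : ℂ} {g : ℂ → ℝ} (hg : Continuous g)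
    (hg0 : ∀ z, 0 ≤ g z) (hs : 0 ≤ s) (ht : 0 ≤ t) (hτ : 0 ≤ τ) (hcG : Metric.ball c τ ⊆ G)
    (hcs : ∀ z ∈ Metric.ball c τ, s ≤ ‖z‖ ∧ t < ‖z‖ ∧ d ≤ g z)
    (hre : ∀ z ∈ G, t < ‖z‖ → ‖z‖ ^ n / 2 ≤ (z ^ n).re)
    (hE : ∫ z in G, g z ≤ E) :
    s ^ n / 2 * d * (Real.pi * τ ^ 2) ≤ (∫ z in G, g z * (z ^ n).re) + t ^ n * E := by
  have hi1 : IntegrableOn (fun z => g z * (z ^ n).re) G :=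
    integrableOn_of_subset_ball hG (by fun_prop)
  have hi2 : IntegrableOn (fun z => t ^ n * g z) G :=
    integrableOn_of_subset_ball hG (by fun_prop)
  calc s ^ n / 2 * d * (Real.pi * τ ^ 2)
      = ∫ z in G, (Metric.ball c τ).indicator (fun _ => s ^ n / 2 * d) z := by
        rw [setIntegral_indicator measurableSet_ball, Set.inter_eq_right.2 hcG]
        simp [Measure.real, Complex.volume_ball, ENNReal.toReal_ofReal hτ]
        ring
    _ ≤ ∫ z in G, (g z * (z ^ n).re + t ^ n * g z) := by
        refine setIntegral_mono_on ?_ (hi1.add hi2) hGm ?_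
        · exact ((integrableOn_of_subset_ball hG continuous_const).indicator measurableSet_ball)
        · intro z hz
          have hgt : 0 ≤ t ^ n * g z := mul_nonneg (pow_nonneg ht n) (hg0 z)
          by_cases hzc : z ∈ Metric.ball c τ
          · rw [Set.indicator_of_mem hzc]
            obtain ⟨h1, h2, h3⟩ := hcs z hzc
            have h4 : s ^ n / 2 ≤ (z ^ n).re :=
              le_trans (by gcongr) (hre z hz h2)
            have h5 : 0 ≤ s ^ n / 2 := by positivity
            nlinarith [mul_le_mul_of_nonneg_left h3 h5, mul_le_mul_of_nonneg_right h4 (hg0 z)]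
          · rw [Set.indicator_of_notMem hzc]
            by_cases hzt : t < ‖z‖
            · have := hre z hz hzt
              have h6 : 0 ≤ (z ^ n).re := le_trans (by positivity) this
              have := mul_nonneg (hg0 z) h6
              linarith
            · have h7 : -(t ^ n) ≤ (z ^ n).re := by
                have h8 := neg_le_of_abs_le (Complex.abs_re_le_norm (z ^ n))
                rw [norm_pow] at h8
                have h9 : ‖z‖ ^ n ≤ t ^ n := by gcongr; exact not_lt.1 hzt
                linarith
              nlinarith [hg0 z]
    _ = (∫ z in G, g z * (z ^ n).re) + t ^ n * ∫ z in G, g z := by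
        rw [integral_add hi1 hi2, integral_const_mul]
    _ ≤ _ := by gcongr

lemma mem_ball_near_tip {ρ : C(Circle, ℝ)} {a κ η : ℝ} (ha : 1 / 4 ≤ a)
    (hκ : ∀ v : Circle, ‖(v : ℂ) - 1‖ < κ → a - √‖(v : ℂ) - 1‖ ≤ ρ v) (hη : 0 < η)
    (hη4 : η ≤ 1 / 4) (hηκ : η < κ) {z : ℂ}
    (hz : z ∈ Metric.ball ((a - η / 4 : ℝ) : ℂ) (η ^ 2 / 1024)) :
    z ∈ starDomain ρ ∧ a - η / 2 < ‖z‖ ∧ η / 8 ≤ ‖z - a‖ ∧ ‖z - a‖ < η := by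
  have hz' : ‖z - ((a - η / 4 : ℝ) : ℂ)‖ < η ^ 2 / 1024 := by
    rwa [← dist_eq_norm]
  have hτ : η ^ 2 / 1024 ≤ η / 4096 := by nlinarith
  have h1 := abs_norm_sub_norm_le z ((a - η / 4 : ℝ) : ℂ)
  rw [Complex.norm_real, Real.norm_of_nonneg (by linarith)] at h1
  obtain ⟨h2, h3⟩ := abs_le.1 h1
  have h4 := norm_direction_sub_one_le (by linarith : 0 < a - η / 4) hz'.le (by linarith)
  have h5 : √‖(direction z : ℂ) - 1‖ ≤ η / 8 :=
    Real.sqrt_le_iff.2 ⟨by positivity, h4.trans (le_of_eq (by ring))⟩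
  have h6 := hκ (direction z) (by nlinarith)
  have h7 : ‖z - a‖ ≤ ‖z - ((a - η / 4 : ℝ) : ℂ)‖ + η / 4 := by
    calc ‖z - a‖ = ‖(z - ((a - η / 4 : ℝ) : ℂ)) + ((-(η / 4) : ℝ) : ℂ)‖ := by
          push_cast; ring_nf
      _ ≤ _ := norm_add_le _ _
      _ = _ := by rw [Complex.norm_real, norm_neg, Real.norm_of_nonneg (by positivity)]
  have h8 : η / 4 ≤ ‖z - a‖ + ‖z - ((a - η / 4 : ℝ) : ℂ)‖ := by
    calc η / 4 = ‖((η / 4 : ℝ) : ℂ)‖ := by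
          rw [Complex.norm_real, Real.norm_of_nonneg (by positivity)]
      _ = ‖(z - ((a - η / 4 : ℝ) : ℂ)) - (z - a)‖ := by push_cast; ring_nf
      _ ≤ _ := (norm_sub_le _ _).trans (add_comm _ _).le
  refine ⟨?_, by linarith, by linarith, by linarith⟩
  change ‖z‖ < ρ (direction z)
  linarith

lemma cusp_estimate {ρ : C(Circle, ℝ)} {a κ η₀ η : ℝ} {K n m : ℕ} {c δ : ℝ}
    (hρ : ∀ v, 1 / 4 ≤ ρ v) (hρa : ∀ v, ρ v ≤ a) (ha : a ≤ 3 / 4)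
    (hη₀ : ∀ v : Circle, a - η₀ < ρ v → √‖(v : ℂ) - 1‖ ≤ a - ρ v)
    (hκ : ∀ v : Circle, ‖(v : ℂ) - 1‖ < κ → a - √‖(v : ℂ) - 1‖ ≤ ρ v)
    {B : ℕ → Polynomial ℂ} (hB : ∀ k, IsBieberbachPoly (starDomain ρ) 0 (k + K) (B k))
    {l : Filter ℕ} [l.NeBot] (hl : l ≤ atTop) {U : Set ℂ} {f : ℂ → ℂ} (hU : IsOpen U)
    (hBf : TendstoLocallyUniformlyOn (fun k z => (B k).derivative.eval z) f l U) (hc : 0 < c)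
    (hf : ∀ z ∈ Metric.ball (a : ℂ) δ, z ∈ U ∧ c * ‖z - a‖ ^ m ≤ ‖f z‖)
    (hη : 0 < η) (hη4 : η ≤ 1 / 8) (hηη₀ : η ≤ η₀) (hηκ : η < κ) (hηδ : 2 * η ≤ δ) (hn : n ≠ 0)
    (hnη : n * η ^ 2 ≤ 1 / 2) :
    (c / 2 * (η / 8) ^ m) ^ 2 * (η ^ 2 / 1024) ^ 2 ≤ 2 * Real.exp (-(n * (η / 2))) := by
  have hρ0 : ∀ v, 0 < ρ v := fun v => by linarith [hρ v]
  have ha4 : 1 / 4 ≤ a := (hρ 1).trans (hρa 1)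
  have hG : starDomain ρ ⊆ Metric.ball 0 1 :=
    starDomain_subset_ball fun v => by linarith [hρa v]
  have hGm : MeasurableSet (starDomain ρ) := (isOpen_starDomain hρ0).measurableSet
  set b := Metric.ball ((a - η / 4 : ℝ) : ℂ) (η ^ 2 / 1024) with hb
  have htip : ∀ z ∈ b, z ∈ starDomain ρ ∧ a - η / 2 < ‖z‖ ∧ η / 8 ≤ ‖z - a‖ ∧ ‖z - a‖ < η :=
    fun z hz => mem_ball_near_tip ha4 hκ hη (by linarith) hηκ hz
  have hlow : ∀ z ∈ b, c * (η / 8) ^ m ≤ ‖f z‖ := fun z hz => by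
    obtain ⟨-, -, h3, h4⟩ := htip z hz
    refine le_trans (by gcongr) (hf z ?_).2
    rw [Metric.mem_ball, dist_eq_norm]
    linarith
  have hunif : ∀ᶠ k in l, ∀ z ∈ b, c / 2 * (η / 8) ^ m ≤ ‖(B k).derivative.eval z‖ := by
    have hcpt := (tendstoLocallyUniformlyOn_iff_forall_isCompact hU).1 hBf
      (Metric.closedBall (a : ℂ) η) (fun z hz => (hf z (Metric.closedBall_subset_ball
        (by linarith) hz)).1) (isCompact_closedBall _ _)
    filter_upwards [Metric.tendstoUniformlyOn_iff.1 hcpt (c / 2 * (η / 8) ^ m)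
      (by positivity)] with k hk z hz
    have h1 := hk z (by
      rw [Metric.mem_closedBall, dist_eq_norm]; exact (htip z hz).2.2.2.le)
    rw [dist_eq_norm] at h1
    have h2 := norm_sub_norm_le (f z) ((B k).derivative.eval z)
    linarith [hlow z hz]
  have hre : ∀ z ∈ starDomain ρ, a - η < ‖z‖ → ‖z‖ ^ n / 2 ≤ (z ^ n).re := by
    intro z hz hzt
    have hz' : ‖z‖ < ρ (direction z) := hz
    refine half_norm_pow_le_re_pow (le_trans ?_ hnη)
    have h1 := hη₀ (direction z) (by linarith)
    have h2 : √‖(direction z : ℂ) - 1‖ ≤ η := by linarith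
    gcongr
    exact (Real.sqrt_le_iff.1 h2).2
  have hbound : ∀ᶠ k in l, (a - η / 2) ^ n / 2 * (c / 2 * (η / 8) ^ m) ^ 2 *
      (Real.pi * (η ^ 2 / 1024) ^ 2) ≤
      (∫ z in starDomain ρ, ‖(B k).derivative.eval z‖ ^ 2 * (z ^ n).re) +
        (a - η) ^ n * Real.pi := by
    filter_upwards [hunif, hl (eventually_ge_atTop 1)] with k hk hk1
    refine half_pow_mul_le_of_ball_subset hG hGm (by fun_prop) (fun z => by positivity)
      (by linarith) (by linarith) (by positivity) (fun z hz => (htip z hz).1)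
      (fun z hz => ⟨(htip z hz).2.1.le, by linarith [(htip z hz).2.1], ?_⟩) hre
      ((hB k).integral_le_pi hG (by omega))
    have := hk z hz
    gcongr
  have hlim := ge_of_tendsto (((tendsto_integral_mul_re_pow hG hGm hB hn).mono_left hl).add_const
    ((a - η) ^ n * Real.pi)) hbound
  rw [zero_add] at hlim
  have hratio : (a - η) ^ n ≤ (a - η / 2) ^ n * Real.exp (-(n * (η / 2))) := by
    have h1 : a - η ≤ (a - η / 2) * Real.exp (-(η / 2)) := by
      nlinarith [Real.add_one_le_exp (-(η / 2))]
    calc (a - η) ^ n ≤ ((a - η / 2) * Real.exp (-(η / 2))) ^ n :=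
          pow_le_pow_left₀ (by linarith) h1 n
      _ = _ := by rw [mul_pow, ← Real.exp_nat_mul]; ring_nf
  have hs : 0 < (a - η / 2) ^ n := pow_pos (by linarith) n
  have hpi := Real.pi_pos
  have h2 : (a - η / 2) ^ n * Real.pi * ((c / 2 * (η / 8) ^ m) ^ 2 * (η ^ 2 / 1024) ^ 2) ≤
      (a - η / 2) ^ n * Real.pi * (2 * Real.exp (-(n * (η / 2)))) := by
    have := mul_le_mul_of_nonneg_right hratio hpi.le
    linarith
  exact le_of_mul_le_mul_left h2 (by positivity)

lemma not_forall_norm_eval_le {ρ : C(Circle, ℝ)} {a κ η₀ M : ℝ} {K : ℕ}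
    (hρ : ∀ v, 1 / 4 ≤ ρ v) (hρa : ∀ v, ρ v ≤ a) (ha : a ≤ 3 / 4) (hη₀pos : 0 < η₀) (hκpos : 0 < κ)
    (hη₀ : ∀ v : Circle, a - η₀ < ρ v → √‖(v : ℂ) - 1‖ ≤ a - ρ v)
    (hκ : ∀ v : Circle, ‖(v : ℂ) - 1‖ < κ → a - √‖(v : ℂ) - 1‖ ≤ ρ v)
    {B : ℕ → Polynomial ℂ} (hB : ∀ k, IsBieberbachPoly (starDomain ρ) 0 (k + K) (B k))
    {U : Set ℂ} (hU : IsOpen U) (hUc : IsPreconnected U) (h0 : (0 : ℂ) ∈ U) (haU : (a : ℂ) ∈ U) :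
    ¬ ∀ k, ∀ z ∈ U, ‖(B k).eval z‖ ≤ M := by
  intro hM
  have hl : (hyperfilter ℕ : Filter ℕ) ≤ atTop := by
    rw [← Nat.cofinite_eq_atTop]; exact hyperfilter_le_cofinite
  obtain ⟨F, hF⟩ := exists_tendstoLocallyUniformlyOn_of_norm_le hU
    (fun k => (B k).differentiable.differentiableOn) hM (hyperfilter ℕ)
  have hFd := hF.differentiableOn
    (Eventually.of_forall fun k => (B k).differentiable.differentiableOn) hU
  have hBf : TendstoLocallyUniformlyOn (fun k z => (B k).derivative.eval z) (deriv F)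
      (hyperfilter ℕ : Filter ℕ) U := by
    have := hF.deriv (Eventually.of_forall fun k => (B k).differentiable.differentiableOn) hU
    convert this using 2 with k
    ext z
    exact ((B k).hasDerivAt z).deriv.symm
  have hF0 : deriv F 0 = 1 := by
    refine tendsto_nhds_unique (hBf.tendsto_at h0) ?_
    simp only [fun k => (hB k).2.2.1]
    exact tendsto_const_nhds
  obtain ⟨m, c, δ, hc, hδ, hf⟩ := exists_pow_le_norm_of_analyticOnNhd hU hUc (hFd.deriv hU) h0
    (by rw [hF0]; exact one_ne_zero) haU
  have key : ∀ᶠ i : ℕ in atTop, (c / 2 * (1 / 16) ^ m) ^ 2 * (1 / 4096) ^ 2 ≤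
      2 * (16 ^ (m + 2) * (((i : ℝ) / 2) ^ (2 * m + 4) * Real.exp (-((i : ℝ) / 2)))) := by
    have hη : Tendsto (fun i : ℕ => 1 / (2 * (i : ℝ))) atTop (𝓝 0) := by
      refine (((tendsto_natCast_atTop_atTop (R := ℝ)).const_mul_atTop
        two_pos).inv_tendsto_atTop).congr fun i => ?_
      simp
    have hsmall : 0 < min (1 / 8) (min η₀ (min κ (δ / 2))) := by positivity
    filter_upwards [hη.eventually_lt_const hsmall, eventually_gt_atTop 0] with i hi hi0
    have hi' : (0 : ℝ) < i := by exact_mod_cast hi0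
    simp only [lt_min_iff] at hi
    have h := cusp_estimate (η := 1 / (2 * (i : ℝ))) (n := 2 * i ^ 2) hρ hρa ha hη₀ hκ hB hl hU hBf
      hc hf (by positivity) hi.1.le hi.2.1.le hi.2.2.1 (by linarith [hi.2.2.2]) (by positivity)
      (le_of_eq (by push_cast; field_simp))
    have e1 : -(((2 * i ^ 2 : ℕ) : ℝ) * (1 / (2 * (i : ℝ)) / 2)) = -((i : ℝ) / 2) := by
      push_cast; field_simp
    rw [e1] at h
    have e2 : (c / 2 * (1 / (2 * (i : ℝ)) / 8) ^ m) ^ 2 * ((1 / (2 * (i : ℝ))) ^ 2 / 1024) ^ 2 *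
        (i : ℝ) ^ (2 * m + 4) = (c / 2 * (1 / 16) ^ m) ^ 2 * (1 / 4096) ^ 2 := by
      have : (1 / (2 * (i : ℝ)) / 8) = 1 / 16 * (i : ℝ)⁻¹ := by field_simp; norm_num
      rw [this, mul_pow (1 / 16 : ℝ), pow_add, pow_mul', inv_pow]
      field_simp
      norm_num
    have e3 : (16 : ℝ) ^ (m + 2) * ((i : ℝ) / 2) ^ (2 * m + 4) =
        4 ^ (m + 2) * (i : ℝ) ^ (2 * m + 4) := by
      rw [show 2 * m + 4 = 2 * (m + 2) by ring, pow_mul, pow_mul, ← mul_pow, ← mul_pow]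
      ring_nf
    have e4 : (1 : ℝ) ≤ 4 ^ (m + 2) := one_le_pow₀ (by norm_num)
    rw [← e2, ← mul_assoc (16 ^ (m + 2) : ℝ), e3]
    have h5 := mul_le_mul_of_nonneg_right h (by positivity : 0 ≤ (i : ℝ) ^ (2 * m + 4))
    have h6 : 0 ≤ (i : ℝ) ^ (2 * m + 4) * Real.exp (-((i : ℝ) / 2)) := by positivity
    nlinarith
  have hlim : Tendsto (fun i : ℕ => 2 * ((16 : ℝ) ^ (m + 2) *
      (((i : ℝ) / 2) ^ (2 * m + 4) * Real.exp (-((i : ℝ) / 2))))) atTop (𝓝 0) := by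
    have h1 := (Real.tendsto_pow_mul_exp_neg_atTop_nhds_zero (2 * m + 4)).comp
      ((tendsto_natCast_atTop_atTop (R := ℝ)).atTop_div_const two_pos)
    simpa using (h1.const_mul ((16 : ℝ) ^ (m + 2))).const_mul 2
  have := ge_of_tendsto hlim key
  have hpos : 0 < (c / 2 * (1 / 16) ^ m) ^ 2 * (1 / 4096 : ℝ) ^ 2 := by positivity
  linarith

/-- The radial functions that are invariant under conjugation and maximal at `1`. -/
def symmetricRadial : Set C(Circle, ℝ) := {ρ | (∀ v, ρ v⁻¹ = ρ v) ∧ ∀ v, ρ v ≤ ρ 1}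

/-- The radial functions with values in `[1 / 4, 3 / 4]` for which all Bieberbach polynomials of
degree index at least `M` are bounded by `M` on the star domain. -/
def boundedRadial (M : ℕ) : Set C(Circle, ℝ) :=
  {ρ | (∀ v, 1 / 4 ≤ ρ v ∧ ρ v ≤ 3 / 4) ∧ ∀ n, M ≤ n → ∃ B, IsBieberbachPoly (starDomain ρ) 0 n B ∧
    ∀ z ∈ starDomain ρ, ‖B.eval z‖ ≤ M}

lemma isClosed_symmetricRadial : IsClosed symmetricRadial := by
  simp only [symmetricRadial, Set.ofPred_and, Set.ofPred_forall]
  refine (isClosed_iInter fun v => ?_).inter (isClosed_iInter fun v => ?_)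
  · exact isClosed_eq (continuous_eval_const _) (continuous_eval_const _)
  · exact isClosed_le (continuous_eval_const _) (continuous_eval_const _)

lemma exists_bieberbachPoly_norm_le_of_limit {M n : ℕ} {σ : ℕ → C(Circle, ℝ)} {ρ : C(Circle, ℝ)}
    (hσ : ∀ j, σ j ∈ boundedRadial M) (hρ : ∀ v, 0 < ρ v)
    (hae : ∀ᵐ z, ∀ᶠ j in atTop, z ∈ starDomain (σ j) ↔ z ∈ starDomain ρ) (hn : M ≤ n) :
    ∃ P, IsBieberbachPoly (starDomain ρ) 0 n P ∧
      ∀ z, (∀ᶠ j in atTop, z ∈ starDomain (σ j)) → ‖P.eval z‖ ≤ M := by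
  choose B hB hBM using fun j => (hσ j).2 n hn
  have hσ0 : ∀ j v, 0 < σ j v := fun j v => by linarith [((hσ j).1 v).1]
  obtain ⟨P, φ, hφ, hP, hlim⟩ := exists_subseq_tendsto_bieberbachPoly
    (fun j => starDomain_subset_ball fun v => ((hσ j).1 v).2.trans (by norm_num))
    (fun j => (isOpen_starDomain (hσ0 j)).measurableSet) (isOpen_starDomain hρ).measurableSet
    hae hB (fun j z hz => hBM j z (ball_subset_starDomain (fun v => ((hσ j).1 v).1) hz))
  refine ⟨P, hP, fun z hz => le_of_tendsto (hlim z).norm ?_⟩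
  filter_upwards [hφ.tendsto_atTop.eventually hz] with j hj using hBM _ z hj

lemma isClosed_boundedRadial (M : ℕ) : IsClosed (boundedRadial M) := by
  refine IsSeqClosed.isClosed fun σ ρ hσ hlim => ?_
  have hpt : ∀ v, Tendsto (fun j => σ j v) atTop (𝓝 (ρ v)) := fun v =>
    ((continuous_eval_const v).tendsto ρ).comp hlim
  have hρ : ∀ v, 1 / 4 ≤ ρ v ∧ ρ v ≤ 3 / 4 := fun v =>
    ⟨ge_of_tendsto' (hpt v) fun j => ((hσ j).1 v).1, le_of_tendsto' (hpt v) fun j => ((hσ j).1 v).2⟩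
  have hρ0 : ∀ v, 0 < ρ v := fun v => by linarith [(hρ v).1]
  have hin : ∀ z ∈ starDomain ρ, ∀ᶠ j in atTop, z ∈ starDomain (σ j) := fun z hz =>
    (hpt (direction z)).eventually_const_lt hz
  refine ⟨hρ, fun n hn => ?_⟩
  have hae : ∀ᵐ z, ∀ᶠ j in atTop, z ∈ starDomain (σ j) ↔ z ∈ starDomain ρ := by
    filter_upwards [measure_eq_zero_iff_ae_notMem.1 (volume_norm_eq_radial ρ hρ0)] with z hz
    rcases lt_or_gt_of_ne hz with h | h
    · filter_upwards [hin z h] with j hj using ⟨fun _ => h, fun _ => hj⟩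
    · filter_upwards [(hpt (direction z)).eventually_lt_const h] with j hj
      exact ⟨fun h' => absurd h' (not_lt.2 hj.le), fun h' => absurd h' (not_lt.2 h.le)⟩
  obtain ⟨P, hP, hPM⟩ := exists_bieberbachPoly_norm_le_of_limit hσ hρ0 hae hn
  exact ⟨P, hP, fun z hz => hPM z (hin z hz)⟩

lemma ae_direction_ne (u : Circle) : ∀ᵐ z : ℂ, direction z ≠ u := by
  have hne : (Submodule.span ℝ {(u : ℂ)}) ≠ ⊤ := by
    intro h
    have h1 := finrank_span_singleton (K := ℝ) (Circle.coe_ne_zero u)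
    rw [h, finrank_top, Complex.finrank_real_complex] at h1
    omega
  have h0 := Measure.addHaar_submodule (volume : Measure ℂ) _ hne
  filter_upwards [measure_eq_zero_iff_ae_notMem.1 h0] with z hz hzu
  refine hz (Submodule.mem_span_singleton.2 ⟨‖z‖, ?_⟩)
  rw [← hzu, Complex.real_smul, norm_mul_direction]

lemma norm_circle_inv_sub (u v : Circle) :
    ‖((v⁻¹ : Circle) : ℂ) - (u⁻¹ : Circle)‖ = ‖(v : ℂ) - u‖ := by
  rw [Circle.coe_inv_eq_conj, Circle.coe_inv_eq_conj, ← map_sub, RCLike.norm_conj]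

lemma norm_circle_inv_sub_one (v : Circle) : ‖((v⁻¹ : Circle) : ℂ) - 1‖ = ‖(v : ℂ) - 1‖ := by
  simpa using norm_circle_inv_sub 1 v

lemma norm_eval_le_of_perturbation {M n : ℕ} {ρ : C(Circle, ℝ)} {ε : ℝ} (hε : 0 < ε)
    (hρ : ρ ∈ symmetricRadial)
    (h : ∀ σ ∈ symmetricRadial, (∀ v, |σ v - ρ v| ≤ ε) → σ ∈ boundedRadial M) (hn : M ≤ n)
    {B : Polynomial ℂ} (hB : IsBieberbachPoly (starDomain ρ) 0 n B) {q : ℂ}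
    (hq : q ∈ starDomain (ρ + ContinuousMap.const _ ε)) : ‖B.eval q‖ ≤ M := by
  set u := direction q with hu
  let d : Circle → ℝ := fun v =>
    ‖(v : ℂ) - 1‖ * (‖(v : ℂ) - u‖ * ‖(v : ℂ) - (u⁻¹ : Circle)‖)
  have hd0 : ∀ v, 0 ≤ d v := fun v => by positivity
  have hdc : Continuous d := by fun_prop
  have hdinv : ∀ v, d v⁻¹ = d v := fun v => by
    have h1 := norm_circle_inv_sub u v
    have h2 := norm_circle_inv_sub u⁻¹ v
    rw [inv_inv] at h2
    simp only [d, norm_circle_inv_sub_one, h1, h2]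
    ring
  let σ : ℕ → C(Circle, ℝ) := fun j => ⟨fun v => ρ v + ε * max 0 (1 - j * d v), by fun_prop⟩
  have hσ : ∀ j v, σ j v = ρ v + ε * max 0 (1 - j * d v) := fun j v => rfl
  have hbump : ∀ (j : ℕ) v, 0 ≤ max 0 (1 - j * d v) ∧ max 0 (1 - j * d v) ≤ 1 := fun j v =>
    ⟨le_max_left _ _, max_le zero_le_one (by linarith [mul_nonneg (Nat.cast_nonneg' j) (hd0 v)])⟩
  have hd1 : d 1 = 0 := by simp [d]
  have hdu : d u = 0 := by simp [d]
  have hσX : ∀ j, σ j ∈ symmetricRadial := by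
    refine fun j => ⟨fun v => by rw [hσ, hσ, hρ.1, hdinv], fun v => ?_⟩
    rw [hσ, hσ, hd1]
    have := mul_le_mul_of_nonneg_left (hbump j v).2 hε.le
    simpa using add_le_add (hρ.2 v) this
  have hσM : ∀ j, σ j ∈ boundedRadial M := fun j => h _ (hσX j) fun v => by
    rw [hσ, add_sub_cancel_left, abs_of_nonneg (mul_nonneg hε.le (hbump j v).1)]
    exact mul_le_of_le_one_right hε.le (hbump j v).2
  have hρM : ρ ∈ boundedRadial M := h ρ hρ fun v => by simpa using hε.le
  have hev : ∀ v, d v ≠ 0 → ∀ᶠ j : ℕ in atTop, σ j v = ρ v := by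
    intro v hv
    have hv' : 0 < d v := lt_of_le_of_ne (hd0 v) hv.symm
    filter_upwards [((tendsto_natCast_atTop_atTop (R := ℝ)).atTop_mul_const hv').eventually_ge_atTop
      1] with j hj
    rw [hσ, max_eq_left (by linarith), mul_zero, add_zero]
  have hae : ∀ᵐ z, ∀ᶠ j in atTop, z ∈ starDomain (σ j) ↔ z ∈ starDomain ρ := by
    filter_upwards [ae_direction_ne 1, ae_direction_ne u, ae_direction_ne u⁻¹] with z h1 h2 h3
    have hdz : d (direction z) ≠ 0 := by
      have hne : ∀ w : Circle, direction z ≠ w → ‖(direction z : ℂ) - w‖ ≠ 0 := fun w hw =>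
        norm_ne_zero_iff.2 (sub_ne_zero.2 fun h => hw (Circle.ext h))
      exact mul_ne_zero (by simpa using hne 1 h1) (mul_ne_zero (hne u h2) (hne _ h3))
    filter_upwards [hev _ hdz] with j hj
    simp only [starDomain, Set.mem_ofPred_eq, hj]
  have hρ0 : ∀ v, 0 < ρ v := fun v => by linarith [(hρM.1 v).1]
  obtain ⟨P, hP, hPM⟩ := exists_bieberbachPoly_norm_le_of_limit hσM hρ0 hae hn
  have hsub : starDomain ρ ⊆ Metric.ball 0 1 :=
    starDomain_subset_ball fun v => (hρM.1 v).2.trans (by norm_num)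
  have h0 : (0 : ℂ) ∈ starDomain ρ := by
    change ‖(0 : ℂ)‖ < _
    simpa using hρ0 _
  rw [hP.unique hsub (isOpen_starDomain hρ0) h0 hB]
  refine hPM q (Eventually.of_forall fun j => ?_)
  change ‖q‖ < σ j u
  rw [hσ, hdu]
  have hq' : ‖q‖ < ρ u + ε := hq
  simpa using hq'

lemma exists_cusp_approx {ρ : C(Circle, ℝ)} (hρ : ρ ∈ symmetricRadial) {ε : ℝ} (hε : 0 < ε) :
    ∃ (σ : C(Circle, ℝ)) (κ : ℝ), σ ∈ symmetricRadial ∧ (∀ v, |σ v - ρ v| ≤ ε) ∧ 0 < κ ∧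
      (∀ v : Circle, σ 1 - ε < σ v → √‖(v : ℂ) - 1‖ ≤ σ 1 - σ v) ∧
      ∀ v : Circle, ‖(v : ℂ) - 1‖ < κ → σ 1 - √‖(v : ℂ) - 1‖ ≤ σ v := by
  let σ : C(Circle, ℝ) :=
    ⟨fun v => max (ρ v - ε) (min (ρ v + ε) (ρ 1 - √‖(v : ℂ) - 1‖)), by fun_prop⟩
  have hσ : ∀ v, σ v = max (ρ v - ε) (min (ρ v + ε) (ρ 1 - √‖(v : ℂ) - 1‖)) := fun v => rfl
  have hσ1 : σ 1 = ρ 1 := by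
    rw [hσ]
    simp [hε.le]
  obtain ⟨κ, hκ, hκρ⟩ := Metric.continuousAt_iff.1 (ρ.continuous.continuousAt (x := 1)) ε hε
  refine ⟨σ, κ, ⟨fun v => ?_, fun v => ?_⟩, fun v => ?_, hκ, fun v hv => ?_, fun v hv => ?_⟩
  · rw [hσ, hσ, hρ.1, norm_circle_inv_sub_one]
  · rw [hσ1, hσ]
    refine max_le (by linarith [hρ.2 v]) ((min_le_right _ _).trans ?_)
    linarith [Real.sqrt_nonneg ‖(v : ℂ) - 1‖]
  · rw [hσ, abs_le]
    constructor
    · linarith [le_max_left (ρ v - ε) (min (ρ v + ε) (ρ 1 - √‖(v : ℂ) - 1‖))]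
    · have : max (ρ v - ε) (min (ρ v + ε) (ρ 1 - √‖(v : ℂ) - 1‖)) ≤ ρ v + ε :=
        max_le (by linarith) (min_le_left _ _)
      linarith
  · rw [hσ1, hσ] at *
    rcases lt_max_iff.1 hv with h | h
    · linarith [hρ.2 v]
    · have : max (ρ v - ε) (min (ρ v + ε) (ρ 1 - √‖(v : ℂ) - 1‖)) ≤ ρ 1 - √‖(v : ℂ) - 1‖ :=
        max_le (by linarith [hρ.2 v, h.trans_le (min_le_right _ _)]) (min_le_right _ _)
      linarith
  · rw [hσ1, hσ]
    refine le_max_of_le_right (le_min ?_ le_rfl)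
    have h1 := hκρ (x := v) (by
      change dist (v : ℂ) ((1 : Circle) : ℂ) < κ
      rwa [dist_eq_norm])
    rw [Real.dist_eq, abs_lt] at h1
    linarith [Real.sqrt_nonneg ‖(v : ℂ) - 1‖]

lemma exists_near_notMem_boundedRadial (M : ℕ) {ρ : C(Circle, ℝ)} (hρ : ρ ∈ symmetricRadial) {r : ℝ}
    (hr : 0 < r) : ∃ σ ∈ symmetricRadial, dist σ ρ < r ∧ σ ∉ boundedRadial M := by
  by_contra! hcon
  obtain ⟨τ, κ, hτ, hτρ, hκ0, hη₀, hκ⟩ := exists_cusp_approx hρ (by positivity : 0 < r / 3)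
  have h : ∀ σ ∈ symmetricRadial, (∀ v, |σ v - τ v| ≤ r / 3) → σ ∈ boundedRadial M := by
    refine fun σ hσ hστ => hcon σ hσ (lt_of_le_of_lt
      ((ContinuousMap.dist_le (by positivity : 0 ≤ r / 3 + r / 3)).2 fun v => ?_) (by linarith))
    exact (dist_triangle (σ v) (τ v) (ρ v)).trans (add_le_add (hστ v) (hτρ v))
  have hτM : τ ∈ boundedRadial M := h τ hτ fun v => by simpa using (div_pos hr three_pos).le
  have hr3 : 0 < r / 3 := by positivity
  choose B hB _ using fun k => hτM.2 (k + M) (by omega)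
  have hpos : ∀ v, 0 < (τ + ContinuousMap.const _ (r / 3) : C(Circle, ℝ)) v := fun v => by
    have := (hτM.1 v).1
    simp only [ContinuousMap.add_apply, ContinuousMap.const_apply]
    linarith
  refine not_forall_norm_eval_le (M := M) (fun v => (hτM.1 v).1) hτ.2 (hτM.1 1).2 hr3 hκ0 hη₀ hκ hB
    (isOpen_starDomain hpos) (isPreconnected_starDomain hpos) ?_ ?_
    fun k z hz => norm_eval_le_of_perturbation hr3 hτ h (by omega) (hB k) hz
  · change ‖(0 : ℂ)‖ < _
    simpa using hpos (direction 0)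
  · have ha := (hτM.1 1).1
    have h1 : direction ((τ 1 : ℝ) : ℂ) = 1 := by
      have := direction_real_mul (r := τ 1) (by linarith) ((1 : Circle) : ℂ)
      rwa [direction_coe, Circle.coe_one, mul_one] at this
    change ‖((τ 1 : ℝ) : ℂ)‖ < _
    rw [h1, Complex.norm_real, Real.norm_of_nonneg (by linarith)]
    simpa using hr

lemma exists_radial_notMem_boundedRadial : ∃ ρ ∈ symmetricRadial,
    (∀ v, 1 / 4 ≤ ρ v ∧ ρ v ≤ 3 / 4) ∧ ∀ M, ρ ∉ boundedRadial M := by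
  have : CompleteSpace symmetricRadial := isClosed_symmetricRadial.completeSpace_coe
  have hdense : Dense (⋂ M : ℕ, {ρ : symmetricRadial | (ρ : C(Circle, ℝ)) ∉ boundedRadial M}) := by
    refine dense_iInter_of_isOpen_nat (fun M => ?_) fun M => ?_
    · exact ((isClosed_boundedRadial M).preimage continuous_subtype_val).isOpen_compl
    · refine Metric.dense_iff.2 fun ρ r hr => ?_
      obtain ⟨σ, hσ, hd, hσM⟩ := exists_near_notMem_boundedRadial M ρ.2 hr
      exact ⟨⟨σ, hσ⟩, hd, hσM⟩
  obtain ⟨ρ, hρ, hρM⟩ := hdense.exists_dist_lt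
    (⟨ContinuousMap.const _ (1 / 2), fun v => rfl, fun v => le_rfl⟩ : symmetricRadial)
    (by norm_num : (0 : ℝ) < 1 / 4)
  refine ⟨ρ, ρ.2, fun v => ?_, fun M => Set.mem_iInter.1 hρ M⟩
  have h1 := (ContinuousMap.dist_apply_le_dist v).trans_lt hρM
  rw [Real.dist_eq, abs_lt] at h1
  simp only [ContinuousMap.const_apply] at h1
  constructor <;> linarith

lemma frequently_norm_eval_gt {ρ : C(Circle, ℝ)} (hρ : ∀ v, 1 / 4 ≤ ρ v ∧ ρ v ≤ 3 / 4)
    (hρM : ∀ M, ρ ∉ boundedRadial M) {B : ℕ → Polynomial ℂ}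
    (hB : ∀ n, 1 ≤ n → IsBieberbachPoly (starDomain ρ) 0 n (B n)) (M : ℝ) :
    ∃ᶠ n : ℕ in atTop, ∃ z ∈ closure (starDomain ρ), M < ‖(B n).eval z‖ := by
  refine frequently_atTop.2 fun N => ?_
  set K := max (max N 1) ⌈M⌉₊ with hK
  by_contra! hcon
  refine hρM K ⟨hρ, fun n hn => ⟨B n, hB n (by omega), fun z hz => ?_⟩⟩
  refine (hcon n (by omega) z (subset_closure hz)).trans ((Nat.le_ceil M).trans ?_)
  exact_mod_cast le_max_right _ _

lemma not_tendstoUniformlyOn_of_frequently {G : Set ℂ} (hG : IsCompact G) {B : ℕ → Polynomial ℂ}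
    (h : ∀ M : ℝ, ∃ᶠ n : ℕ in atTop, ∃ z ∈ G, M < ‖(B n).eval z‖) (f : ℂ → ℂ) :
    ¬ TendstoUniformlyOn (fun (n : ℕ) (z : ℂ) => (B n).eval z) f atTop G := by
  intro hf
  have h1 := Metric.tendstoUniformlyOn_iff.1 hf 1 one_pos
  obtain ⟨N, hN⟩ := h1.exists
  obtain ⟨C, hC⟩ := hG.exists_bound_of_continuousOn (B N).continuous.continuousOn
  obtain ⟨n, ⟨z, hz, hzn⟩, hn⟩ := ((h (C + 2)).and_eventually h1).exists
  have h2 := dist_triangle_left ((B n).eval z) ((B N).eval z) (f z)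
  have h3 := norm_sub_norm_le ((B n).eval z) ((B N).eval z)
  rw [dist_eq_norm ((B n).eval z)] at h2
  linarith [hN z hz, hn z hz, hC z hz]

/-- **Keldysh-type example (Theorem 2).** There exists a Jordan domain `G`
inside the unit disk, symmetric in the real axis, containing `0`, whose
Bieberbach polynomials with respect to `z₀ = 0` satisfy
`limsup_n sup_{z ∈ cl G} |B_n(z)| = ∞`; in particular they do not converge
uniformly on `cl G`. -/
theorem exists_jordan_domain_with_divergent_bieberbach_polys :
    ∃ G : Set ℂ, IsJordanDomain G ∧ G ⊆ Metric.ball (0 : ℂ) 1 ∧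
      (∀ z : ℂ, z ∈ G ↔ (starRingEnd ℂ) z ∈ G) ∧ (0 : ℂ) ∈ G ∧
      ∀ B : ℕ → Polynomial ℂ, (∀ n, 1 ≤ n → IsBieberbachPoly G 0 n (B n)) →
        (∀ M : ℝ, ∃ᶠ n : ℕ in atTop, ∃ z ∈ closure G, M < ‖(B n).eval z‖) ∧
        ¬ ∃ f : ℂ → ℂ,
            TendstoUniformlyOn (fun (n : ℕ) (z : ℂ) => (B n).eval z) f atTop
              (closure G) := by
  obtain ⟨ρ, hρX, hρ, hρM⟩ := exists_radial_notMem_boundedRadial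
  have hρ0 : ∀ v, 0 < ρ v := fun v => by linarith [(hρ v).1]
  have hJ := isJordanDomain_starDomain hρ0
  refine ⟨starDomain ρ, hJ, starDomain_subset_ball fun v => (hρ v).2.trans (by norm_num),
    conj_mem_starDomain hρX.1, ?_, fun B hB => ?_⟩
  · exact ball_subset_starDomain (fun v => (hρ v).1) (by simp)
  · have h := frequently_norm_eval_gt hρ hρM hB
    exact ⟨h, fun ⟨f, hf⟩ =>
      not_tendstoUniformlyOn_of_frequently hJ.2.1.isCompact_closure h f hf⟩
end
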